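/- For all integers k, Δ > 1 and reals d, μ > 0 there exist ρ > 0 and n₀ such that the following holds for every n ≥ n₀. Let G be a (ρ,d)-dense graph on n vertices with minimum degree δ(G) ≥ μn, and let H be an 𝓕_c(k, √n/log n)-tiling on n vertices with chromatic number χ(H) ≤ k and Δ(H) ≤ Δ. Then H is a subgraph of G. -/

import Mathlib

open scoped Classical

namespace Paper

noncomputable section

variable {V : Type} [Fintype V]

/-- The degree of a vertex, via `Set.ncard`. -/
def ndeg (G : SimpleGraph V) (v : V) : ℕ := (G.neighborSet v).ncard

/-- A proper colouring with colours `0, …, k-1`. -/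
def ProperCol (G : SimpleGraph V) (k : ℕ) (C : V → ℕ) : Prop :=
  (∀ v, C v < k) ∧ ∀ ⦃u v⦄, G.Adj u v → C u ≠ C v

/-- A topological colouring with colours `0, …, k-1`: every edge is monochromatic. -/
def TopCol (G : SimpleGraph V) (k : ℕ) (C : V → ℕ) : Prop :=
  (∀ v, C v < k) ∧ ∀ ⦃u v⦄, G.Adj u v → C u = C v

/-- The size of the `i`-th colour class of a colouring. -/
def classCard (C : V → ℕ) (i : ℕ) : ℕ := {v | C v = i}.ncard

/-- The chromatic number, as a natural number. -/
def chromNum (G : SimpleGraph V) : ℕ := G.chromaticNumber.toNat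

/-- The size of the smallest colour class of a colouring with `k` colours. -/
def minClassCard (C : V → ℕ) (k : ℕ) : ℕ := sInf {a | ∃ i < k, a = classCard C i}

/-- The minimum, over proper `χ(G)`-colourings, of the size of the smallest colour class. -/
def alphaNat (G : SimpleGraph V) : ℕ :=
  sInf {a | ∃ C, ProperCol G (chromNum G) C ∧ a = minClassCard C (chromNum G)}

/-- `α(G)`: minimum proportion of vertices in a single colour class over proper
`χ(G)`-colourings. -/
def alphaR (G : SimpleGraph V) : ℝ := (alphaNat G : ℝ) / (Fintype.card V : ℝ)

/-- The critical chromatic number `crit(G) = (χ(G) − 1)/(1 − α(G))`. -/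
def critR (G : SimpleGraph V) : ℝ := ((chromNum G : ℝ) - 1) / (1 - alphaR G)

/-- `𝒟(G)`: values `||φ⁻¹(0)| − |φ⁻¹(1)||` over proper `χ(G)`-colourings `φ`. -/
def DSet (G : SimpleGraph V) : Set ℕ :=
  {d | ∃ C, ProperCol G (chromNum G) C ∧
    d = ((classCard C 0 : ℤ) - (classCard C 1 : ℤ)).natAbs}

/-- The set `S ⊆ ℕ` has greatest common divisor `1`.  (Elements `0` are immaterial, and this
fails when `S ⊆ {0}`, matching the convention `gcd = ∞` in that case.) -/
def GcdOne (S : Set ℕ) : Prop := ∃ T : Finset ℕ, ↑T ⊆ S ∧ T.gcd id = 1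

/-- The orders of the connected components of `G`. -/
def compOrders (G : SimpleGraph V) : Set ℕ :=
  {m | ∃ c : G.ConnectedComponent, m = c.supp.ncard}

/-- Membership in the class `𝓕_cr`. -/
def IsFcr (G : SimpleGraph V) : Prop :=
  (G.chromaticNumber = 2 ∧ GcdOne (DSet G) ∧ GcdOne (compOrders G)) ∨
  (3 ≤ G.chromaticNumber ∧ GcdOne (DSet G))

/-- `H` is a tiling whose tiles satisfy the (isomorphism-invariant) predicate `tile`:
the vertex set partitions into parts with no edges of `H` between distinct parts, each part
inducing a graph satisfying `tile`. -/
def IsTiling (H : SimpleGraph V) (tile : ∀ (W : Type) [Fintype W], SimpleGraph W → Prop) : Prop :=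
  ∃ P : Set (Set V), Setoid.IsPartition P ∧
    (∀ p ∈ P, ∀ q ∈ P, p ≠ q → ∀ u ∈ p, ∀ v ∈ q, ¬ H.Adj u v) ∧
    ∀ p ∈ P, tile ↥p (H.induce p)

/-- Tiles of order at most `w`. -/
def TileLe (w : ℕ) (W : Type) [Fintype W] (F : SimpleGraph W) : Prop := Fintype.card W ≤ w

/-- Tiles in `𝓕(k, w)`: properly `k`-colourable of order at most `w` (real bound `w`). -/
def TileCol (k : ℕ) (w : ℝ) (W : Type) [Fintype W] (F : SimpleGraph W) : Prop :=
  F.Colorable k ∧ (Fintype.card W : ℝ) ≤ w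

/-- Tiles in `𝓕_cr(k, w)` (real bound `w`). -/
def TileFcr (k : ℕ) (w : ℝ) (W : Type) [Fintype W] (F : SimpleGraph W) : Prop :=
  IsFcr F ∧ F.Colorable k ∧ (Fintype.card W : ℝ) ≤ w

/-- Tiles in `𝓕_c(k, w)` (real bound `w`). -/
def TileFc (k : ℕ) (w : ℝ) (W : Type) [Fintype W] (F : SimpleGraph W) : Prop :=
  GcdOne (compOrders F) ∧ F.Colorable k ∧ (Fintype.card W : ℝ) ≤ w

/-- Tiles isomorphic to a fixed graph `F₀`. -/
def TileIso {m : ℕ} (F₀ : SimpleGraph (Fin m)) (W : Type) [Fintype W]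
    (F : SimpleGraph W) : Prop :=
  Nonempty (F ≃g F₀)

/-- `G` contains a copy of `H` as a (not necessarily induced) subgraph. -/
def ContainsCopy {V' : Type} (G : SimpleGraph V) (H : SimpleGraph V') : Prop :=
  ∃ f : V' → V, Function.Injective f ∧ ∀ ⦃u v⦄, H.Adj u v → G.Adj (f u) (f v)

/-- `H` is properly `(k, s)`-flexi-chromatic. -/
def ProperlyFlexi (H : SimpleGraph V) (k s : ℕ) : Prop :=
  ∃ φ, ProperCol H k φ ∧ ∀ w : Fin k → ℤ, ∑ i, w i = 0 → (∀ i, |w i| ≤ (s : ℤ)) →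
    ∃ φ', ProperCol H k φ' ∧
      ∀ i : Fin k, (classCard φ (i : ℕ) : ℤ) - classCard φ' (i : ℕ) = w i

/-- `H` is topologically `(k, s)`-flexi-chromatic. -/
def TopFlexi (H : SimpleGraph V) (k s : ℕ) : Prop :=
  ∃ φ, TopCol H k φ ∧ ∀ w : Fin k → ℤ, ∑ i, w i = 0 → (∀ i, |w i| ≤ (s : ℤ)) →
    ∃ φ', TopCol H k φ' ∧
      ∀ i : Fin k, (classCard φ (i : ℕ) : ℤ) - classCard φ' (i : ℕ) = w i

/-- `A` is a union of connected components of `H` (the vertex set of a subtiling). -/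
def CompClosed (H : SimpleGraph V) (A : Set V) : Prop :=
  ∀ ⦃u v⦄, H.Reachable u v → u ∈ A → v ∈ A

/-- `H` contains `t` pairwise disjoint properly `(k, s)`-flexi-chromatic subtilings together
with one further disjoint topologically `(ℓ, s')`-flexi-chromatic subtiling, each of order at
most `w'`. -/
def HasFlexiSubtilings (H : SimpleGraph V) (t ℓ k s s' w' : ℕ) : Prop :=
  ∃ (A : Fin t → Set V) (B : Set V),
    (∀ i, CompClosed H (A i)) ∧ CompClosed H B ∧
    (∀ i j, i ≠ j → Disjoint (A i) (A j)) ∧ (∀ i, Disjoint (A i) B) ∧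
    (∀ i, (A i).ncard ≤ w') ∧ B.ncard ≤ w' ∧
    (∀ i, ProperlyFlexi (H.induce (A i)) k s) ∧
    TopFlexi (H.induce B) ℓ s'

/-- `H ∈ ℋ(n, w, Δ; χ; t, ℓ, w')`. -/
def InH (H : SimpleGraph V) (n w : ℕ) (Δ χ : ℝ) (t ℓ w' : ℕ) : Prop :=
  Fintype.card V ≤ n ∧ (∀ v, (ndeg H v : ℝ) ≤ Δ) ∧ IsTiling H (TileLe w) ∧
  critR H ≤ χ ∧ HasFlexiSubtilings H t ℓ ⌈χ⌉₊ (⌈χ⌉₊ * w) w w'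

/-- The tight adjacency graph `T(J)` on the edge set `E` of a `k`-uniform hypergraph. -/
def TGraph (k : ℕ) (E : Set (Finset V)) : SimpleGraph ↥E :=
  SimpleGraph.fromRel fun e f => ((e : Finset V) ∩ (f : Finset V)).card = k - 1

/-- The number of tight components. -/
def tightCount (k : ℕ) (E : Set (Finset V)) : ℕ := Nat.card (TGraph k E).ConnectedComponent

/-- The vertex support of a tight component. -/
def tcSupp (k : ℕ) (E : Set (Finset V)) (c : (TGraph k E).ConnectedComponent) : Set V :=
  {v | ∃ e : ↥E, (TGraph k E).connectedComponentMk e = c ∧ v ∈ (e : Finset V)}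

/-- The loose adjacency graph `L(J)` on the tight components. -/
def LGraph (k : ℕ) (E : Set (Finset V)) : SimpleGraph (TGraph k E).ConnectedComponent :=
  SimpleGraph.fromRel fun c c' => (tcSupp k E c ∩ tcSupp k E c').Nonempty

/-- The number of loose components. -/
def looseCount (k : ℕ) (E : Set (Finset V)) : ℕ := Nat.card (LGraph k E).ConnectedComponent

/-- `(t, ℓ)`-connectedness: some vertex-spanning subhypergraph has at most `t` tight
components and at most `ℓ` loose components. -/
def ConnectedTL (k : ℕ) (E : Set (Finset V)) (t ℓ : ℕ) : Prop :=
  ∃ E' ⊆ E, (∀ v : V, ∃ e ∈ E', v ∈ e) ∧ tightCount k E' ≤ t ∧ looseCount k E' ≤ ℓ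

/-- Every vertex is linked to some edge. -/
def Linked (k : ℕ) (E : Set (Finset V)) : Prop :=
  ∀ v : V, ∃ f ∈ E, v ∉ f ∧ ∃ e ∈ E, v ∈ e ∧ (e ∩ f).card = k - 1

/-- `ω` is a fractional `F`-tiling of `G`. -/
def IsFracTiling {α : Type} [Fintype α] (F : SimpleGraph α) (G : SimpleGraph V)
    (ω : (F →g G) → ℝ) : Prop :=
  (∀ θ, 0 ≤ ω θ ∧ ω θ ≤ 1) ∧
  ∀ v : V, (∑ᶠ θ : F →g G, ω θ * ({u | θ u = v}.ncard : ℝ)) ≤ 1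

/-- The weight of a fractional tiling. -/
def fracWeight {α : Type} [Fintype α] (F : SimpleGraph α) (G : SimpleGraph V)
    (ω : (F →g G) → ℝ) : ℝ :=
  (Fintype.card α : ℝ) * ∑ᶠ θ : F →g G, ω θ

/-- For a rational `q > 1`, the numerator `a` in `q = ⌊q⌋ + a/b`. -/
def aB (q : ℚ) : ℕ := (q - (⌊q⌋ : ℚ)).num.toNat

/-- For a rational `q > 1`, the denominator `b` in `q = ⌊q⌋ + a/b`. -/
def bB (q : ℚ) : ℕ := (q - (⌊q⌋ : ℚ)).den

/-- The bottle graph `B_q`: complete `⌈q⌉`-partite with one part of size `a` and the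
remaining `⌈q⌉ − 1` parts of size `b`. -/
def Bgraph (q : ℚ) : SimpleGraph (Σ i : Fin ⌈q⌉₊, Fin (if (i : ℕ) = 0 then aB q else bB q)) :=
  SimpleGraph.completeMultipartiteGraph fun i : Fin ⌈q⌉₊ => Fin (if (i : ℕ) = 0 then aB q else bB q)

/-- `G` is a `(q, ρ; t, ℓ)`-tiling framework. -/
def TilingFramework (G : SimpleGraph V) (q : ℚ) (ρ : ℝ) (t ℓ : ℕ) : Prop :=
  (∃ ω, IsFracTiling (Bgraph q) G ω ∧
      (1 - ρ) * (Fintype.card V : ℝ) ≤ fracWeight (Bgraph q) G ω) ∧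
  ConnectedTL ⌈q⌉₊ (G.cliqueSet ⌈q⌉₊) t ℓ ∧
  Linked ⌈q⌉₊ (G.cliqueSet ⌈q⌉₊)

/-- `G'` (on the vertex set `S`) is an `(ε, d)`-approximation of `G`. -/
def IsApprox (G : SimpleGraph V) (ε d : ℝ) (S : Set V) (G' : SimpleGraph ↥S) : Prop :=
  G' ≤ G.induce S ∧ (1 - ε) * (Fintype.card V : ℝ) ≤ (S.ncard : ℝ) ∧
  ∀ v : ↥S, (ndeg G (v : V) : ℝ) - d * (Fintype.card V : ℝ) ≤ (ndeg G' v : ℝ)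

/-- `G` is `μ`-robustly a `(q, ρ; t, ℓ)`-tiling framework. -/
def RobustFramework (G : SimpleGraph V) (μ : ℝ) (q : ℚ) (ρ : ℝ) (t ℓ : ℕ) : Prop :=
  ∀ (S : Set V) (G' : SimpleGraph ↥S), IsApprox G μ μ S G' → TilingFramework G' q ρ t ℓ

/-- `α(χ) = 1 − (⌈χ⌉ − 1)/χ`. -/
def alphaOf (χ : ℝ) : ℝ := 1 - ((⌈χ⌉₊ : ℝ) - 1) / χ

/-- The degree sequence of `G` is `(χ, μ)`-strong. -/
def DegSeqStrong (G : SimpleGraph V) (χ μ : ℝ) : Prop :=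
  ∃ e : Fin (Fintype.card V) ≃ V,
    (∀ i j, i ≤ j → ndeg G (e i) ≤ ndeg G (e j)) ∧
    ∀ i : Fin (Fintype.card V), ((i : ℕ) + 1 : ℝ) ≤ (Fintype.card V : ℝ) / χ →
      (1 - 1 / χ - alphaOf χ) * (Fintype.card V : ℝ) + χ * alphaOf χ * ((i : ℕ) + 1) +
          μ * (Fintype.card V : ℝ) ≤ (ndeg G (e i) : ℝ)

/-- `G` is uniformly `(ρ, d)`-dense. -/
def UniformlyDense (G : SimpleGraph V) (ρ d : ℝ) : Prop :=
  ∀ U : Set V, d * (U.ncard : ℝ) ^ 2 / 2 - ρ * (Fintype.card V : ℝ) ^ 2 ≤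
    ((G.induce U).edgeSet.ncard : ℝ)

/-- `p`-approximately `(k, s)`-flexi-chromatic with central colouring `φ`, generic in the
kind of colouring `Col` (proper or topological). -/
def ApproxFlexiWith {V : Type} (Col : ℕ → (V → ℕ) → Prop) (k s p : ℕ) (φ : V → ℕ) : Prop :=
  Col k φ ∧ ∀ w : Fin k → ℤ, ∑ i, w i = 0 → (∀ i, |w i| ≤ (s : ℤ)) →
    ∃ φ', Col k φ' ∧
      ∀ i : Fin k, |(classCard φ (i : ℕ) : ℤ) - classCard φ' (i : ℕ) - w i| ≤ (p : ℤ)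

/-- The vertex support of a hypergraph edge set. -/
def hsupp (E : Set (Finset V)) : Set V := {v | ∃ e ∈ E, v ∈ e}

/-- The reachability graph `ℛ(T)` on the vertex set of `T`. -/
def RGraph (k : ℕ) (T : Set (Finset V)) : SimpleGraph ↥(hsupp T) :=
  SimpleGraph.fromRel fun x y => ∃ e ∈ T, ∃ f ∈ T,
    (x : V) ∈ e ∧ (x : V) ∉ f ∧ (y : V) ∈ f ∧ (y : V) ∉ e ∧ (e ∩ f).card = k - 1

end

/-- Weighted number of related pairs between `A` and `B`. -/
noncomputable def wEdges {α β : Type*} (r : α → β → Prop) (p : α → ℝ) (q : β → ℝ)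
    (A : Finset α) (B : Finset β) : ℝ :=
  ∑ a ∈ A, ∑ b ∈ B, if r a b then p a * q b else 0

/-- Any two subsets of `A` and `B` of relative weight at least `δ` have density at least `ε`. -/
def Bidense {α β : Type*} (r : α → β → Prop) (p : α → ℝ) (q : β → ℝ) (δ ε : ℝ)
    (A : Finset α) (B : Finset β) : Prop :=
  ∀ A' ⊆ A, ∀ B' ⊆ B, δ * ∑ a ∈ A, p a ≤ ∑ a ∈ A', p a → δ * ∑ b ∈ B, q b ≤ ∑ b ∈ B', q b →
    ε * ((∑ a ∈ A', p a) * ∑ b ∈ B', q b) ≤ wEdges r p q A' B'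

section Weighted

variable {α β : Type*} {r : α → β → Prop} {p : α → ℝ} {q : β → ℝ}

lemma wEdges_nonneg (hp : ∀ a, 0 ≤ p a) (hq : ∀ b, 0 ≤ q b) (A : Finset α) (B : Finset β) :
    0 ≤ wEdges r p q A B := by
  unfold wEdges
  refine Finset.sum_nonneg fun a _ => Finset.sum_nonneg fun b _ => ?_
  split_ifs
  · exact mul_nonneg (hp a) (hq b)
  · exact le_rfl

lemma wEdges_le (hp : ∀ a, 0 ≤ p a) (hq : ∀ b, 0 ≤ q b) (A : Finset α) (B : Finset β) :
    wEdges r p q A B ≤ (∑ a ∈ A, p a) * ∑ b ∈ B, q b := by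
  unfold wEdges
  rw [Finset.sum_mul_sum]
  refine Finset.sum_le_sum fun a _ => Finset.sum_le_sum fun b _ => ?_
  split_ifs
  · exact le_rfl
  · exact mul_nonneg (hp a) (hq b)

lemma wEdges_sdiff_left {A' A : Finset α} (h : A' ⊆ A) (B : Finset β) :
    wEdges r p q A' B = wEdges r p q A B - wEdges r p q (A \ A') B := by
  unfold wEdges
  rw [← Finset.sum_sdiff h]; ring

lemma wEdges_sdiff_right (A : Finset α) {B' B : Finset β} (h : B' ⊆ B) :
    wEdges r p q A B' = wEdges r p q A B - wEdges r p q A (B \ B') := by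
  unfold wEdges
  rw [← Finset.sum_sub_distrib]
  refine Finset.sum_congr rfl fun a _ => ?_
  rw [← Finset.sum_sdiff h]; ring

lemma wEdges_symm (r : α → β → Prop) (p : α → ℝ) (q : β → ℝ) (A : Finset α) (B : Finset β) :
    wEdges r p q A B = wEdges (fun b a => r a b) q p B A := by
  unfold wEdges
  rw [Finset.sum_comm]
  simp only [mul_comm]

lemma Bidense.symm {δ ε : ℝ} {A : Finset α} {B : Finset β} (h : Bidense r p q δ ε A B) :
    Bidense (fun b a => r a b) q p δ ε B A := by
  intro B' hB A' hA h1 h2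
  rw [← wEdges_symm, mul_comm (∑ b ∈ B', q b)]
  exact h A' hA B' hB h2 h1

lemma Bidense.mono_subset {δ δ' ε : ℝ} {A A₁ : Finset α} {B B₁ : Finset β}
    (h : Bidense r p q δ ε A B) (hA : A₁ ⊆ A) (hB : B₁ ⊆ B)
    (h1 : δ * ∑ a ∈ A, p a ≤ δ' * ∑ a ∈ A₁, p a) (h2 : δ * ∑ b ∈ B, q b ≤ δ' * ∑ b ∈ B₁, q b) :
    Bidense r p q δ' ε A₁ B₁ :=
  fun A' hA' B' hB' h3 h4 => h A' (hA'.trans hA) B' (hB'.trans hB) (h1.trans h3) (h2.trans h4)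

/-- A pair of positive density contains a large pair that is dense on all large subpairs. -/
lemma exists_bidense (hp : ∀ a, 0 ≤ p a) (hq : ∀ b, 0 ≤ q b) {δ d : ℝ} (hδ : 0 < δ) (hδ1 : δ ≤ 1)
    (hd : 0 < d) (A₀ : Finset α) (B₀ : Finset β)
    (hP : 0 < ∑ a ∈ A₀, p a) (hQ : 0 < ∑ b ∈ B₀, q b)
    (hdens : d * ((∑ a ∈ A₀, p a) * ∑ b ∈ B₀, q b) ≤ wEdges r p q A₀ B₀) :
    ∃ A ⊆ A₀, ∃ B ⊆ B₀, d ^ (4 / δ ^ 2) * ∑ a ∈ A₀, p a ≤ ∑ a ∈ A, p a ∧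
      d ^ (4 / δ ^ 2) * ∑ b ∈ B₀, q b ≤ ∑ b ∈ B, q b ∧ Bidense r p q δ (d / 2) A B := by
  set η : ℝ := δ ^ 2 / 4 with hη
  have hη0 : 0 < η := by positivity
  have hη1 : η < 1 := by nlinarith
  have hηi : 4 / δ ^ 2 = η⁻¹ := by rw [hη]; field_simp
  set P : Finset α → ℝ := fun A => ∑ a ∈ A, p a with hPd
  set Q : Finset β → ℝ := fun B => ∑ b ∈ B, q b with hQd
  have hP0 : ∀ A, 0 ≤ P A := fun A => Finset.sum_nonneg fun a _ => hp a
  have hQ0 : ∀ B, 0 ≤ Q B := fun B => Finset.sum_nonneg fun b _ => hq b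
  have hPm : ∀ {A A'}, A' ⊆ A → P A' ≤ P A := fun h =>
    Finset.sum_le_sum_of_subset_of_nonneg h fun a _ _ => hp a
  have hQm : ∀ {B B'}, B' ⊆ B → Q B' ≤ Q B := fun h =>
    Finset.sum_le_sum_of_subset_of_nonneg h fun a _ _ => hq a
  set e : Finset α → Finset β → ℝ := wEdges r p q with he
  have he0 : ∀ A B, 0 ≤ e A B := wEdges_nonneg hp hq
  have hele : ∀ A B, e A B ≤ P A * Q B := wEdges_le hp hq
  set F : Finset α × Finset β → ℝ := fun x => e x.1 x.2 / (P x.1 * Q x.2) ^ (1 - η) with hF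
  obtain ⟨⟨A, B⟩, hAB, hmax⟩ := Finset.exists_max_image (A₀.powerset ×ˢ B₀.powerset) F
    ⟨(A₀, B₀), by simp⟩
  rw [Finset.mem_product, Finset.mem_powerset, Finset.mem_powerset] at hAB
  obtain ⟨hA, hB⟩ := hAB
  simp only at hA hB
  have hPQ0 : 0 < P A₀ * Q B₀ := mul_pos hP hQ
  have hmax0 : F (A₀, B₀) ≤ F (A, B) := hmax _ (by simp)
  have hF0 : d * (P A₀ * Q B₀) ^ η ≤ F (A₀, B₀) := by
    simp only [hF]
    rw [le_div_iff₀ (by positivity), mul_assoc, ← Real.rpow_add hPQ0]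
    simpa using hdens
  have hFpos : 0 < F (A, B) := lt_of_lt_of_le (by positivity) (hF0.trans hmax0)
  have hPQ : 0 < P A * Q B := by
    rcases (mul_nonneg (hP0 A) (hQ0 B)).lt_or_eq with h | h
    · exact h
    · exfalso
      have : e A B = 0 := le_antisymm (h ▸ hele A B) (he0 A B)
      simp [hF, this] at hFpos
  have hPA : 0 < P A := lt_of_le_of_ne (hP0 A) fun h => by simp [← h] at hPQ
  have hQB : 0 < Q B := lt_of_le_of_ne (hQ0 B) fun h => by simp [← h] at hPQ
  have hE : d * (P A₀ * Q B₀) ^ η * (P A * Q B) ^ (1 - η) ≤ e A B := by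
    have := hF0.trans hmax0
    simp only [hF] at this
    rwa [le_div_iff₀ (by positivity)] at this
  have hPQle : P A * Q B ≤ P A₀ * Q B₀ := mul_le_mul (hPm hA) (hQm hB) (hQ0 B) (hP0 _)
  have hE1 : d * (P A * Q B) ≤ e A B := by
    refine le_trans ?_ hE
    have h1 : P A * Q B = (P A * Q B) ^ η * (P A * Q B) ^ (1 - η) := by
      rw [← Real.rpow_add hPQ]; simp
    calc d * (P A * Q B) = d * (P A * Q B) ^ η * (P A * Q B) ^ (1 - η) := by
          rw [mul_assoc, ← h1]
      _ ≤ _ := by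
        gcongr
  have hratio : d ^ η⁻¹ * (P A₀ * Q B₀) ≤ P A * Q B := by
    have h1 : d * (P A₀ * Q B₀) ^ η * (P A * Q B) ^ (1 - η) ≤
        (P A * Q B) ^ η * (P A * Q B) ^ (1 - η) := by
      rw [← Real.rpow_add hPQ]
      simpa using hE.trans (hele A B)
    have h2 := le_of_mul_le_mul_right h1 (by positivity)
    have h3 := Real.rpow_le_rpow (by positivity) h2 (inv_nonneg.2 hη0.le)
    rwa [Real.mul_rpow hd.le (by positivity), Real.rpow_rpow_inv hPQ0.le hη0.ne',
      Real.rpow_rpow_inv hPQ.le hη0.ne'] at h3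
  have key : ∀ A₁ ⊆ A, ∀ B₁ ⊆ B, e A₁ B₁ ≤ e A B * (P A₁ / P A * (Q B₁ / Q B) + η) := by
    intro A₁ hA₁ B₁ hB₁
    have ht0 : 0 ≤ P A₁ / P A * (Q B₁ / Q B) :=
      mul_nonneg (div_nonneg (hP0 _) (hP0 _)) (div_nonneg (hQ0 _) (hQ0 _))
    rcases (mul_nonneg (hP0 A₁) (hQ0 B₁)).lt_or_eq with h | h
    · have h1 : F (A₁, B₁) ≤ F (A, B) := hmax _ (by
        simp only [Finset.mem_product, Finset.mem_powerset]
        exact ⟨hA₁.trans hA, hB₁.trans hB⟩)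
      simp only [hF] at h1
      rw [div_le_div_iff₀ (by positivity) (by positivity)] at h1
      set t := P A₁ / P A * (Q B₁ / Q B) with ht
      have h2 : e A₁ B₁ ≤ e A B * t ^ (1 - η) := by
        have h3 : P A₁ * Q B₁ = t * (P A * Q B) := by
          rw [ht]; field_simp
        rw [h3, Real.mul_rpow ht0 hPQ.le, ← mul_assoc] at h1
        exact le_of_mul_le_mul_right h1 (by positivity)
      have h4 := Real.geom_mean_le_arith_mean2_weighted (w₁ := 1 - η) (w₂ := η) (p₁ := t)
        (p₂ := 1) (by linarith) hη0.le ht0 zero_le_one (by ring)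
      rw [Real.one_rpow] at h4
      refine h2.trans (mul_le_mul_of_nonneg_left ?_ (he0 _ _))
      nlinarith
    · have h5 : e A₁ B₁ ≤ 0 := h ▸ hele A₁ B₁
      exact h5.trans (mul_nonneg (he0 _ _) (by positivity))
  refine ⟨A, hA, B, hB, ?_, ?_, ?_⟩
  · rw [hηi]
    have : d ^ η⁻¹ * P A₀ * Q B₀ ≤ P A * Q B₀ :=
      (by linarith : d ^ η⁻¹ * P A₀ * Q B₀ ≤ P A * Q B).trans
        (mul_le_mul_of_nonneg_left (hQm hB) (hP0 _))
    exact le_of_mul_le_mul_right this hQ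
  · rw [hηi]
    have : P A₀ * (d ^ η⁻¹ * Q B₀) ≤ P A₀ * Q B :=
      (by linarith : P A₀ * (d ^ η⁻¹ * Q B₀) ≤ P A * Q B).trans
        (mul_le_mul_of_nonneg_right (hPm hA) (hQ0 _))
    exact le_of_mul_le_mul_left this hP
  · intro A' hA' B' hB' h1 h2
    change δ * P A ≤ P A' at h1
    change δ * Q B ≤ Q B' at h2
    change d / 2 * (P A' * Q B') ≤ e A' B'
    have h3 : e A' B' = e A B - e (A \ A') B - e A' (B \ B') := by
      simp only [he]
      rw [wEdges_sdiff_right A' hB', wEdges_sdiff_left hA' B]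
    have h4 := key (A \ A') Finset.sdiff_subset B subset_rfl
    have h5 := key A' hA' (B \ B') Finset.sdiff_subset
    have hPs : P (A \ A') = P A - P A' := by
      simp only [hPd]; rw [← Finset.sum_sdiff hA']; ring
    have hQs : Q (B \ B') = Q B - Q B' := by
      simp only [hQd]; rw [← Finset.sum_sdiff hB']; ring
    rw [hPs, div_self hQB.ne', sub_div, div_self hPA.ne'] at h4
    rw [hQs, sub_div, div_self hQB.ne'] at h5
    set x := P A' / P A with hx
    set y := Q B' / Q B with hy
    have hx' : δ ≤ x := by rw [hx, le_div_iff₀ hPA]; exact h1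
    have hy' : δ ≤ y := by rw [hy, le_div_iff₀ hQB]; exact h2
    have hxy : δ ^ 2 ≤ x * y := by nlinarith
    have h6 : e A B * (x * y / 2) ≤ e A' B' := by
      have h7 : e A B * (x * y / 2) ≤ e A B * (x * y - 2 * η) :=
        mul_le_mul_of_nonneg_left (by rw [hη]; linarith) (he0 _ _)
      rw [h3]; nlinarith
    refine le_trans ?_ h6
    have h8 : P A' * Q B' = (P A * Q B) * (x * y) := by
      rw [hx, hy]; field_simp
    rw [h8]
    have : 0 ≤ x * y := by nlinarith
    linarith [mul_le_mul_of_nonneg_right hE1 this]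

end Weighted

/-- Number of ordered adjacent pairs in `A × B`. -/
noncomputable abbrev adjPairs {V : Type} (G : SimpleGraph V) (A B : Finset V) : ℝ :=
  wEdges G.Adj (fun _ => 1) (fun _ => 1) A B

/-- All vertex sets of size at least `m` have density at least `d`. -/
def LocDense {V : Type} (G : SimpleGraph V) (d m : ℝ) (U₀ : Finset V) : Prop :=
  ∀ U ⊆ U₀, m ≤ (U.card : ℝ) → d * (U.card : ℝ) ^ 2 ≤ adjPairs G U U

lemma Bidense.mono_density {α β : Type*} {r : α → β → Prop} {p : α → ℝ} {q : β → ℝ}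
    (hp : ∀ a, 0 ≤ p a) (hq : ∀ b, 0 ≤ q b) {δ ε ε' : ℝ} {A : Finset α} {B : Finset β}
    (h : Bidense r p q δ ε A B) (hε : ε' ≤ ε) : Bidense r p q δ ε' A B :=
  fun A' hA B' hB h1 h2 => le_trans (mul_le_mul_of_nonneg_right hε
    (mul_nonneg (Finset.sum_nonneg fun a _ => hp a) (Finset.sum_nonneg fun b _ => hq b)))
    (h A' hA B' hB h1 h2)

/-- In a locally dense set there are `k` large subsets that are pairwise bidense. -/
lemma exists_pairwise_bidense (k : ℕ) {d δ : ℝ} (hd : 0 < d) (hd1 : d ≤ 1) (hδ : 0 < δ)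
    (hδ1 : δ ≤ 1) :
    ∃ c : ℝ, 0 < c ∧ c ≤ 1 ∧ ∀ (V : Type) (G : SimpleGraph V) (U₀ : Finset V), U₀.Nonempty →
      LocDense G d (c * U₀.card) U₀ →
      ∃ W : ℕ → Finset V, (∀ i < k, W i ⊆ U₀ ∧ c * (U₀.card : ℝ) ≤ (W i).card) ∧
        ∀ i < k, ∀ j < k, i ≠ j →
          Bidense G.Adj (fun _ => 1) (fun _ => 1) δ (d / 2) (W i) (W j) := by
  induction k with
  | zero => exact ⟨1, one_pos, le_rfl, fun V G U₀ _ _ => ⟨fun _ => ∅, by simp, by simp⟩⟩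
  | succ k ih =>
    obtain ⟨c, hc, hc1, ih⟩ := ih
    set δ' := δ * c with hδ'
    have hδ'0 : 0 < δ' := by positivity
    have hδ'1 : δ' ≤ 1 := mul_le_one₀ hδ1 hc.le hc1
    set c' := d ^ (4 / δ' ^ 2) with hc'
    have hc'0 : 0 < c' := by positivity
    have hc'1 : c' ≤ 1 := Real.rpow_le_one hd.le hd1 (by positivity)
    refine ⟨c * c', by positivity, mul_le_one₀ hc1 hc'0.le hc'1, fun V G U₀ hU₀ hLD => ?_⟩
    have hcard : (0 : ℝ) < U₀.card := by exact_mod_cast hU₀.card_pos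
    have hcc : c * c' ≤ 1 := mul_le_one₀ hc1 hc'0.le hc'1
    obtain ⟨A, hA, B, hB, hAc, hBc, hAB⟩ := exists_bidense (r := G.Adj) (p := fun _ : V => (1 : ℝ))
      (q := fun _ : V => (1 : ℝ)) (fun _ => zero_le_one) (fun _ => zero_le_one) hδ'0 hδ'1 hd U₀ U₀
      (by simpa using hU₀) (by simpa using hU₀) (by
        have := hLD U₀ subset_rfl (by nlinarith)
        simpa [sq] using this)
    rw [← hc'] at hAc hBc
    simp only [Finset.sum_const, nsmul_eq_mul, mul_one] at hAc hBc
    have hB0 : (0 : ℝ) < B.card := lt_of_lt_of_le (by positivity) hBc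
    obtain ⟨W, hW, hWW⟩ := ih V G B (Finset.card_pos.1 (by exact_mod_cast hB0)) (by
      intro U hU hUc
      refine hLD U (hU.trans hB) (le_trans ?_ hUc)
      rw [mul_assoc]
      exact mul_le_mul_of_nonneg_left hBc hc.le)
    have hAW : ∀ i < k, Bidense G.Adj (fun _ => 1) (fun _ => 1) δ (d / 2) A (W i) := by
      intro i hi
      refine hAB.mono_subset subset_rfl (hW i hi).1 ?_ ?_
      · simp only [Finset.sum_const, nsmul_eq_mul, mul_one]
        rw [hδ']
        exact mul_le_mul_of_nonneg_right (mul_le_of_le_one_right hδ.le hc1) (Nat.cast_nonneg _)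
      · simp only [Finset.sum_const, nsmul_eq_mul, mul_one]
        rw [hδ', mul_assoc]
        exact mul_le_mul_of_nonneg_left (hW i hi).2 hδ.le
    refine ⟨fun i => if i = k then A else W i, fun i hi => ?_, fun i hi j hj hij => ?_⟩
    · by_cases h : i = k
      · simp only [h, if_true]
        refine ⟨hA, le_trans ?_ hAc⟩
        exact mul_le_mul_of_nonneg_right (mul_le_of_le_one_left hc'0.le hc1) (Nat.cast_nonneg _)
      · simp only [h, if_false]
        have h1 := hW i (by omega)
        refine ⟨h1.1.trans hB, le_trans ?_ h1.2⟩
        rw [mul_assoc]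
        exact mul_le_mul_of_nonneg_left hBc hc.le
    · by_cases h : i = k
      · have h' : j ≠ k := fun h' => hij (h.trans h'.symm)
        simp only [h, h', if_true, if_false]
        exact hAW j (by omega)
      · by_cases h' : j = k
        · simp only [h, h', if_true, if_false]
          have := (hAW i (by omega)).symm
          simpa only [G.adj_comm] using this
        · simp only [h, h', if_false]
          exact hWW i (by omega) j (by omega) hij

section Greedy

variable {α β : Type*} {r : α → β → Prop} {p : α → ℝ} {q : β → ℝ}

/-- Few vertices are atypical with respect to a large set. -/
lemma Bidense.weight_atypical_lt {δ ε : ℝ} {A A₁ : Finset α} {B B₁ : Finset β}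
    (h : Bidense r p q δ ε A B) (hq : ∀ b, 0 ≤ q b) (hδ : 0 < δ)
    (hQ : 0 < ∑ b ∈ B, q b) (hA₁ : A₁ ⊆ A) (hA : δ * ∑ a ∈ A, p a ≤ ∑ a ∈ A₁, p a)
    (hB₁ : B₁ ⊆ B) (hbad : ∀ b ∈ B₁, ∑ a ∈ A₁ with r a b, p a < ε * ∑ a ∈ A₁, p a) :
    ∑ b ∈ B₁, q b < δ * ∑ b ∈ B, q b := by
  by_contra! hcon
  have h1 := h A₁ hA₁ B₁ hB₁ hA hcon
  have h2 : 0 < ∑ b ∈ B₁, q b := lt_of_lt_of_le (by positivity) hcon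
  rw [wEdges_symm] at h1
  unfold wEdges at h1
  obtain ⟨b, hb, hqb⟩ : ∃ b ∈ B₁, 0 < q b := by
    by_contra! hn
    exact absurd (Finset.sum_nonpos hn) (not_le.2 h2)
  refine absurd h1 (not_le.2 ?_)
  rw [mul_comm (∑ a ∈ A₁, p a), ← mul_assoc, mul_comm ε, mul_assoc, Finset.sum_mul]
  have h3 : ∀ b, (∑ a ∈ A₁, if r a b then q b * p a else 0) = q b * ∑ a ∈ A₁ with r a b, p a := by
    intro b
    rw [Finset.sum_filter, Finset.mul_sum]
    exact Finset.sum_congr rfl fun a _ => by split_ifs <;> simp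
  simp only [h3]
  exact Finset.sum_lt_sum (fun b hb => mul_le_mul_of_nonneg_left (hbad b hb).le (hq b))
    ⟨b, hb, mul_lt_mul_of_pos_left (hbad b hb) hqb⟩

end Greedy

section Greedy

variable {V W Θ : Type} [Fintype W]

/-- Greedy embedding into pairwise bidense sets, keeping for each `x` a positive proportion of the
tests `θ ∈ T` satisfied by the images of the closed neighbourhood of `x`. -/
lemma exists_greedy_embedding [Nonempty V] {G : SimpleGraph V} {H : SimpleGraph W} {k Δ : ℕ}
    (hΔ : ∀ x, (Finset.univ.filter (H.Adj x)).card ≤ Δ) {col : W → ℕ} (hcol : ∀ x, col x < k)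
    (hprop : ∀ x y, H.Adj x y → col x ≠ col y) {P : ℕ → Finset V} {T : Finset Θ} {p : Θ → ℝ}
    (hp : ∀ θ, 0 ≤ p θ) {r : Θ → V → Prop} {ε δ : ℝ} (hε : 0 < ε) (hε1 : ε ≤ 1) (hδ : 0 < δ)
    (hδε : 4 * (Δ + 1) * δ ≤ ε ^ (Δ + 1))
    (hPP : ∀ i < k, ∀ j < k, i ≠ j →
      Bidense G.Adj (fun _ => 1) (fun _ => 1) δ ε (P i) (P j))
    (hTP : ∀ i < k, Bidense r p (fun _ => 1) δ ε T (P i))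
    (hP : ∀ i < k, 0 < (P i).card) {C : Finset W}
    (hC : ∀ i < k, (C.card : ℝ) < ε ^ Δ / 2 * (P i).card) :
    ∃ f : W → V, Set.InjOn f C ∧ (∀ x ∈ C, f x ∈ P (col x)) ∧
      (∀ x ∈ C, ∀ y ∈ C, H.Adj x y → G.Adj (f x) (f y)) ∧
      ∀ x, ε ^ (Δ + 1) * ∑ θ ∈ T, p θ ≤
        ∑ θ ∈ T with ∀ y ∈ C, (y = x ∨ H.Adj x y) → r θ (f y), p θ := by
  have hT0 : 0 ≤ ∑ θ ∈ T, p θ := Finset.sum_nonneg fun θ _ => hp θ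
  have hpow : ∀ m n : ℕ, m ≤ n → ε ^ n ≤ ε ^ m := fun m n h =>
    pow_le_pow_of_le_one hε.le hε1 h
  have hδpow : ∀ m ≤ Δ + 1, δ ≤ ε ^ m := by
    intro m hm
    have h1 := hpow m (Δ + 1) hm
    have h2 : (0 : ℝ) ≤ Δ * δ := by positivity
    nlinarith
  have hdeg : ∀ S : Finset W, ∀ x, (S.filter (H.Adj x)).card ≤ Δ := fun S x =>
    (Finset.card_le_card (Finset.filter_subset_filter _ (Finset.subset_univ S))).trans (hΔ x)
  have hdeg1 : ∀ S : Finset W, ∀ x, (S.filter fun y => y = x ∨ H.Adj x y).card ≤ Δ + 1 := by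
    intro S x
    rw [Finset.filter_or]
    refine (Finset.card_union_le _ _).trans ?_
    have h1 : (S.filter fun y => y = x).card ≤ 1 := by
      refine Finset.card_le_one.2 fun a ha b hb => ?_
      rw [(Finset.mem_filter.1 ha).2, (Finset.mem_filter.1 hb).2]
    have := hdeg S x
    omega
  suffices main : ∀ S ⊆ C, ∃ f : W → V, Set.InjOn f S ∧ (∀ x ∈ S, f x ∈ P (col x)) ∧
      (∀ x ∈ S, ∀ y ∈ S, H.Adj x y → G.Adj (f x) (f y)) ∧
      (∀ y ∉ S, ε ^ (S.filter (H.Adj y)).card * ((P (col y)).card : ℝ) ≤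
        (((P (col y)).filter fun v => ∀ x ∈ S, H.Adj y x → G.Adj (f x) v).card : ℝ)) ∧
      ∀ x, ε ^ (S.filter fun y => y = x ∨ H.Adj x y).card * ∑ θ ∈ T, p θ ≤
        ∑ θ ∈ T with ∀ y ∈ S, (y = x ∨ H.Adj x y) → r θ (f y), p θ by
    obtain ⟨f, h1, h2, h3, -, h5⟩ := main C subset_rfl
    refine ⟨f, h1, h2, h3, fun x => le_trans ?_ (h5 x)⟩
    exact mul_le_mul_of_nonneg_right (hpow _ _ (hdeg1 C x)) hT0
  intro S
  induction S using Finset.induction_on with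
  | empty =>
    intro _
    refine ⟨fun _ => Classical.arbitrary V, by simp, by simp, by simp, by simp, by simp⟩
  | insert z S hz ih =>
    intro hS
    obtain ⟨f, hinj, hfP, hadj, hcand, htest⟩ := ih ((Finset.subset_insert _ _).trans hS)
    set cand : W → Finset V := fun y =>
      (P (col y)).filter fun v => ∀ x ∈ S, H.Adj y x → G.Adj (f x) v with hcandd
    set tst : W → Finset Θ := fun x =>
      T.filter fun θ => ∀ y ∈ S, (y = x ∨ H.Adj x y) → r θ (f y) with htstd
    have hcz := hP _ (hcol z)
    have hczR : (0 : ℝ) < (P (col z)).card := by exact_mod_cast hcz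
    set bad₁ : W → Finset V := fun y =>
      (P (col z)).filter fun v => (((cand y).filter (G.Adj v)).card : ℝ) < ε * (cand y).card
      with hbad₁
    set bad₂ : W → Finset V := fun x =>
      (P (col z)).filter fun v => ∑ θ ∈ tst x with r θ v, p θ < ε * ∑ θ ∈ tst x, p θ with hbad₂
    have hb₁ : ∀ y ∉ S, H.Adj y z → ((bad₁ y).card : ℝ) ≤ δ * (P (col z)).card := by
      intro y hy hyz
      have h1 := (hPP (col y) (hcol y) (col z) (hcol z) (hprop _ _ hyz)).weight_atypical_lt
        (A₁ := cand y) (B₁ := bad₁ y) (fun _ => zero_le_one) hδ (by simpa using hczR)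
        (Finset.filter_subset _ _) (by
          simp only [Finset.sum_const, nsmul_eq_mul, mul_one]
          refine le_trans ?_ (hcand y hy)
          exact mul_le_mul_of_nonneg_right (hδpow _ ((hdeg S y).trans (Nat.le_succ _)))
            (Nat.cast_nonneg _)) (Finset.filter_subset _ _) (by
          intro b hb
          simp only [hbad₁, Finset.mem_filter] at hb
          simp only [Finset.sum_const, nsmul_eq_mul, mul_one]
          simpa only [G.adj_comm] using hb.2)
      simpa using h1.le
    have hb₂ : ∀ x, ((bad₂ x).card : ℝ) ≤ δ * (P (col z)).card := by
      intro x
      have h1 := (hTP (col z) (hcol z)).weight_atypical_lt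
        (A₁ := tst x) (B₁ := bad₂ x) (fun _ => zero_le_one) hδ (by simpa using hczR)
        (Finset.filter_subset _ _) (by
          refine le_trans ?_ (htest x)
          exact mul_le_mul_of_nonneg_right (hδpow _ (hdeg1 S x)) hT0)
        (Finset.filter_subset _ _) (by
          intro b hb
          simp only [hbad₂, Finset.mem_filter] at hb
          exact hb.2)
      simpa using h1.le
    set Y : Finset W := Finset.univ.filter (H.Adj z) with hY
    set Z : Finset W := insert z Y with hZ
    set B : Finset V := S.image f ∪ ((Y \ S).biUnion bad₁ ∪ Z.biUnion bad₂) with hB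
    have hYc : (Y.card : ℝ) ≤ Δ := by exact_mod_cast hΔ z
    have hBc : (B.card : ℝ) < (cand z).card := by
      have h1 : ((S.image f).card : ℝ) ≤ C.card := by
        exact_mod_cast Finset.card_image_le.trans
          (Finset.card_le_card ((Finset.subset_insert _ _).trans hS))
      have h2 : (((Y \ S).biUnion bad₁).card : ℝ) ≤ Δ * (δ * (P (col z)).card) := by
        have h3 : (((Y \ S).biUnion bad₁).card : ℝ) ≤ ∑ y ∈ Y \ S, ((bad₁ y).card : ℝ) := by
          exact_mod_cast Finset.card_biUnion_le
        refine h3.trans ((Finset.sum_le_card_nsmul _ _ (δ * (P (col z)).card) ?_).trans ?_)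
        · intro y hy
          rw [Finset.mem_sdiff, hY, Finset.mem_filter] at hy
          exact hb₁ y hy.2 hy.1.2.symm
        · rw [nsmul_eq_mul]
          refine mul_le_mul_of_nonneg_right (le_trans ?_ hYc) (by positivity)
          exact_mod_cast Finset.card_le_card Finset.sdiff_subset
      have h2' : ((Z.biUnion bad₂).card : ℝ) ≤ (Δ + 1) * (δ * (P (col z)).card) := by
        have h3 : ((Z.biUnion bad₂).card : ℝ) ≤ ∑ y ∈ Z, ((bad₂ y).card : ℝ) := by
          exact_mod_cast Finset.card_biUnion_le
        refine h3.trans ((Finset.sum_le_card_nsmul _ _ (δ * (P (col z)).card) ?_).trans ?_)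
        · intro y _
          exact hb₂ y
        · rw [nsmul_eq_mul]
          refine mul_le_mul_of_nonneg_right ?_ (by positivity)
          have : (Z.card : ℝ) ≤ Y.card + 1 := by exact_mod_cast Finset.card_insert_le _ _
          linarith
      have h4 : (B.card : ℝ) ≤ (S.image f).card +
          (((Y \ S).biUnion bad₁).card + (Z.biUnion bad₂).card) := by
        exact_mod_cast (Finset.card_union_le _ _).trans
          (Nat.add_le_add_left (Finset.card_union_le _ _) _)
      have h5 := hC (col z) (hcol z)
      have h6 : ε ^ Δ * ((P (col z)).card : ℝ) ≤ (cand z).card :=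
        (mul_le_mul_of_nonneg_right (hpow _ _ (hdeg S z)) (Nat.cast_nonneg _)).trans (hcand z hz)
      have h7 : (Δ + (Δ + 1)) * δ ≤ ε ^ Δ / 2 := by
        have := hpow Δ (Δ + 1) (Nat.le_succ _)
        nlinarith
      have h8 := mul_le_mul_of_nonneg_right h7 hczR.le
      linarith
    obtain ⟨v, hv, hvB⟩ : ∃ v ∈ cand z, v ∉ B := by
      by_contra! hn
      exact absurd (by exact_mod_cast Finset.card_le_card hn : ((cand z).card : ℝ) ≤ B.card)
        (not_le.2 hBc)
    simp only [hB, Finset.mem_union, not_or, Finset.mem_biUnion, not_exists, not_and,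
      Finset.mem_image] at hvB
    obtain ⟨hv1, hv2, hv3⟩ := hvB
    have hvP : v ∈ P (col z) := (Finset.mem_filter.1 hv).1
    have hvadj : ∀ x ∈ S, H.Adj z x → G.Adj (f x) v := (Finset.mem_filter.1 hv).2
    set f' := Function.update f z v with hf'
    have hf'z : f' z = v := by simp [hf']
    have hf'S : ∀ x ∈ S, f' x = f x := fun x hx => by
      rw [hf', Function.update_of_ne]; rintro rfl; exact hz hx
    refine ⟨f', ?_, ?_, ?_, ?_, ?_⟩
    · rw [Finset.coe_insert, Set.injOn_insert (by simpa using hz)]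
      refine ⟨fun x hx y hy hxy => ?_, ?_⟩
      · rw [hf'S x hx, hf'S y hy] at hxy
        exact hinj hx hy hxy
      · rintro ⟨x, hx, hxv⟩
        rw [hf'z, hf'S x hx] at hxv
        exact hv1 x hx hxv
    · intro x hx
      rcases Finset.mem_insert.1 hx with rfl | hx
      · rwa [hf'z]
      · rw [hf'S x hx]; exact hfP x hx
    · intro x hx y hy hxy
      rcases Finset.mem_insert.1 hx with rfl | hxS
      · rcases Finset.mem_insert.1 hy with rfl | hy
        · exact absurd hxy (H.loopless.irrefl _)
        · rw [hf'z, hf'S y hy]; exact (hvadj y hy hxy).symm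
      · rcases Finset.mem_insert.1 hy with rfl | hyS
        · rw [hf'z, hf'S x hxS]; exact hvadj x hxS hxy.symm
        · rw [hf'S x hxS, hf'S y hyS]; exact hadj x hxS y hyS hxy
    · intro y hy
      have hyz : y ≠ z := fun h => hy (h ▸ Finset.mem_insert_self _ _)
      have hyS : y ∉ S := fun h => hy (Finset.mem_insert_of_mem h)
      by_cases hadjy : H.Adj y z
      · rw [Finset.filter_insert, if_pos hadjy, Finset.card_insert_of_notMem (by simp [hz]),
          pow_succ']
        have h1 : ((P (col y)).filter fun v => ∀ x ∈ insert z S, H.Adj y x → G.Adj (f' x) v) =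
            (cand y).filter (G.Adj v) := by
          ext u
          simp only [hcandd, Finset.mem_filter, Finset.forall_mem_insert, hf'z]
          constructor
          · rintro ⟨h1, h2, h3⟩
            exact ⟨⟨h1, fun x hx hyx => hf'S x hx ▸ h3 x hx hyx⟩, h2 hadjy⟩
          · rintro ⟨⟨h1, h3⟩, h2⟩
            exact ⟨h1, fun _ => h2, fun x hx hyx => (hf'S x hx).symm ▸ h3 x hx hyx⟩
        rw [h1]
        have h2 := hv2 y (by rw [Finset.mem_sdiff, hY, Finset.mem_filter]
                             exact ⟨⟨Finset.mem_univ _, hadjy.symm⟩, hyS⟩)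
        simp only [hbad₁, Finset.mem_filter, not_and, not_lt] at h2
        refine le_trans ?_ (h2 hvP)
        rw [mul_assoc]
        exact mul_le_mul_of_nonneg_left (hcand y hyS) hε.le
      · rw [Finset.filter_insert, if_neg hadjy]
        refine (hcand y hyS).trans (le_of_eq ?_)
        congr 2
        ext u
        simp only [Finset.mem_filter, Finset.forall_mem_insert, hadjy, false_imp_iff, true_and]
        refine and_congr_right fun _ => forall₂_congr fun x hx => ?_
        rw [hf'S x hx]
    · intro x
      by_cases hxz : z = x ∨ H.Adj x z
      · rw [Finset.filter_insert, if_pos hxz, Finset.card_insert_of_notMem (by simp [hz]),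
          pow_succ']
        have h1 : (T.filter fun θ => ∀ y ∈ insert z S, (y = x ∨ H.Adj x y) → r θ (f' y)) =
            (tst x).filter fun θ => r θ v := by
          ext u
          simp only [htstd, Finset.mem_filter, Finset.forall_mem_insert, hf'z]
          constructor
          · rintro ⟨h1, h2, h3⟩
            exact ⟨⟨h1, fun y hy hyx => hf'S y hy ▸ h3 y hy hyx⟩, h2 hxz⟩
          · rintro ⟨⟨h1, h3⟩, h2⟩
            exact ⟨h1, fun _ => h2, fun y hy hyx => (hf'S y hy).symm ▸ h3 y hy hyx⟩
        rw [h1]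
        have h2 := hv3 x (by
          rw [hZ, Finset.mem_insert, hY, Finset.mem_filter]
          rcases hxz with h | h
          · exact Or.inl h.symm
          · exact Or.inr ⟨Finset.mem_univ _, h.symm⟩)
        simp only [hbad₂, Finset.mem_filter, not_and, not_lt] at h2
        refine le_trans ?_ (h2 hvP)
        rw [mul_assoc]
        exact mul_le_mul_of_nonneg_left (htest x) hε.le
      · rw [Finset.filter_insert, if_neg hxz]
        refine (htest x).trans (le_of_eq ?_)
        congr 1
        ext u
        simp only [Finset.mem_filter, Finset.forall_mem_insert, hxz, false_imp_iff, true_and]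
        refine and_congr_right fun _ => forall₂_congr fun y hy => ?_
        rw [hf'S y hy]

end Greedy

/-- Embedding a small bounded-degree graph into a set `U` of a locally dense graph such that every
closed neighbourhood satisfies a positive proportion of weighted tests. -/
lemma exists_core_embedding (k Δ : ℕ) {d β : ℝ} (hd : 0 < d) (hd1 : d ≤ 1) (hβ : 0 < β)
    (hβ1 : β ≤ 1) :
    ∃ c : ℝ, 0 < c ∧ c ≤ 1 ∧ ∀ (V : Type) [Fintype V] [Nonempty V] (G : SimpleGraph V),
      LocDense G d (c * Fintype.card V) Finset.univ →
      ∀ (W : Type) [Fintype W] (H : SimpleGraph W),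
      (∀ x, (Finset.univ.filter (H.Adj x)).card ≤ Δ) → H.Colorable k →
      ∀ C : Finset W, (C.card : ℝ) ≤ c * Fintype.card V →
      ∀ (Θ : Type) [Fintype Θ] (p : Θ → ℝ), (∀ θ, 0 ≤ p θ) → 0 < ∑ θ, p θ →
      ∀ (r : Θ → V → Prop) (U : Finset V),
      β * Fintype.card V * ∑ θ, p θ ≤ wEdges r p (fun _ => 1) Finset.univ U →
      ∃ f : W → V, Set.InjOn f C ∧ (∀ x ∈ C, f x ∈ U) ∧
        (∀ x ∈ C, ∀ y ∈ C, H.Adj x y → G.Adj (f x) (f y)) ∧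
        ∀ x, c * ∑ θ, p θ ≤ ∑ θ with ∀ y ∈ C, (y = x ∨ H.Adj x y) → r θ (f y), p θ := by
  set ε : ℝ := min β d / 2 with hεd
  have hε : 0 < ε := by positivity
  have hεβ : ε ≤ β / 2 := by rw [hεd]; gcongr; exact min_le_left _ _
  have hεd' : ε ≤ d / 2 := by rw [hεd]; gcongr; exact min_le_right _ _
  have hε1 : ε ≤ 1 := by linarith
  have hεp1 : ∀ m : ℕ, ε ^ m ≤ 1 := fun m => pow_le_one₀ hε.le hε1
  set δ : ℝ := ε ^ (Δ + 1) / (4 * (Δ + 1)) with hδd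
  have hδ : 0 < δ := by positivity
  have hδε : 4 * (Δ + 1) * δ = ε ^ (Δ + 1) := by rw [hδd]; field_simp
  have hδ1 : δ ≤ 1 := by
    have := hεp1 (Δ + 1)
    have : (0 : ℝ) ≤ Δ * δ := by positivity
    nlinarith
  obtain ⟨c₂, hc₂, hc₂1, hparts⟩ := exists_pairwise_bidense k hd hd1 hδ hδ1
  set δ₁ := δ * c₂ with hδ₁d
  have hδ₁ : 0 < δ₁ := by positivity
  have hδ₁1 : δ₁ ≤ 1 := mul_le_one₀ hδ1 hc₂.le hc₂1
  set c₁ := β ^ (4 / δ₁ ^ 2) with hc₁d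
  have hc₁ : 0 < c₁ := by positivity
  have hc₁1 : c₁ ≤ 1 := Real.rpow_le_one hβ.le hβ1 (by positivity)
  set a := c₁ * c₂ * β with ha
  have ha0 : 0 < a := by positivity
  have ha1 : a ≤ 1 := mul_le_one₀ (mul_le_one₀ hc₁1 hc₂.le hc₂1) hβ.le hβ1
  set c := ε ^ (Δ + 1) / 4 * a with hc
  have hεΔ : 0 < ε ^ (Δ + 1) := by positivity
  have hca : c ≤ a := by
    rw [hc]
    have := hεp1 (Δ + 1)
    nlinarith
  refine ⟨c, by positivity, hca.trans ha1, ?_⟩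
  intro V _ _ G hLD W _ H hΔ hcol C hC Θ _ p hp hpsum r U hU
  set n : ℝ := ((Fintype.card V : ℕ) : ℝ) with hn
  have hn0 : 0 < n := by rw [hn]; exact_mod_cast Fintype.card_pos
  have hUn : (U.card : ℝ) ≤ n := by rw [hn]; exact_mod_cast Finset.card_le_univ U
  have hUle := wEdges_le (r := r) hp (fun _ : V => zero_le_one (α := ℝ)) Finset.univ U
  simp only [Finset.sum_const, nsmul_eq_mul, mul_one] at hUle
  have hUβ : β * n ≤ U.card := by
    have h1 : β * n * ∑ θ, p θ ≤ U.card * ∑ θ, p θ := by linarith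
    exact le_of_mul_le_mul_right h1 hpsum
  have hU0 : (0 : ℝ) < U.card := lt_of_lt_of_le (by positivity) hUβ
  obtain ⟨T, -, A, hA, hTc, hAc, hTA⟩ := exists_bidense (r := r) (p := p)
    (q := fun _ : V => (1 : ℝ)) hp (fun _ => zero_le_one) hδ₁ hδ₁1 hβ Finset.univ U hpsum
    (by simpa using hU0) (by
      simp only [Finset.sum_const, nsmul_eq_mul, mul_one]
      refine le_trans ?_ hU
      rw [mul_comm (∑ θ, p θ), ← mul_assoc]
      exact mul_le_mul_of_nonneg_right (mul_le_mul_of_nonneg_left hUn hβ.le) hpsum.le)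
  simp only [Finset.sum_const, nsmul_eq_mul, mul_one] at hAc
  rw [← hc₁d] at hTc hAc
  have hAn : c₁ * β * n ≤ A.card := by
    refine le_trans ?_ hAc
    rw [mul_assoc]
    exact mul_le_mul_of_nonneg_left hUβ hc₁.le
  have hA0 : (0 : ℝ) < A.card := lt_of_lt_of_le (by positivity) hAn
  have haA : a * n ≤ c₂ * A.card := by
    calc a * n = c₂ * (c₁ * β * n) := by rw [ha]; ring
      _ ≤ _ := mul_le_mul_of_nonneg_left hAn hc₂.le
  obtain ⟨P, hP, hPP⟩ := hparts V G A (Finset.card_pos.1 (by exact_mod_cast hA0)) (by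
    intro U' _ hU'
    refine hLD U' (Finset.subset_univ _) (le_trans ?_ hU')
    exact (mul_le_mul_of_nonneg_right hca hn0.le).trans haA)
  have hPa : ∀ i < k, a * n ≤ (P i).card := fun i hi => haA.trans (hP i hi).2
  obtain ⟨f, h1, h2, h3, h4⟩ := exists_greedy_embedding (G := G) (H := H) (k := k) (Δ := Δ)
    (col := fun x => (hcol.some x : Fin k).val) hΔ (fun x => (hcol.some x).2)
    (fun x y hxy h => hcol.some.valid hxy (Fin.ext h)) (P := P) (T := T) hp (r := r) hε hε1 hδ
    hδε.le (fun i hi j hj hij => (hPP i hi j hj hij).mono_density (fun _ => zero_le_one)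
      (fun _ => zero_le_one) hεd')
    (fun i hi => by
      refine Bidense.mono_density hp (fun _ => zero_le_one) ?_ hεβ
      refine hTA.mono_subset subset_rfl (hP i hi).1 ?_ ?_
      · exact mul_le_mul_of_nonneg_right (mul_le_of_le_one_right hδ.le hc₂1)
          (Finset.sum_nonneg fun θ _ => hp θ)
      · simp only [Finset.sum_const, nsmul_eq_mul, mul_one]
        rw [hδ₁d, mul_assoc]
        exact mul_le_mul_of_nonneg_left (hP i hi).2 hδ.le)
    (fun i hi => by
      have := hPa i hi
      have h0 : (0 : ℝ) < (P i).card := lt_of_lt_of_le (by positivity) this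
      exact_mod_cast h0) (C := C) (fun i hi => by
      have h5 := hPa i hi
      have h6 : ε ^ (Δ + 1) ≤ ε ^ Δ := pow_le_pow_of_le_one hε.le hε1 (Nat.le_succ _)
      have h7 : 0 < a * n := by positivity
      have h8 : c * n = ε ^ (Δ + 1) / 4 * (a * n) := by rw [hc]; ring
      have h9 : ε ^ (Δ + 1) / 4 * (a * n) < ε ^ Δ / 2 * (a * n) := by
        apply mul_lt_mul_of_pos_right _ h7; linarith
      have h10 : ε ^ Δ / 2 * (a * n) ≤ ε ^ Δ / 2 * (P i).card :=
        mul_le_mul_of_nonneg_left h5 (by positivity)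
      linarith)
  refine ⟨f, h1, fun x hx => hA ((hP _ (hcol.some x).2).1 (h2 x hx)), h3, fun x => ?_⟩
  refine le_trans ?_ ((h4 x).trans (Finset.sum_le_sum_of_subset_of_nonneg
    (Finset.filter_subset_filter _ (Finset.subset_univ T)) fun θ _ _ => hp θ))
  refine le_trans ?_ (mul_le_mul_of_nonneg_left hTc hεΔ.le)
  rw [← mul_assoc]
  refine mul_le_mul_of_nonneg_right ?_ hpsum.le
  rw [hc, ha]
  have h5 : c₂ * β ≤ 1 := mul_le_one₀ hc₂1 hβ.le hβ1
  have h6 : c₁ * c₂ * β ≤ c₁ := by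
    rw [mul_assoc]; exact mul_le_of_le_one_right hc₁.le h5
  nlinarith

section Embeddings

variable {V W : Type}

/-- `f` embeds `H[S]` into `G`. -/
def EmbOn (G : SimpleGraph V) (H : SimpleGraph W) (f : W → V) (S : Finset W) : Prop :=
  Set.InjOn f S ∧ ∀ x ∈ S, ∀ y ∈ S, H.Adj x y → G.Adj (f x) (f y)

/-- `S` is a union of connected components of `H`. -/
def AdjClosed (H : SimpleGraph W) (S : Finset W) : Prop :=
  ∀ x ∈ S, ∀ y, H.Adj x y → y ∈ S

/-- `f` maps the closed neighbourhood of `x` into `S`. -/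
def NbhdInto (H : SimpleGraph W) (f : W → V) (x : W) (S : V → Prop) : Prop :=
  ∀ y, (y = x ∨ H.Adj x y) → S (f y)

lemma AdjClosed.biUnion {H : SimpleGraph W} {𝒞 : Finset (Finset W)}
    (h : ∀ C ∈ 𝒞, AdjClosed H C) : AdjClosed H (𝒞.biUnion id) := by
  intro x hx y hxy
  rw [Finset.mem_biUnion] at hx ⊢
  obtain ⟨C, hC, hxC⟩ := hx
  exact ⟨C, hC, h C hC x hxC y hxy⟩

lemma AdjClosed.mem_of_closedNbhd {H : SimpleGraph W} {S : Finset W} (h : AdjClosed H S) {x y : W}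
    (hx : x ∈ S) (hxy : y = x ∨ H.Adj x y) : y ∈ S := by
  rcases hxy with rfl | hxy
  · exact hx
  · exact h x hx y hxy

lemma AdjClosed.nbhdInto_congr {H : SimpleGraph W} {S : Finset W} (h : AdjClosed H S) {f g : W → V}
    (hfg : ∀ x ∈ S, f x = g x) {x : W} (hx : x ∈ S) (P : V → Prop) :
    NbhdInto H f x P ↔ NbhdInto H g x P := by
  refine forall₂_congr fun y hy => ?_
  rw [hfg y (h.mem_of_closedNbhd hx hy)]

lemma EmbOn.congr {G : SimpleGraph V} {H : SimpleGraph W} {f g : W → V} {S : Finset W}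
    (h : EmbOn G H f S) (hfg : ∀ x ∈ S, g x = f x) : EmbOn G H g S :=
  ⟨fun x hx y hy hxy => h.1 hx hy (by rwa [hfg x hx, hfg y hy] at hxy), fun x hx y hy hxy => by
    rw [hfg x hx, hfg y hy]; exact h.2 x hx y hy hxy⟩

/-- Embeddings of disjoint closed sets with disjoint images glue. -/
lemma EmbOn.union {G : SimpleGraph V} {H : SimpleGraph W} {f : W → V} {S T : Finset W}
    (hS : EmbOn G H f S) (hT : EmbOn G H f T) (hSc : AdjClosed H S) (hTc : AdjClosed H T)
    (hdis : ∀ x ∈ S, ∀ y ∈ T, f x ≠ f y) : EmbOn G H f (S ∪ T) := by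
  have hnot : ∀ x ∈ S, x ∉ T := fun x hx hx' => hdis x hx x hx' rfl
  refine ⟨fun x hx y hy hxy => ?_, fun x hx y hy hxy => ?_⟩
  · rw [Finset.mem_coe, Finset.mem_union] at hx hy
    rcases hx with hx | hx <;> rcases hy with hy | hy
    · exact hS.1 hx hy hxy
    · exact absurd hxy (hdis x hx y hy)
    · exact absurd hxy.symm (hdis y hy x hx)
    · exact hT.1 hx hy hxy
  · rw [Finset.mem_union] at hx hy
    rcases hx with hx | hx
    · exact hS.2 x hx y (hSc x hx y hxy) hxy
    · exact hT.2 x hx y (hTc x hx y hxy) hxy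

lemma card_sdiff_image_ge (U : Finset V) (f : W → V) (S : Finset W) :
    (U.card : ℝ) - S.card ≤ (U \ S.image f).card := by
  have h1 : U.card ≤ (U \ S.image f).card + (S.image f).card := by
    have := Finset.card_le_card_sdiff_add_card (s := U) (t := S.image f)
    omega
  have h2 : ((S.image f).card : ℝ) ≤ S.card := by exact_mod_cast Finset.card_image_le
  have h3 : (U.card : ℝ) ≤ (U \ S.image f).card + (S.image f).card := by exact_mod_cast h1
  linarith

lemma LocDense.mono {G : SimpleGraph V} {d m m' : ℝ} {U : Finset V} (h : LocDense G d m U)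
    (hm : m ≤ m') : LocDense G d m' U := fun U' hU' hc => h U' hU' (hm.trans hc)

/-- The bounded degree condition on `H`. -/
def DegLe [Fintype W] (H : SimpleGraph W) (Δ : ℕ) : Prop :=
  ∀ x, (Finset.univ.filter (H.Adj x)).card ≤ Δ

/-- Sequential embedding of small pieces into a set `U` with a little room to spare, so that every
closed neighbourhood has linearly many common neighbours in `U`. -/
lemma exists_sequential_embedding (k Δ : ℕ) {d γ : ℝ} (hd : 0 < d) (hd1 : d ≤ 1) (hγ : 0 < γ)
    (hγ1 : γ ≤ 1) :
    ∃ c : ℝ, 0 < c ∧ c ≤ 1 ∧ ∀ (V : Type) [Fintype V] [Nonempty V] (G : SimpleGraph V),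
      LocDense G d (c * Fintype.card V) Finset.univ →
      ∀ (W : Type) [Fintype W] (H : SimpleGraph W), DegLe H Δ → H.Colorable k →
      ∀ 𝒞 : Finset (Finset W), (𝒞 : Set (Finset W)).PairwiseDisjoint id →
      (∀ C ∈ 𝒞, AdjClosed H C) → (∀ C ∈ 𝒞, (C.card : ℝ) ≤ c * Fintype.card V) →
      ∀ U : Finset V, ((𝒞.biUnion id).card : ℝ) + γ * Fintype.card V ≤ U.card →
      ∃ f : W → V, EmbOn G H f (𝒞.biUnion id) ∧ (∀ x ∈ 𝒞.biUnion id, f x ∈ U) ∧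
        ∀ x ∈ 𝒞.biUnion id, c * Fintype.card V ≤
          ((U.filter fun a => NbhdInto H f x (G.Adj a)).card : ℝ) := by
  obtain ⟨c, hc, hc1, hcore⟩ := exists_core_embedding k Δ hd hd1 (β := d * γ) (by positivity)
    (mul_le_one₀ hd1 hγ.le hγ1)
  refine ⟨c * γ, by positivity, mul_le_one₀ hc1 hγ.le hγ1, ?_⟩
  intro V _ _ G hLD W _ H hΔ hcol 𝒞
  set n : ℝ := ((Fintype.card V : ℕ) : ℝ) with hn
  have hn0 : 0 < n := by rw [hn]; exact_mod_cast Fintype.card_pos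
  have hLDc : LocDense G d (c * n) Finset.univ :=
    hLD.mono (mul_le_mul_of_nonneg_right (mul_le_of_le_one_right hc.le hγ1) hn0.le)
  have hLDγ : LocDense G d (γ * n) Finset.univ :=
    hLD.mono (mul_le_mul_of_nonneg_right (mul_le_of_le_one_left hγ.le hc1) hn0.le)
  induction 𝒞 using Finset.induction_on with
  | empty =>
    intro _ _ _ U _
    exact ⟨fun _ => Classical.arbitrary V, ⟨by simp, by simp⟩, by simp, by simp⟩
  | insert C 𝒞 hC𝒞 ih =>
    intro hdis hclosed hsmall U hU
    have hS : AdjClosed H (𝒞.biUnion id) :=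
      AdjClosed.biUnion fun C hC => hclosed C (Finset.mem_insert_of_mem hC)
    have hCc : AdjClosed H C := hclosed C (Finset.mem_insert_self _ _)
    rw [Finset.biUnion_insert, id] at hU ⊢
    have hCS : Disjoint C (𝒞.biUnion id) := by
      rw [Finset.disjoint_biUnion_right]
      intro D hD
      exact hdis (by simp) (by simp [hD]) (fun h => hC𝒞 (h ▸ hD))
    rw [Finset.card_union_of_disjoint hCS] at hU
    push_cast at hU
    obtain ⟨f, hf, hfU, hfx⟩ := ih (hdis.subset (by simp))
      (fun C hC => hclosed C (Finset.mem_insert_of_mem hC))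
      (fun C hC => hsmall C (Finset.mem_insert_of_mem hC)) U (by
        have : (0 : ℝ) ≤ C.card := Nat.cast_nonneg _
        linarith)
    set S := 𝒞.biUnion id with hSd
    set U' := U \ S.image f with hU'
    have hU'c : γ * n ≤ U'.card := by
      have := card_sdiff_image_ge U f S
      have : (0 : ℝ) ≤ C.card := Nat.cast_nonneg _
      linarith
    have hU'0 : (0 : ℝ) < U'.card := lt_of_lt_of_le (by positivity) hU'c
    have hsum : ∑ v : V, (if v ∈ U' then (1 : ℝ) else 0) = U'.card := by simp
    obtain ⟨g, hg1, hg2, hg3, hg4⟩ := hcore V G hLDc W H hΔ hcol C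
      ((hsmall C (Finset.mem_insert_self _ _)).trans
        (mul_le_mul_of_nonneg_right (mul_le_of_le_one_right hc.le hγ1) hn0.le))
      V (fun v => if v ∈ U' then 1 else 0) (fun v => by split_ifs <;> simp)
      (by rw [hsum]; exact hU'0) G.Adj U' (by
        rw [hsum]
        have h1 := hLDγ U' (Finset.subset_univ _) hU'c
        have h2 : wEdges G.Adj (fun v => if v ∈ U' then (1 : ℝ) else 0) (fun _ => 1)
            Finset.univ U' = adjPairs G U' U' := by
          unfold adjPairs wEdges
          rw [← Finset.sum_subset (Finset.subset_univ U')]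
          · refine Finset.sum_congr rfl fun a ha => ?_
            simp [ha]
          · intro a _ ha
            simp [ha]
        rw [h2]
        refine le_trans ?_ h1
        rw [sq, ← mul_assoc, mul_assoc d]
        exact mul_le_mul_of_nonneg_right (mul_le_mul_of_nonneg_left hU'c hd.le) hU'0.le)
    set f' : W → V := fun y => if y ∈ C then g y else f y with hf'
    have hf'C : ∀ x ∈ C, f' x = g x := fun x hx => by simp [hf', hx]
    have hf'S : ∀ x ∈ S, f' x = f x := fun x hx => by
      simp [hf', Finset.disjoint_right.1 hCS hx]
    refine ⟨f', ?_, ?_, ?_⟩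
    · refine EmbOn.union (EmbOn.congr ⟨hg1, hg3⟩ hf'C) (hf.congr hf'S) hCc hS ?_
      intro x hx y hy hxy
      rw [hf'C x hx, hf'S y hy] at hxy
      have := hg2 x hx
      rw [hU', Finset.mem_sdiff, hxy] at this
      exact this.2 (Finset.mem_image_of_mem _ hy)
    · intro x hx
      rcases Finset.mem_union.1 hx with hx | hx
      · rw [hf'C x hx]; exact (Finset.mem_sdiff.1 (hg2 x hx)).1
      · rw [hf'S x hx]; exact hfU x hx
    · intro x hx
      rcases Finset.mem_union.1 hx with hx | hx
      · have h1 := hg4 x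
        rw [hsum] at h1
        have h2 : c * γ * n ≤ c * U'.card := by
          rw [mul_assoc]; exact mul_le_mul_of_nonneg_left hU'c hc.le
        refine h2.trans (h1.trans ?_)
        rw [← Finset.sum_filter, Finset.sum_const, nsmul_eq_mul, mul_one]
        refine Nat.cast_le.2 (Finset.card_le_card fun a ha => ?_)
        simp only [Finset.mem_filter, Finset.mem_univ, true_and] at ha
        rw [Finset.mem_filter, hCc.nbhdInto_congr hf'C hx]
        exact ⟨(Finset.mem_sdiff.1 ha.2).1, fun y hy =>
          ha.1 y (hCc.mem_of_closedNbhd hx hy) hy⟩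
      · refine (hfx x hx).trans (le_of_eq ?_)
        congr 2
        ext a
        rw [Finset.mem_filter, Finset.mem_filter, hS.nbhdInto_congr hf'S hx]

end Embeddings

lemma exp_neg_le_one_sub_half {t : ℝ} (h0 : 0 ≤ t) (h1 : t ≤ 1) : Real.exp (-t) ≤ 1 - t / 2 := by
  have h2 : t + 1 ≤ Real.exp t := Real.add_one_le_exp t
  rw [Real.exp_neg]
  have h3 : (Real.exp t)⁻¹ ≤ (t + 1)⁻¹ := inv_anti₀ (by linarith) h2
  refine h3.trans ?_
  rw [inv_le_iff_one_le_mul₀ (by linarith)]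
  nlinarith

/-- Sequential embedding in which, simultaneously for many target sets `T θ`, a positive proportion
of the vertices of `X` have their closed neighbourhood mapped into `T θ`. -/
lemma exists_spread_embedding (k Δ : ℕ) {d β : ℝ} (hd : 0 < d) (hd1 : d ≤ 1) (hβ : 0 < β)
    (hβ1 : β ≤ 1) :
    ∃ c : ℝ, 0 < c ∧ c ≤ 1 ∧ ∀ (V : Type) [Fintype V] [Nonempty V] (G : SimpleGraph V),
      LocDense G d (c * Fintype.card V) Finset.univ →
      ∀ (W : Type) [Fintype W] (H : SimpleGraph W), DegLe H Δ → H.Colorable k →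
      ∀ (w : ℝ), 0 < w → w ≤ c * Fintype.card V →
      ∀ (Θ : Type) [Fintype Θ] [Nonempty Θ] (T : Θ → Finset V) (X : Finset W),
      ∀ 𝒞 : Finset (Finset W), (𝒞 : Set (Finset W)).PairwiseDisjoint id →
      (∀ C ∈ 𝒞, AdjClosed H C) → (∀ C ∈ 𝒞, (C.card : ℝ) ≤ w) →
      ∀ U : Finset V,
      (∀ θ, ((𝒞.biUnion id).card : ℝ) + β * Fintype.card V ≤ (T θ ∩ U).card) →
      ∃ f : W → V, EmbOn G H f (𝒞.biUnion id) ∧ (∀ x ∈ 𝒞.biUnion id, f x ∈ U) ∧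
        ∀ θ, c * (X ∩ 𝒞.biUnion id).card - w * Real.log (Fintype.card Θ) ≤
          (((X ∩ 𝒞.biUnion id).filter fun x => NbhdInto H f x (· ∈ T θ)).card : ℝ) := by
  obtain ⟨c, hc, hc1, hcore⟩ := exists_core_embedding k Δ hd hd1 hβ hβ1
  refine ⟨c / 2, by positivity, by linarith, ?_⟩
  intro V _ _ G hLD W _ H hΔ hcol w hw hwc Θ _ _ T X 𝒞 hdis hclosed hsmall U hU
  set n : ℝ := ((Fintype.card V : ℕ) : ℝ) with hn
  have hn0 : 0 < n := by rw [hn]; exact_mod_cast Fintype.card_pos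
  have hLDc : LocDense G d (c * n) Finset.univ :=
    hLD.mono (by nlinarith)
  have hcn : w ≤ c * n := by nlinarith
  have hΘ : (0 : ℝ) < Fintype.card Θ := by exact_mod_cast Fintype.card_pos
  suffices main : ∃ f : W → V, EmbOn G H f (𝒞.biUnion id) ∧ (∀ x ∈ 𝒞.biUnion id, f x ∈ U) ∧
      ∑ θ, Real.exp (-((((X ∩ 𝒞.biUnion id).filter
        fun x => NbhdInto H f x (· ∈ T θ)).card : ℝ) / w)) ≤
      Fintype.card Θ * Real.exp (-(c * (X ∩ 𝒞.biUnion id).card / (2 * w))) by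
    obtain ⟨f, h1, h2, h3⟩ := main
    refine ⟨f, h1, h2, fun θ => ?_⟩
    have h4 := (Finset.single_le_sum (f := fun θ => Real.exp (-((((X ∩ 𝒞.biUnion id).filter
        fun x => NbhdInto H f x (· ∈ T θ)).card : ℝ) / w))) (fun θ _ => (Real.exp_pos _).le)
        (Finset.mem_univ θ)).trans h3
    rw [← Real.exp_log hΘ, ← Real.exp_add, Real.exp_le_exp] at h4
    set N := (((X ∩ 𝒞.biUnion id).filter fun x => NbhdInto H f x (· ∈ T θ)).card : ℝ)
    have h5 : c * (X ∩ 𝒞.biUnion id).card / (2 * w) - Real.log (Fintype.card Θ) ≤ N / w := by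
      linarith
    rw [le_div_iff₀ hw, sub_mul] at h5
    have h6 : c * ((X ∩ 𝒞.biUnion id).card : ℝ) / (2 * w) * w =
        c / 2 * (X ∩ 𝒞.biUnion id).card := by field_simp
    linarith
  induction 𝒞 using Finset.induction_on with
  | empty => exact ⟨fun _ => Classical.arbitrary V, ⟨by simp, by simp⟩, by simp, by simp⟩
  | insert C 𝒞 hC𝒞 ih =>
    have hS : AdjClosed H (𝒞.biUnion id) :=
      AdjClosed.biUnion fun C hC => hclosed C (Finset.mem_insert_of_mem hC)
    have hCc : AdjClosed H C := hclosed C (Finset.mem_insert_self _ _)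
    rw [Finset.biUnion_insert, id] at hU ⊢
    have hCS : Disjoint C (𝒞.biUnion id) := by
      rw [Finset.disjoint_biUnion_right]
      intro D hD
      exact hdis (by simp) (by simp [hD]) (fun h => hC𝒞 (h ▸ hD))
    rw [Finset.card_union_of_disjoint hCS] at hU
    push_cast at hU
    have hC0 : (0 : ℝ) ≤ C.card := Nat.cast_nonneg _
    obtain ⟨f, hf, hfU, hfΦ⟩ := ih (hdis.subset (by simp))
      (fun C hC => hclosed C (Finset.mem_insert_of_mem hC))
      (fun C hC => hsmall C (Finset.mem_insert_of_mem hC)) (fun θ => by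
        have := hU θ
        linarith)
    set S := 𝒞.biUnion id with hSd
    set U' := U \ S.image f with hU'
    set p : Θ → ℝ := fun θ => Real.exp (-((((X ∩ S).filter
        fun x => NbhdInto H f x (· ∈ T θ)).card : ℝ) / w)) with hp
    have hp0 : ∀ θ, 0 < p θ := fun θ => Real.exp_pos _
    obtain ⟨g, hg1, hg2, hg3, hg4⟩ := hcore V G hLDc W H hΔ hcol C
      ((hsmall C (Finset.mem_insert_self _ _)).trans hcn) Θ p (fun θ => (hp0 θ).le)
      (Finset.sum_pos (fun θ _ => hp0 θ) Finset.univ_nonempty) (fun θ u => u ∈ T θ) U' (by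
        unfold wEdges
        rw [Finset.mul_sum]
        refine Finset.sum_le_sum fun θ _ => ?_
        have h1 : (∑ u ∈ U', if u ∈ T θ then p θ * 1 else 0) = (T θ ∩ U').card * p θ := by
          rw [← Finset.sum_filter, Finset.sum_const, nsmul_eq_mul, mul_one,
            Finset.filter_mem_eq_inter, Finset.inter_comm]
        refine le_of_le_of_eq ?_ (h1.symm.trans (Finset.sum_congr rfl fun u _ => by congr))
        refine mul_le_mul_of_nonneg_right ?_ (hp0 θ).le
        have h2 : T θ ∩ U' = (T θ ∩ U) \ S.image f := by
          rw [hU', Finset.inter_sdiff_assoc]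
        have h3 := card_sdiff_image_ge (T θ ∩ U) f S
        rw [h2]
        have := hU θ
        linarith)
    set f' : W → V := fun y => if y ∈ C then g y else f y with hf'
    have hf'C : ∀ x ∈ C, f' x = g x := fun x hx => by simp [hf', hx]
    have hf'S : ∀ x ∈ S, f' x = f x := fun x hx => by
      simp [hf', Finset.disjoint_right.1 hCS hx]
    refine ⟨f', ?_, ?_, ?_⟩
    · refine EmbOn.union (EmbOn.congr ⟨hg1, hg3⟩ hf'C) (hf.congr hf'S) hCc hS ?_
      intro x hx y hy hxy
      rw [hf'C x hx, hf'S y hy] at hxy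
      have := hg2 x hx
      rw [hU', Finset.mem_sdiff, hxy] at this
      exact this.2 (Finset.mem_image_of_mem _ hy)
    · intro x hx
      rcases Finset.mem_union.1 hx with hx | hx
      · rw [hf'C x hx]; exact (Finset.mem_sdiff.1 (hg2 x hx)).1
      · rw [hf'S x hx]; exact hfU x hx
    · set j : Θ → ℝ := fun θ => (((X ∩ C).filter fun x => NbhdInto H g x (· ∈ T θ)).card : ℝ)
        with hj
      have hXC : ((X ∩ C).card : ℝ) ≤ w :=
        le_trans (by exact_mod_cast Finset.card_le_card Finset.inter_subset_right)
          (hsmall C (Finset.mem_insert_self _ _))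
      have hj0 : ∀ θ, 0 ≤ j θ := fun θ => Nat.cast_nonneg _
      have hjw : ∀ θ, j θ ≤ w := fun θ =>
        le_trans (Nat.cast_le.2 (Finset.card_filter_le _ _)) hXC
      have hdisX : Disjoint (X ∩ C) (X ∩ S) :=
        hCS.mono Finset.inter_subset_right Finset.inter_subset_right
      have hcard : ((X ∩ (C ∪ S)).card : ℝ) = (X ∩ C).card + (X ∩ S).card := by
        rw [Finset.inter_union_distrib_left, Finset.card_union_of_disjoint hdisX]
        push_cast; rfl
      have hsplit : ∀ θ, Real.exp (-((((X ∩ (C ∪ S)).filter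
          fun x => NbhdInto H f' x (· ∈ T θ)).card : ℝ) / w)) = p θ * Real.exp (-(j θ / w)) := by
        intro θ
        rw [hp, ← Real.exp_add]
        congr 1
        have h1 : ((X ∩ (C ∪ S)).filter fun x => NbhdInto H f' x (· ∈ T θ)) =
            ((X ∩ C).filter fun x => NbhdInto H g x (· ∈ T θ)) ∪
            ((X ∩ S).filter fun x => NbhdInto H f x (· ∈ T θ)) := by
          rw [Finset.inter_union_distrib_left, Finset.filter_union]
          congr 1
          · refine Finset.filter_congr fun x hx => ?_
            rw [hCc.nbhdInto_congr hf'C (Finset.mem_inter.1 hx).2]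
          · refine Finset.filter_congr fun x hx => ?_
            rw [hS.nbhdInto_congr hf'S (Finset.mem_inter.1 hx).2]
        rw [h1, Finset.card_union_of_disjoint (hdisX.mono (Finset.filter_subset _ _)
          (Finset.filter_subset _ _))]
        push_cast
        rw [hj]
        ring
      simp only [hsplit]
      have hstep : ∑ θ, p θ * j θ = ∑ x ∈ X ∩ C,
          ∑ θ with NbhdInto H g x (· ∈ T θ), p θ := by
        simp only [hj, Finset.card_filter, Finset.sum_filter]
        push_cast
        simp only [Finset.mul_sum]
        rw [Finset.sum_comm]
        refine Finset.sum_congr rfl fun x _ => Finset.sum_congr rfl fun θ _ => ?_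
        split_ifs <;> simp
      have hlow : (X ∩ C).card * (c * ∑ θ, p θ) ≤ ∑ θ, p θ * j θ := by
        rw [hstep, ← nsmul_eq_mul]
        refine Finset.card_nsmul_le_sum _ _ _ fun x hx => ?_
        refine (hg4 x).trans (le_of_eq ?_)
        congr 1
        ext θ
        simp only [Finset.mem_filter, Finset.mem_univ, true_and]
        exact ⟨fun h y hy => h y (hCc.mem_of_closedNbhd (Finset.mem_inter.1 hx).2 hy) hy,
          fun h y _ hy => h y hy⟩
      have hΦ : ∑ θ, p θ * Real.exp (-(j θ / w)) ≤
          (∑ θ, p θ) * Real.exp (-(c * (X ∩ C).card / (2 * w))) := by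
        calc ∑ θ, p θ * Real.exp (-(j θ / w)) ≤ ∑ θ, (p θ - p θ * j θ / (2 * w)) := by
              refine Finset.sum_le_sum fun θ _ => ?_
              have h1 := exp_neg_le_one_sub_half (t := j θ / w) (div_nonneg (hj0 θ) hw.le)
                (div_le_one_of_le₀ (hjw θ) hw.le)
              have h2 := mul_le_mul_of_nonneg_left h1 (hp0 θ).le
              refine h2.trans (le_of_eq ?_)
              field_simp
          _ = ∑ θ, p θ - (∑ θ, p θ * j θ) / (2 * w) := by
              rw [Finset.sum_sub_distrib, Finset.sum_div]
          _ ≤ ∑ θ, p θ - ((X ∩ C).card * (c * ∑ θ, p θ)) / (2 * w) := by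
              gcongr
          _ = (∑ θ, p θ) * (1 - c * (X ∩ C).card / (2 * w)) := by ring
          _ ≤ _ := by
              refine mul_le_mul_of_nonneg_left ?_ (Finset.sum_nonneg fun θ _ => (hp0 θ).le)
              have := Real.add_one_le_exp (-(c * (X ∩ C).card / (2 * w)))
              linarith
      refine hΦ.trans ((mul_le_mul_of_nonneg_right hfΦ (Real.exp_pos _).le).trans (le_of_eq ?_))
      rw [mul_assoc, ← Real.exp_add, hcard]
      congr 2
      ring

lemma adjPairs_eq_sum {V : Type} (G : SimpleGraph V) (A B : Finset V) :
    adjPairs G A B = ∑ a ∈ A, ((B.filter (G.Adj a)).card : ℝ) := by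
  unfold adjPairs wEdges
  refine Finset.sum_congr rfl fun a _ => ?_
  rw [← Finset.sum_filter, Finset.sum_const, nsmul_eq_mul, mul_one, mul_one]

lemma adjPairs_comm {V : Type} (G : SimpleGraph V) (A B : Finset V) :
    adjPairs G A B = adjPairs G B A := by
  unfold adjPairs
  rw [wEdges_symm]
  simp only [G.adj_comm]

section Classes

variable {V : Type} [Fintype V]

/-- Vertices reachable from `I` in `j` rounds, each round adding all vertices with at least `m`
neighbours among those already reached. -/
noncomputable def closureSeq (G : SimpleGraph V) (m : ℝ) (I : Finset V) : ℕ → Finset V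
  | 0 => I
  | j + 1 => closureSeq G m I j ∪
      Finset.univ.filter fun v => m ≤ (((closureSeq G m I j).filter (G.Adj v)).card : ℝ)

lemma closureSeq_mono (G : SimpleGraph V) (m : ℝ) (I : Finset V) :
    Monotone (closureSeq G m I) :=
  monotone_nat_of_le_succ fun _ => Finset.subset_union_left

/-- The number of neighbours of `v` in other classes. -/
noncomputable def crossDeg (G : SimpleGraph V) (part : V → ℕ) (v : V) : ℕ :=
  (Finset.univ.filter fun u => G.Adj v u ∧ part u ≠ part v).card

lemma exists_unsplittable_partition [Nonempty V] (G : SimpleGraph V) {σ ζ : ℝ} (hσ : 0 < σ)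
    (hσ1 : σ ≤ 1) :
    ∃ (s : ℕ) (part : V → ℕ), 1 ≤ s ∧ σ * s ≤ 1 ∧ (∀ v, part v < s) ∧
      (∀ i < s, σ * Fintype.card V ≤ ((Finset.univ.filter fun v => part v = i).card : ℝ)) ∧
      (∑ v, (crossDeg G part v : ℝ) ≤ 2 * ((s : ℝ) - 1) * ζ * (Fintype.card V : ℝ) ^ 2) ∧
      ∀ i < s, ∀ P Q : Finset V, Disjoint P Q → P ∪ Q = Finset.univ.filter (fun v => part v = i) →
        σ * Fintype.card V ≤ P.card → σ * Fintype.card V ≤ Q.card →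
        ζ * (Fintype.card V : ℝ) ^ 2 < adjPairs G P Q := by
  set n : ℝ := ((Fintype.card V : ℕ) : ℝ) with hn
  have hn0 : 0 < n := by rw [hn]; exact_mod_cast Fintype.card_pos
  set Good : ℕ → Prop := fun s => ∃ part : V → ℕ, (∀ v, part v < s) ∧
      (∀ i < s, σ * n ≤ ((Finset.univ.filter fun v => part v = i).card : ℝ)) ∧
      ∑ v, (crossDeg G part v : ℝ) ≤ 2 * ((s : ℝ) - 1) * ζ * n ^ 2 with hGood
  have hbound : ∀ s, Good s → σ * s ≤ 1 := by
    rintro s ⟨part, h1, h2, -⟩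
    have h3 : (Fintype.card V : ℕ) = ∑ i ∈ Finset.range s,
        (Finset.univ.filter fun v => part v = i).card := by
      rw [← Finset.card_univ]
      exact Finset.card_eq_sum_card_fiberwise fun v _ => by simpa using h1 v
    have h4 : (s : ℝ) * (σ * n) ≤ n := by
      have h3' : n = ∑ i ∈ Finset.range s,
          ((Finset.univ.filter fun v => part v = i).card : ℝ) := by
        rw [hn, h3]; push_cast; rfl
      conv_rhs => rw [h3']
      have := Finset.card_nsmul_le_sum (Finset.range s)
        (fun i => ((Finset.univ.filter fun v => part v = i).card : ℝ)) (σ * n)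
        (fun i hi => h2 i (Finset.mem_range.1 hi))
      simpa using this
    have h5 : (s * σ) * n ≤ 1 * n := by linarith
    have := le_of_mul_le_mul_right h5 hn0
    linarith
  have hG1 : Good 1 := by
    refine ⟨fun _ => 0, by simp, fun i hi => ?_, ?_⟩
    · have : i = 0 := by omega
      subst this
      simp only [Finset.filter_true, Finset.card_univ]
      exact mul_le_of_le_one_left hn0.le hσ1
    · simp [crossDeg]
  obtain ⟨s, hs1, hGs, hGs'⟩ : ∃ s, 1 ≤ s ∧ Good s ∧ ¬ Good (s + 1) := by
    by_contra! hcon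
    have hall : ∀ s, Good (s + 1) := by
      intro s
      induction s with
      | zero => exact hG1
      | succ s ih => exact hcon _ (Nat.succ_le_succ (Nat.zero_le _)) ih
    obtain ⟨s, hs⟩ := exists_nat_gt (1 / σ)
    have := hbound _ (hall s)
    rw [div_lt_iff₀ hσ] at hs
    push_cast at this
    nlinarith
  obtain ⟨part, h1, h2, h3⟩ := id hGs
  refine ⟨s, part, hs1, hbound s hGs, h1, h2, h3, ?_⟩
  intro i hi P Q hPQ hun hP hQ
  by_contra! hcon
  refine hGs' ?_
  have hPi : ∀ v ∈ P, part v = i := fun v hv => by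
    have : v ∈ P ∪ Q := Finset.mem_union_left _ hv
    rw [hun] at this; exact (Finset.mem_filter.1 this).2
  have hQi : ∀ v ∈ Q, part v = i := fun v hv => by
    have : v ∈ P ∪ Q := Finset.mem_union_right _ hv
    rw [hun] at this; exact (Finset.mem_filter.1 this).2
  have hiPQ : ∀ v, part v = i → v ∉ Q → v ∈ P := fun v hv hvQ => by
    have : v ∈ P ∪ Q := by rw [hun]; simp [hv]
    exact (Finset.mem_union.1 this).resolve_right hvQ
  refine ⟨fun v => if v ∈ Q then s else part v, fun v => ?_, fun j hj => ?_, ?_⟩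
  · have := h1 v
    dsimp only
    split_ifs <;> omega
  · by_cases hjs : j = s
    · subst hjs
      refine hQ.trans (Nat.cast_le.2 (Finset.card_le_card fun v hv => ?_))
      simp [hv]
    · by_cases hji : j = i
      · subst hji
        refine hP.trans (Nat.cast_le.2 (Finset.card_le_card fun v hv => ?_))
        simp [Finset.disjoint_left.1 hPQ hv, hPi v hv]
      · refine (h2 j (by omega)).trans (Nat.cast_le.2 (Finset.card_le_card fun v hv => ?_))
        rw [Finset.mem_filter] at hv
        have : v ∉ Q := fun h => hji (hv.2.symm.trans (hQi v h))
        simp [this, hv.2]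
  · set part' : V → ℕ := fun v => if v ∈ Q then s else part v with hpart'
    have hle : ∀ v, (crossDeg G part' v : ℝ) ≤ crossDeg G part v +
        ((if v ∈ P then ((Q.filter (G.Adj v)).card : ℝ) else 0) +
        (if v ∈ Q then ((P.filter (G.Adj v)).card : ℝ) else 0)) := by
      intro v
      unfold crossDeg
      by_cases hvQ : v ∈ Q
      · have hvP : v ∉ P := Finset.disjoint_right.1 hPQ hvQ
        rw [if_neg hvP, if_pos hvQ, zero_add]
        norm_cast
        refine (Finset.card_le_card fun u hu => ?_).trans (Finset.card_union_le _ _)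
        simp only [Finset.mem_filter, Finset.mem_univ, true_and, hpart', hvQ, if_true,
          Finset.mem_union] at hu ⊢
        by_cases huQ : u ∈ Q
        · simp [huQ] at hu
        · by_cases hui : part u = i
          · exact Or.inr ⟨hiPQ u hui huQ, hu.1⟩
          · exact Or.inl ⟨hu.1, fun h => hui (h.trans (hQi v hvQ))⟩
      · rw [if_neg hvQ, add_zero]
        by_cases hvP : v ∈ P
        · rw [if_pos hvP]
          norm_cast
          refine (Finset.card_le_card fun u hu => ?_).trans (Finset.card_union_le _ _)
          simp only [Finset.mem_filter, Finset.mem_univ, true_and, hpart', hvQ, if_false,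
            Finset.mem_union] at hu ⊢
          by_cases huQ : u ∈ Q
          · exact Or.inr ⟨huQ, hu.1⟩
          · rw [if_neg huQ] at hu
            exact Or.inl hu
        · rw [if_neg hvP, add_zero]
          refine Nat.cast_le.2 (Finset.card_le_card fun u hu => ?_)
          simp only [Finset.mem_filter, Finset.mem_univ, true_and, hpart', hvQ, if_false] at hu ⊢
          refine ⟨hu.1, fun h => ?_⟩
          by_cases huQ : u ∈ Q
          · exact hvP (hiPQ v (h.symm.trans (hQi u huQ)) hvQ)
          · rw [if_neg huQ] at hu
            exact hu.2 h
    have hsum := Finset.sum_le_sum fun v (_ : v ∈ Finset.univ) => hle v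
    rw [Finset.sum_add_distrib, Finset.sum_add_distrib, ← Finset.sum_filter, ← Finset.sum_filter,
      Finset.filter_mem_eq_inter, Finset.filter_mem_eq_inter, Finset.univ_inter,
      Finset.univ_inter, ← adjPairs_eq_sum, ← adjPairs_eq_sum, adjPairs_comm G Q P] at hsum
    push_cast
    nlinarith

end Classes

lemma closureSeq_eventually_large {V : Type} [Fintype V] [Nonempty V] (G : SimpleGraph V)
    {σ ζ : ℝ} (hζ : 0 < ζ) {Vi : Finset V}
    (hsplit : ∀ P Q : Finset V, Disjoint P Q → P ∪ Q = Vi → σ * Fintype.card V ≤ P.card →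
      σ * Fintype.card V ≤ Q.card → ζ * (Fintype.card V : ℝ) ^ 2 < adjPairs G P Q)
    {I : Finset V} (hI : I ⊆ Vi) (hIc : σ * Fintype.card V ≤ I.card) :
    ∃ j ≤ ⌈2 / ζ⌉₊ + 1,
      ((Vi \ closureSeq G (ζ / 2 * Fintype.card V) I j).card : ℝ) < σ * Fintype.card V := by
  set n : ℝ := ((Fintype.card V : ℕ) : ℝ) with hn
  have hn0 : 0 < n := by rw [hn]; exact_mod_cast Fintype.card_pos
  by_contra! hcon
  set B := closureSeq G (ζ / 2 * n) I with hB
  have hIB : ∀ j, I ⊆ B j := fun j => closureSeq_mono G (ζ / 2 * n) I (Nat.zero_le j)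
  have hstep : ∀ j ≤ ⌈2 / ζ⌉₊ + 1, ((B j).card : ℝ) + ζ / 2 * n ≤ (B (j + 1)).card := by
    intro j hj
    set P := Vi ∩ B j with hP
    set Q := Vi \ B j with hQ
    have h1 := hsplit P Q (Finset.disjoint_left.2 fun v hv hv' =>
        (Finset.mem_sdiff.1 hv').2 (Finset.mem_inter.1 hv).2) (sup_inf_sdiff Vi (B j))
      (hIc.trans (Nat.cast_le.2 (Finset.card_le_card (Finset.subset_inter hI (hIB j)))))
      (hcon j hj)
    rw [adjPairs_comm, adjPairs_eq_sum] at h1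
    set N := Q.filter fun v => ζ / 2 * n ≤ (((B j).filter (G.Adj v)).card : ℝ) with hN
    have h2 : ∑ v ∈ Q, ((P.filter (G.Adj v)).card : ℝ) ≤
        ∑ v ∈ Q, ((if v ∈ N then n else 0) + ζ / 2 * n) := by
      refine Finset.sum_le_sum fun v hv => ?_
      have h3 : ((P.filter (G.Adj v)).card : ℝ) ≤ ((B j).filter (G.Adj v)).card :=
        Nat.cast_le.2 (Finset.card_le_card (Finset.filter_subset_filter _
          Finset.inter_subset_right))
      split_ifs with hvN
      · have h4 : (((B j).filter (G.Adj v)).card : ℝ) ≤ n := by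
          rw [hn]; exact_mod_cast Finset.card_le_univ _
        have : 0 < ζ / 2 * n := by positivity
        linarith
      · have h4 : ¬ ζ / 2 * n ≤ (((B j).filter (G.Adj v)).card : ℝ) := fun h =>
          hvN (Finset.mem_filter.2 ⟨hv, h⟩)
        push Not at h4
        linarith
    rw [Finset.sum_add_distrib, ← Finset.sum_filter, Finset.sum_const, Finset.sum_const,
      nsmul_eq_mul, nsmul_eq_mul] at h2
    have h5 : Q.filter (· ∈ N) = N := by
      ext v; simp only [hN, Finset.mem_filter]; tauto
    rw [h5] at h2
    have h6 : (Q.card : ℝ) ≤ n := by rw [hn]; exact_mod_cast Finset.card_le_univ _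
    have h7 : Q.card * (ζ / 2 * n) ≤ n * (ζ / 2 * n) :=
      mul_le_mul_of_nonneg_right h6 (by positivity)
    have h8 : ζ / 2 * n ≤ N.card := by
      have : (ζ / 2 * n) * n ≤ N.card * n := by nlinarith
      exact le_of_mul_le_mul_right this hn0
    have h9 : (B j).card + N.card ≤ (B (j + 1)).card := by
      rw [← Finset.card_union_of_disjoint]
      · refine Finset.card_le_card (Finset.union_subset
          (closureSeq_mono G _ I (Nat.le_succ j)) fun v hv => ?_)
        exact Finset.mem_union_right _ (Finset.mem_filter.2
          ⟨Finset.mem_univ _, (Finset.mem_filter.1 hv).2⟩)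
      · exact Finset.disjoint_right.2 fun v hv =>
          (Finset.mem_sdiff.1 (Finset.mem_filter.1 hv).1).2
    have h10 : ((B j).card : ℝ) + N.card ≤ (B (j + 1)).card := by exact_mod_cast h9
    linarith
  have hgrow : ∀ j ≤ ⌈2 / ζ⌉₊ + 1, j * (ζ / 2 * n) ≤ (B j).card := by
    intro j
    induction j with
    | zero => intro _; simp
    | succ j ih =>
      intro hj
      have h1 := ih (by omega)
      have h2 := hstep j (by omega)
      push_cast
      linarith
  have h1 := hgrow _ le_rfl
  have h2 : ((B (⌈2 / ζ⌉₊ + 1)).card : ℝ) ≤ n := by rw [hn]; exact_mod_cast Finset.card_le_univ _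
  have h3 := Nat.le_ceil (2 / ζ)
  rw [div_le_iff₀ hζ] at h3
  push_cast at h1
  have h4 : (2 : ℝ) * n ≤ (⌈2 / ζ⌉₊ * ζ) * n := mul_le_mul_of_nonneg_right h3 hn0.le
  have h5 : 0 < ζ * n := by positivity
  nlinarith

/-- A graph of linear minimum degree splits into boundedly many classes such that the closure of
any large subset of a class contains all vertices assigned to that class. -/
lemma exists_classes {μ σ : ℝ} (hμ : 0 < μ) (hμ1 : μ ≤ 1) (hσ : 0 < σ) (hσμ : σ ≤ μ ^ 2 / 8) :
    ∃ (β : ℝ) (J : ℕ), 0 < β ∧ β ≤ 1 ∧ ∀ (V : Type) [Fintype V] [Nonempty V] (G : SimpleGraph V),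
      (∀ v, μ * Fintype.card V ≤ ((Finset.univ.filter (G.Adj v)).card : ℝ)) →
      ∃ (s : ℕ) (part cl : V → ℕ), σ * s ≤ 1 ∧ (∀ v, part v < s) ∧ (∀ v, cl v < s) ∧
        (∀ i < s, μ / 2 * Fintype.card V ≤
          ((Finset.univ.filter fun v => cl v = i ∧ part v = i).card : ℝ)) ∧
        ∀ i < s, ∀ I ⊆ Finset.univ.filter (fun v => part v = i), σ * Fintype.card V ≤ I.card →
          ∀ v, cl v = i → v ∈ closureSeq G (β * Fintype.card V) I J := by
  have hσ1 : σ ≤ 1 := by nlinarith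
  set ζ := σ ^ 2 * μ / 8 with hζ
  have hζ0 : 0 < ζ := by positivity
  have hσ8 : σ ≤ 1 / 8 := by nlinarith
  have hζσ : ζ ≤ σ := by
    have : σ * μ ≤ 1 := mul_le_one₀ hσ1 hμ.le hμ1
    rw [hζ]; nlinarith
  refine ⟨ζ / 2, ⌈2 / ζ⌉₊ + 2, by positivity, by linarith, ?_⟩
  intro V _ _ G hdeg
  set n : ℝ := ((Fintype.card V : ℕ) : ℝ) with hn
  have hn0 : 0 < n := by rw [hn]; exact_mod_cast Fintype.card_pos
  obtain ⟨s, part, hs1, hσs, hpart, hsize, hcross, hsplit⟩ :=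
    exists_unsplittable_partition G (ζ := ζ) hσ hσ1
  rw [← hn] at hsize hcross hsplit
  have hs1R : (1 : ℝ) ≤ s := by exact_mod_cast hs1
  set Vp : ℕ → Finset V := fun i => Finset.univ.filter fun v => part v = i with hVp
  set own : V → ℝ := fun v => (((Vp (part v)).filter (G.Adj v)).card : ℝ) with hown
  have hdegsplit : ∀ v, ((Finset.univ.filter (G.Adj v)).card : ℝ) = own v + crossDeg G part v := by
    intro v
    simp only [hown, crossDeg]
    norm_cast
    rw [← Finset.card_union_of_disjoint]
    · congr 1
      ext u
      simp only [hVp, Finset.mem_filter, Finset.mem_univ, true_and, Finset.mem_union]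
      tauto
    · refine Finset.disjoint_left.2 fun u hu hu' => ?_
      simp only [hVp, Finset.mem_filter, Finset.mem_univ, true_and] at hu hu'
      exact hu'.2 hu.1
  have hcross0 : ∑ v, (crossDeg G part v : ℝ) ≤ 2 * ζ * n ^ 2 * s := by
    refine hcross.trans ?_
    have : 0 ≤ ζ * n ^ 2 := by positivity
    nlinarith
  have hcross1 : ∑ v, (crossDeg G part v : ℝ) ≤ σ * μ / 4 * n ^ 2 := by
    refine hcross0.trans ?_
    have h1 : ζ * s ≤ σ * μ / 8 := by
      have : σ * μ / 8 * (σ * s) ≤ σ * μ / 8 * 1 := mul_le_mul_of_nonneg_left hσs (by positivity)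
      rw [hζ]; linarith
    have h2 := mul_le_mul_of_nonneg_right h1 (by positivity : 0 ≤ 2 * n ^ 2)
    linarith
  have hlarge : ∀ i < s, 3 / 4 * μ * n ≤ (Vp i).card := by
    intro i hi
    have h1 : ∀ v ∈ Vp i, μ * n ≤ (Vp i).card + crossDeg G part v := by
      intro v hv
      have h2 := hdeg v
      rw [hdegsplit v] at h2
      have h3 : own v ≤ (Vp i).card := by
        rw [hown]
        have : part v = i := (Finset.mem_filter.1 hv).2
        simp only [this]
        exact Nat.cast_le.2 (Finset.card_filter_le _ _)
      linarith
    have h2 := Finset.sum_le_sum h1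
    rw [Finset.sum_add_distrib, Finset.sum_const, Finset.sum_const, nsmul_eq_mul,
      nsmul_eq_mul] at h2
    have h3 : ∑ v ∈ Vp i, (crossDeg G part v : ℝ) ≤ σ * μ / 4 * n ^ 2 :=
      (Finset.sum_le_sum_of_subset_of_nonneg (Finset.subset_univ _)
        fun v _ _ => Nat.cast_nonneg _).trans hcross1
    have h4 := hsize i hi
    have h4' : σ * n ≤ (Vp i).card := h4
    have h5 : σ * μ / 4 * n ^ 2 ≤ (Vp i).card * (μ / 4 * n) := by
      have := mul_le_mul_of_nonneg_right h4' (by positivity : 0 ≤ μ / 4 * n)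
      linarith
    have h6 : 0 < ((Vp i).card : ℝ) := lt_of_lt_of_le (by positivity) h4'
    have h7 : (Vp i).card * (3 / 4 * μ * n) ≤ (Vp i).card * ((Vp i).card : ℝ) := by linarith
    exact le_of_mul_le_mul_left h7 h6
  have hsμ : μ * s ≤ 2 := by
    have h3 : (Fintype.card V : ℕ) = ∑ i ∈ Finset.range s, (Vp i).card := by
      rw [← Finset.card_univ]
      exact Finset.card_eq_sum_card_fiberwise fun v _ => by simpa using hpart v
    have h3' : n = ∑ i ∈ Finset.range s, ((Vp i).card : ℝ) := by
      rw [hn, h3]; push_cast; rfl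
    have h4 := Finset.card_nsmul_le_sum (Finset.range s)
      (fun i => ((Vp i).card : ℝ)) (3 / 4 * μ * n) (fun i hi => hlarge i (Finset.mem_range.1 hi))
    rw [← h3', Finset.card_range, nsmul_eq_mul] at h4
    have h5 : (3 / 4 * (μ * s)) * n ≤ 1 * n := by linarith
    have := le_of_mul_le_mul_right h5 hn0
    linarith
  have hcl : ∀ v, ∃ i < s, μ ^ 2 / 4 * n ≤ (((Vp i).filter (G.Adj v)).card : ℝ) ∧
      (μ / 2 * n ≤ own v → i = part v) := by
    intro v
    by_cases hv : μ / 2 * n ≤ own v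
    · refine ⟨part v, hpart v, le_trans ?_ hv, fun _ => rfl⟩
      have : μ ^ 2 ≤ μ := by nlinarith
      nlinarith
    · by_contra! hcon
      have h1 : (Finset.univ.filter (G.Adj v)).card =
          ∑ i ∈ Finset.range s, ((Vp i).filter (G.Adj v)).card := by
        rw [Finset.card_eq_sum_card_fiberwise (f := part) (t := Finset.range s)
          fun u _ => by simpa using hpart u]
        refine Finset.sum_congr rfl fun i _ => ?_
        congr 1
        ext u
        simp only [hVp, Finset.mem_filter, Finset.mem_univ, true_and]
        tauto
      have h2 : ((Finset.univ.filter (G.Adj v)).card : ℝ) ≤ s * (μ ^ 2 / 4 * n) := by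
        rw [h1]; push_cast
        have := Finset.sum_le_card_nsmul (Finset.range s)
          (fun i => (((Vp i).filter (G.Adj v)).card : ℝ)) (μ ^ 2 / 4 * n) (fun i hi => by
            by_contra! hlt
            exact hv (hcon i (Finset.mem_range.1 hi) hlt.le).1)
        simpa using this
      have h3 := hdeg v
      have h4 : μ * s * (μ * n) ≤ 2 * (μ * n) := mul_le_mul_of_nonneg_right hsμ (by positivity)
      have h5 : 0 < μ * n := by positivity
      nlinarith
  choose cl hcls hclN hclp using hcl
  refine ⟨s, part, cl, hσs, hpart, hcls, ?_, ?_⟩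
  · intro i hi
    set bad := (Vp i).filter fun v => cl v ≠ i with hbad
    have h1 : ∀ v ∈ bad, μ / 2 * n ≤ crossDeg G part v := by
      intro v hv
      rw [hbad, Finset.mem_filter] at hv
      have hvi : part v = i := (Finset.mem_filter.1 hv.1).2
      have h2 : ¬ μ / 2 * n ≤ own v := fun h => hv.2 ((hclp v h).trans hvi)
      have h3 := hdeg v
      rw [hdegsplit v] at h3
      push Not at h2
      linarith
    have h2 := Finset.card_nsmul_le_sum bad (fun v => (crossDeg G part v : ℝ)) _ h1
    have h3 : ∑ v ∈ bad, (crossDeg G part v : ℝ) ≤ σ * μ / 4 * n ^ 2 :=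
      (Finset.sum_le_sum_of_subset_of_nonneg (Finset.subset_univ _)
        fun v _ _ => Nat.cast_nonneg _).trans hcross1
    rw [nsmul_eq_mul] at h2
    have h4 : (bad.card : ℝ) ≤ σ / 2 * n := by
      have : bad.card * (μ / 2 * n) ≤ σ / 2 * n * (μ / 2 * n) := by linarith
      exact le_of_mul_le_mul_right this (by positivity)
    have h5 : (Vp i).card =
        bad.card + (Finset.univ.filter fun v => cl v = i ∧ part v = i).card := by
      rw [← Finset.card_filter_add_card_filter_not (s := Vp i) (fun v => cl v ≠ i), ← hbad]
      congr 2
      ext v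
      simp only [hVp, Finset.mem_filter, Finset.mem_univ, true_and, ne_eq, not_not]
      tauto
    have h6 : ((Vp i).card : ℝ) = bad.card +
        ((Finset.univ.filter fun v => cl v = i ∧ part v = i).card : ℝ) := by exact_mod_cast h5
    have h7 := hlarge i hi
    have h8 : σ / 2 ≤ μ / 4 := by nlinarith
    have h9 := mul_le_mul_of_nonneg_right h8 hn0.le
    linarith
  · intro i hi I hI hIc v hv
    obtain ⟨j, hj, hlt⟩ := closureSeq_eventually_large G (σ := σ) hζ0 (hsplit i hi) hI hIc
    rw [← hn] at hlt
    refine closureSeq_mono G _ I (show j + 1 ≤ _ by omega) ?_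
    refine Finset.mem_union_right _ (Finset.mem_filter.2 ⟨Finset.mem_univ _, ?_⟩)
    set B := closureSeq G (ζ / 2 * n) I j with hB
    have h1 := hclN v
    rw [hv] at h1
    have h2 : ((Vp i).filter (G.Adj v)).card ≤ (B.filter (G.Adj v)).card + (Vp i \ B).card := by
      refine (Finset.card_le_card fun u hu => ?_).trans (Finset.card_union_le _ _)
      rw [Finset.mem_filter] at hu
      rw [Finset.mem_union, Finset.mem_filter, Finset.mem_sdiff]
      by_cases huB : u ∈ B
      · exact Or.inl ⟨huB, hu.2⟩
      · exact Or.inr ⟨hu.1, huB⟩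
    have h3 : (((Vp i).filter (G.Adj v)).card : ℝ) ≤
        (B.filter (G.Adj v)).card + (Vp i \ B).card := by exact_mod_cast h2
    have hlt' : ((Vp i \ B).card : ℝ) < σ * n := hlt
    have h4 : ζ / 2 + σ ≤ μ ^ 2 / 4 := by
      have : ζ ≤ μ ^ 2 / 8 := hζσ.trans hσμ
      linarith
    have h5 := mul_le_mul_of_nonneg_right h4 hn0.le
    linarith

section Sumsets

open scoped Pointwise

variable {G : Type*} [AddCommGroup G] [DecidableEq G]

/-- The number of new elements gained by translating `B` by `x`. -/
noncomputable def gain (B : Finset G) (x : G) : ℕ := ((x +ᵥ B) \ B).card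

lemma gain_neg (B : Finset G) (x : G) : gain B (-x) = gain B x := by
  unfold gain
  have h1 : ((-x +ᵥ B) \ B).card = (B \ (x +ᵥ B)).card := by
    rw [← Finset.card_vadd_finset x ((-x +ᵥ B) \ B), Finset.vadd_finset_sdiff, vadd_vadd,
      add_neg_cancel, zero_vadd]
  rw [h1]
  exact Finset.card_sdiff_comm (Finset.card_vadd_finset x B).symm

lemma gain_add_le (B : Finset G) (x y : G) : gain B (x + y) ≤ gain B x + gain B y := by
  unfold gain
  rw [← Finset.card_vadd_finset x ((y +ᵥ B) \ B), Finset.vadd_finset_sdiff, vadd_vadd]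
  refine (Finset.card_le_card ?_).trans (Finset.card_union_le _ _)
  intro z hz
  simp only [Finset.mem_union, Finset.mem_sdiff] at hz ⊢
  tauto

lemma gain_zero (B : Finset G) : gain B 0 = 0 := by
  simp [gain]

lemma gain_le_of_mem_nsmul {B S : Finset G} {M : ℕ} (hS : ∀ x ∈ S, gain B x ≤ M) (r : ℕ) :
    ∀ x ∈ r • S, gain B x ≤ r * M := by
  induction r with
  | zero => intro x hx; rw [zero_nsmul, Finset.mem_zero] at hx; simp [hx, gain_zero]
  | succ r ih =>
    intro x hx
    rw [succ_nsmul, Finset.mem_add] at hx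
    obtain ⟨y, hy, z, hz, rfl⟩ := hx
    have := gain_add_le B y z
    have := ih y hy
    have := hS z hz
    linarith [Nat.succ_mul r M]

lemma exists_large_gain {B W : Finset G} (hB : B.Nonempty) (hW : 2 * B.card ≤ W.card) :
    ∃ g ∈ W, B.card ≤ 2 * gain B g := by
  by_contra! hcon
  have h1 : ∀ g, gain B g + (B.filter fun b => b ∈ g +ᵥ B).card = B.card := by
    intro g
    have h2 : (B.filter fun b => b ∈ g +ᵥ B) = (g +ᵥ B) ∩ B := by
      ext z; simp only [Finset.mem_filter, Finset.mem_inter]; tauto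
    rw [gain, h2, Finset.card_sdiff_add_card_inter, Finset.card_vadd_finset]
  have h2 : ∑ g ∈ W, (B.filter fun b => b ∈ g +ᵥ B).card ≤ B.card * B.card := by
    simp_rw [Finset.card_filter]
    rw [Finset.sum_comm, ← smul_eq_mul]
    refine Finset.sum_le_card_nsmul _ _ _ fun b _ => ?_
    rw [← Finset.card_filter]
    refine Finset.card_le_card_of_injOn (fun g => b - g) (fun g hg => ?_) ?_
    · have hg := (Finset.mem_filter.1 hg).2
      obtain ⟨c, hc, hcb⟩ := Finset.mem_vadd_finset.1 hg
      rw [vadd_eq_add] at hcb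
      simpa [← hcb] using hc
    · intro g _ g' _ h
      simpa using h
  have h3 : ∑ g ∈ W, B.card < ∑ g ∈ W, 2 * (B.filter fun b => b ∈ g +ᵥ B).card := by
    refine Finset.sum_lt_sum_of_nonempty ?_ fun g hg => ?_
    · rw [← Finset.card_pos]
      have := hB.card_pos
      omega
    · have := h1 g
      have := hcon g hg
      omega
  rw [← Finset.mul_sum, Finset.sum_const, smul_eq_mul] at h3
  have h4 := Nat.mul_le_mul_right B.card hW
  nlinarith

lemma card_nsmul_ge [Fintype G] {S : Finset G} (h0 : (0 : G) ∈ S) (hneg : ∀ x ∈ S, -x ∈ S)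
    (hgen : AddSubgroup.closure (S : Set G) = ⊤) (j : ℕ) :
    min (Fintype.card G) ((j + 1) * S.card) ≤ ((3 * j + 1) • S).card := by
  induction j with
  | zero => simp
  | succ j ih =>
    have hmono : ∀ r, r • S ⊆ (r + 1) • S := fun r => by
      rw [succ_nsmul]
      exact Finset.subset_add_left _ h0
    by_cases hst : (3 * j + 3) • S ⊆ (3 * j + 2) • S
    · have hall : ∀ x : G, x ∈ (3 * j + 2) • S := by
        have hadd : ∀ y ∈ (3 * j + 2) • S, ∀ s ∈ S, y + s ∈ (3 * j + 2) • S := fun y hy s hs =>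
          hst (by rw [succ_nsmul]; exact Finset.add_mem_add hy hs)
        intro x
        have hx : x ∈ AddSubgroup.closure (S : Set G) := by rw [hgen]; trivial
        have hz : (0 : G) ∈ (3 * j + 2) • S := by
          have := Finset.nsmul_mem_nsmul (n := 3 * j + 2) h0
          simpa using this
        refine AddSubgroup.closure_induction_right (p := fun y _ => y ∈ (3 * j + 2) • S) hz
          (fun y _ s hs hy => hadd y hy s hs)
          (fun y _ s hs hy => hadd y hy (-s) (hneg s hs)) hx
      have h1 : (3 * (j + 1) + 1) • S = Finset.univ := by
        rw [Finset.eq_univ_iff_forall]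
        exact fun x => hmono _ (hmono _ (hall x))
      rw [h1, Finset.card_univ]
      exact min_le_left _ _
    · obtain ⟨g, hg, hg'⟩ := Finset.not_subset.1 hst
      have hdisj : Disjoint ((3 * j + 1) • S) (g +ᵥ S) := by
        refine Finset.disjoint_left.2 fun u hu hu' => hg' ?_
        obtain ⟨s, hs, rfl⟩ := Finset.mem_vadd_finset.1 hu'
        have h2 : (g +ᵥ s) + -s ∈ (3 * j + 2) • S := by
          rw [show 3 * j + 2 = (3 * j + 1) + 1 by ring, succ_nsmul]
          exact Finset.add_mem_add hu (hneg s hs)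
        simpa using h2
      have hsub : (3 * j + 1) • S ∪ (g +ᵥ S) ⊆ (3 * (j + 1) + 1) • S := by
        refine Finset.union_subset ((hmono _).trans ((hmono _).trans (hmono _))) fun u hu => ?_
        obtain ⟨s, hs, rfl⟩ := Finset.mem_vadd_finset.1 hu
        rw [show 3 * (j + 1) + 1 = (3 * j + 3) + 1 by ring, succ_nsmul]
        exact Finset.add_mem_add hg hs
      have h3 := Finset.card_le_card hsub
      rw [Finset.card_union_of_disjoint hdisj, Finset.card_vadd_finset] at h3
      have h4 : (j + 1 + 1) * S.card = (j + 1) * S.card + S.card := by ring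
      rw [h4]
      omega

/-- A small set in a finite abelian group grows when shifted by a suitable element of a given
generating set. -/
lemma exists_gain_of_closure_eq_top [Fintype G] {S B : Finset G}
    (hgen : AddSubgroup.closure (S : Set G) = ⊤) {t : ℕ} (ht : 1 ≤ t) (htB : t ≤ B.card)
    (htS : t ≤ (insert 0 S).card) (hB : 2 * B.card ≤ Fintype.card G) :
    ∃ x ∈ S, t ≤ 14 * gain B x := by
  set M := S.sup (gain B) with hM
  have hS : ∀ x ∈ S, gain B x ≤ M := fun x hx => Finset.le_sup hx
  set S' := insert 0 (S ∪ -S) with hS'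
  have hS'M : ∀ x ∈ S', gain B x ≤ M := by
    intro x hx
    rw [hS', Finset.mem_insert, Finset.mem_union, Finset.mem_neg'] at hx
    rcases hx with rfl | hx | hx
    · rw [gain_zero]; exact Nat.zero_le _
    · exact hS x hx
    · rw [← gain_neg]; exact hS _ hx
  have hneg : ∀ x ∈ S', -x ∈ S' := by
    intro x hx
    rw [hS', Finset.mem_insert, Finset.mem_union, Finset.mem_neg'] at hx ⊢
    rw [neg_neg, neg_eq_zero]
    tauto
  have hgen' : AddSubgroup.closure (S' : Set G) = ⊤ := by
    rw [eq_top_iff, ← hgen]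
    refine AddSubgroup.closure_mono fun x hx => ?_
    rw [hS']
    simp only [Finset.coe_insert, Finset.coe_union, Set.mem_insert_iff, Set.mem_union]
    tauto
  have htS' : t ≤ S'.card := htS.trans (Finset.card_le_card
    (Finset.insert_subset_insert _ Finset.subset_union_left))
  set j := 2 * B.card / t with hj
  have h1 := card_nsmul_ge (Finset.mem_insert_self _ _) hneg hgen' j
  have h2 : 2 * B.card ≤ (j + 1) * t := by
    have := Nat.lt_mul_div_succ (2 * B.card) ht
    rw [← hj] at this
    linarith [Nat.mul_comm t (j + 1)]
  have h3 : 2 * B.card ≤ ((3 * j + 1) • S').card :=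
    (le_min hB (h2.trans (Nat.mul_le_mul_left _ htS'))).trans h1
  obtain ⟨g, hg, hgB⟩ := exists_large_gain (Finset.card_pos.1 (ht.trans htB)) h3
  have h4 := gain_le_of_mem_nsmul hS'M _ g hg
  have h5 : j * t ≤ 2 * B.card := Nat.div_mul_le_self _ _
  have hBM : t ≤ 14 * M := by
    have h6 : B.card * t ≤ B.card * (14 * M) := by nlinarith
    exact Nat.le_of_mul_le_mul_left h6 (ht.trans htB)
  have hSne : S.Nonempty := by
    rw [Finset.nonempty_iff_ne_empty]
    rintro rfl
    rw [Finset.sup_empty] at hM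
    simp only [Nat.bot_eq_zero] at hM
    omega
  obtain ⟨x, hx, hxM⟩ := Finset.exists_mem_eq_sup S hSne (gain B)
  exact ⟨x, hx, by rw [← hxM]; exact hBM⟩

end Sumsets

section SubsetSums

open scoped Pointwise

variable {ι : Type*}

/-- Every residue in `B` is the residue of a subset sum over `U` of size at most `s`. -/
def AttainsResidues (a : ι → ℕ) (U : Finset ι) (s m : ℕ) (B : Finset (ZMod m)) : Prop :=
  ∀ b ∈ B, ∃ S ⊆ U, ∑ i ∈ S, a i ≤ s ∧ ((∑ i ∈ S, a i : ℕ) : ZMod m) = b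

lemma AttainsResidues.insert [DecidableEq ι] {a : ι → ℕ} {U : Finset ι} {s m w : ℕ}
    {B : Finset (ZMod m)}
    (h : AttainsResidues a U s m B) {i : ι} (hi : i ∉ U) (hw : a i ≤ w) :
    AttainsResidues a (insert i U) (s + w) m (B ∪ ((a i : ZMod m) +ᵥ B)) := by
  intro b hb
  rcases Finset.mem_union.1 hb with hb | hb
  · obtain ⟨S, hS, h1, h2⟩ := h b hb
    exact ⟨S, hS.trans (Finset.subset_insert _ _), by omega, h2⟩
  · obtain ⟨c, hc, rfl⟩ := Finset.mem_vadd_finset.1 hb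
    obtain ⟨S, hS, h1, h2⟩ := h c hc
    have hiS : i ∉ S := fun h => hi (hS h)
    refine ⟨Insert.insert i S, Finset.insert_subset_insert _ hS, ?_, ?_⟩
    · rw [Finset.sum_insert hiS]; omega
    · rw [Finset.sum_insert hiS, Nat.cast_add, h2, vadd_eq_add]

lemma closure_natCast_eq_top {I : Finset ι} {a : ι → ℕ} (m : ℕ) (hgcd : I.gcd a = 1) :
    AddSubgroup.closure (((I.filter fun i => a i ≠ m).image fun i => (a i : ZMod m) :
      Finset (ZMod m)) : Set (ZMod m)) = ⊤ := by
  set H := AddSubgroup.closure (((I.filter fun i => a i ≠ m).image fun i => (a i : ZMod m) :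
      Finset (ZMod m)) : Set (ZMod m)) with hH
  have hmem : ∀ i ∈ I, (a i : ZMod m) ∈ H := by
    intro i hi
    by_cases him : a i = m
    · rw [him, ZMod.natCast_self]; exact H.zero_mem
    · refine AddSubgroup.subset_closure ?_
      exact Finset.mem_coe.2 (Finset.mem_image_of_mem _ (Finset.mem_filter.2 ⟨hi, him⟩))
  set K := H.comap (Int.castAddHom (ZMod m)) with hK
  obtain ⟨g, hg⟩ := Int.subgroup_cyclic K
  have hdvd : ∀ i ∈ I, g.natAbs ∣ a i := by
    intro i hi
    have h1 : ((a i : ℕ) : ℤ) ∈ K := by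
      rw [hK, AddSubgroup.mem_comap]
      simpa using hmem i hi
    rw [hg, ← AddSubgroup.zmultiples_eq_closure, Int.mem_zmultiples_iff] at h1
    exact Int.natAbs_dvd_natAbs.2 h1
  have hg1 : g.natAbs = 1 := by
    have := Finset.dvd_gcd hdvd
    rw [hgcd] at this
    exact Nat.dvd_one.1 this
  have h1 : ∀ z : ℤ, z ∈ K := by
    intro z
    rw [hg, ← AddSubgroup.zmultiples_eq_closure, Int.mem_zmultiples_iff, ← Int.natAbs_dvd, hg1]
    exact one_dvd _
  rw [eq_top_iff]
  intro x _
  obtain ⟨z, rfl⟩ := ZMod.intCast_surjective x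
  exact h1 z

lemma card_mul_le_card_image_natCast {V : Finset ℕ} {w m : ℕ} (hmw : m ≤ w)
    (hV : ∀ v ∈ V, v ≤ w) :
    V.card * m ≤ 2 * w * (V.image fun v : ℕ => (v : ZMod m)).card := by
  have h1 : V.card ≤ ((V.image fun v : ℕ => (v : ZMod m)) ×ˢ Finset.range (w / m + 1)).card := by
    refine Finset.card_le_card_of_injOn (fun v => ((v : ZMod m), v / m)) (fun v hv => ?_) ?_
    · have := Nat.div_le_div_right (c := m) (hV v hv)
      simp only [Finset.coe_product, Set.mem_prod, Finset.mem_coe, Finset.mem_range]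
      exact ⟨Finset.mem_image_of_mem _ hv, by omega⟩
    · intro v _ v' _ h
      simp only [Prod.mk.injEq, ZMod.natCast_eq_natCast_iff'] at h
      rw [← Nat.div_add_mod v m, ← Nat.div_add_mod v' m, h.1, h.2]
  rw [Finset.card_product, Finset.card_range] at h1
  have h2 := Nat.div_mul_le_self w m
  calc V.card * m ≤ (V.image fun v : ℕ => (v : ZMod m)).card * (w / m + 1) * m :=
        Nat.mul_le_mul_right _ h1
    _ = (V.image fun v : ℕ => (v : ZMod m)).card * (w / m * m + m) := by ring
    _ ≤ (V.image fun v : ℕ => (v : ZMod m)).card * (2 * w) := Nat.mul_le_mul_left _ (by omega)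
    _ = _ := by ring

lemma exists_attainsResidues_half [DecidableEq ι] {I : Finset ι} {a : ι → ℕ} {w m r : ℕ}
    {V : Finset ℕ}
    (hm : 1 ≤ m) (hmw : m ≤ w) (haw : ∀ i ∈ I, a i ≤ w)
    (hVne : V.Nonempty) (hVw : ∀ v ∈ V, 1 ≤ v ∧ v ≤ w)
    (hVr : ∀ v ∈ V, 2 * r + 3 ≤ (I.filter fun i => a i = v).card)
    (hr : 14 * w < r * V.card)
    (hgcd : ∀ U ⊆ I, U.card ≤ 2 * (w + r) → (I \ U).gcd a = 1)
    {U₀ : Finset ι} (hU₀I : U₀ ⊆ I) (hU₀ : U₀.card ≤ w + r)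
    (hU₀c : ∀ v, (U₀.filter fun i => a i = v).card ≤ r + 1) :
    ∃ U ⊆ I, Disjoint U U₀ ∧ (∀ i ∈ U, a i ≠ m) ∧ U.card ≤ w + r ∧
      (∀ v, (U.filter fun i => a i = v).card ≤ r + 1) ∧
      ∃ B : Finset (ZMod m), m < 2 * B.card ∧ AttainsResidues a U ((r + 1) * w) m B := by
  have : NeZero m := ⟨by omega⟩
  set T := V.image fun v : ℕ => (v : ZMod m) with hT
  set t := T.card with ht
  have ht1 : 1 ≤ t := Finset.card_pos.2 (hVne.image _)
  have hVt := card_mul_le_card_image_natCast hmw fun v hv => (hVw v hv).2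
  rw [← hT, ← ht] at hVt
  have key : ∀ j ≤ r, ∃ U ⊆ I, Disjoint U U₀ ∧ (∀ i ∈ U, a i ≠ m) ∧ U.card ≤ w + j ∧
      (∀ v, (U.filter fun i => a i = v).card ≤ j + 1) ∧
      ∃ B : Finset (ZMod m), t ≤ B.card ∧ (m < 2 * B.card ∨ j * t ≤ 14 * B.card) ∧
        AttainsResidues a U ((j + 1) * w) m B := by
    intro j
    induction j with
    | zero =>
      intro _
      have hex : ∀ v : V, ∃ i ∈ I, i ∉ U₀ ∧ a i = v := by
        intro v
        have h1 := hVr v v.2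
        have h2 := hU₀c v
        obtain ⟨i, hi, hi'⟩ := Finset.exists_mem_notMem_of_card_lt_card
          (show (U₀.filter fun i => a i = v).card < (I.filter fun i => a i = v).card by omega)
        rw [Finset.mem_filter] at hi hi'
        exact ⟨i, hi.1, fun h => hi' ⟨h, hi.2⟩, hi.2⟩
      choose e heI heU hev using hex
      set U := (V.attach.filter fun v : V => (v : ℕ) ≠ m).image e with hU
      have hmemU : ∀ i, i ∈ U → ∃ v : V, (v : ℕ) ≠ m ∧ e v = i := by
        intro i hi
        obtain ⟨v, hv, rfl⟩ := Finset.mem_image.1 hi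
        exact ⟨v, (Finset.mem_filter.1 hv).2, rfl⟩
      refine ⟨U, ?_, ?_, ?_, ?_, ?_, T, le_rfl, Or.inr (by omega), ?_⟩
      · intro i hi
        obtain ⟨v, -, rfl⟩ := hmemU i hi
        exact heI v
      · refine Finset.disjoint_left.2 fun i hi => ?_
        obtain ⟨v, -, rfl⟩ := hmemU i hi
        exact heU v
      · intro i hi
        obtain ⟨v, hv, rfl⟩ := hmemU i hi
        rw [hev v]; exact hv
      · have h1 : U.card ≤ V.card := by
          refine Finset.card_image_le.trans ((Finset.card_filter_le _ _).trans ?_)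
          rw [Finset.card_attach]
        have h2 : V.card ≤ (Finset.Icc 1 w).card :=
          Finset.card_le_card fun v hv => Finset.mem_Icc.2 (hVw v hv)
        rw [Nat.card_Icc] at h2
        omega
      · intro v
        rw [Finset.card_le_one]
        intro i hi i' hi'
        rw [Finset.mem_filter] at hi hi'
        obtain ⟨u, -, rfl⟩ := hmemU i hi.1
        obtain ⟨u', -, rfl⟩ := hmemU i' hi'.1
        rw [hev] at hi hi'
        rw [show u = u' from Subtype.ext (hi.2.trans hi'.2.symm)]
      · intro b hb
        obtain ⟨v, hv, rfl⟩ := Finset.mem_image.1 hb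
        by_cases hvm : v = m
        · exact ⟨∅, Finset.empty_subset _, by simp, by simp [hvm]⟩
        · refine ⟨{e ⟨v, hv⟩}, ?_, ?_, ?_⟩
          · rw [Finset.singleton_subset_iff]
            exact Finset.mem_image_of_mem _ (Finset.mem_filter.2 ⟨Finset.mem_attach _ _, hvm⟩)
          · rw [Finset.sum_singleton, hev]
            have := (hVw v hv).2
            simpa using this
          · rw [Finset.sum_singleton, hev]
    | succ j ih =>
      intro hj
      obtain ⟨U, hUI, hUd, hUm, hUc, hUv, B, hBt, hB, hatt⟩ := ih (by omega)
      by_cases hhalf : m < 2 * B.card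
      · refine ⟨U, hUI, hUd, hUm, by omega, fun v => (hUv v).trans (by omega), B, hBt,
          Or.inl hhalf, fun b hb => ?_⟩
        obtain ⟨S, hS, h1, h2⟩ := hatt b hb
        exact ⟨S, hS, h1.trans (Nat.mul_le_mul_right _ (by omega)), h2⟩
      · have hB' := hB.resolve_left hhalf
        set P := I \ (U₀ ∪ U) with hP
        have hPgcd : P.gcd a = 1 := by
          refine hgcd _ (Finset.union_subset hU₀I hUI) ((Finset.card_union_le _ _).trans ?_)
          omega
        have hgen := closure_natCast_eq_top m hPgcd
        have hTS : T ⊆ insert 0 ((P.filter fun i => a i ≠ m).image fun i => (a i : ZMod m)) := by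
          intro b hb
          obtain ⟨v, hv, rfl⟩ := Finset.mem_image.1 hb
          by_cases hvm : v = m
          · rw [hvm, ZMod.natCast_self]; exact Finset.mem_insert_self _ _
          · refine Finset.mem_insert_of_mem (Finset.mem_image.2 ?_)
            have h1 := hVr v hv
            have h2 := hU₀c v
            have h3 := hUv v
            have h4 : ((U₀ ∪ U).filter fun i => a i = v).card <
                (I.filter fun i => a i = v).card := by
              rw [Finset.filter_union]
              have := Finset.card_union_le (U₀.filter fun i => a i = v) (U.filter fun i => a i = v)
              omega
            obtain ⟨i, hi, hi'⟩ := Finset.exists_mem_notMem_of_card_lt_card h4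
            rw [Finset.mem_filter] at hi hi'
            refine ⟨i, Finset.mem_filter.2 ⟨Finset.mem_sdiff.2 ⟨hi.1, fun h => hi' ⟨h, hi.2⟩⟩, ?_⟩,
              ?_⟩
            · rw [hi.2]; exact hvm
            · rw [hi.2]
        obtain ⟨x, hx, hxt⟩ := exists_gain_of_closure_eq_top hgen ht1 hBt
          (Finset.card_le_card hTS) (by rw [ZMod.card]; omega)
        obtain ⟨i, hi, rfl⟩ := Finset.mem_image.1 hx
        rw [Finset.mem_filter, Finset.mem_sdiff, Finset.mem_union, not_or] at hi
        obtain ⟨⟨hiI, hiU₀, hiU⟩, him⟩ := hi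
        have hcard : (B ∪ ((a i : ZMod m) +ᵥ B)).card = B.card + gain B (a i : ZMod m) := by
          rw [gain, ← Finset.card_union_of_disjoint Finset.disjoint_sdiff,
            Finset.union_sdiff_self_eq_union]
        refine ⟨insert i U, Finset.insert_subset hiI hUI,
          Finset.disjoint_insert_left.2 ⟨hiU₀, hUd⟩, ?_, ?_, ?_,
          B ∪ ((a i : ZMod m) +ᵥ B), ?_, Or.inr ?_, ?_⟩
        rotate_left 5
        · have := hatt.insert hiU (haw i hiI)
          rw [show (j + 1 + 1) * w = (j + 1) * w + w by ring]
          exact this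
        · intro i' hi'
          rcases Finset.mem_insert.1 hi' with rfl | hi'
          exacts [him, hUm i' hi']
        · rw [Finset.card_insert_of_notMem hiU]; omega
        · intro v
          rw [Finset.filter_insert]
          have := hUv v
          split_ifs
          · exact (Finset.card_insert_le _ _).trans (by omega)
          · omega
        · rw [hcard]; omega
        · rw [hcard]; nlinarith
  obtain ⟨U, hUI, hUd, hUm, hUc, hUv, B, hBt, hB, hatt⟩ := key r le_rfl
  refine ⟨U, hUI, hUd, hUm, hUc, hUv, B, ?_, hatt⟩
  rcases hB with hB | hB
  · exact hB
  · by_contra! hcon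
    have h1 : r * V.card * m ≤ 14 * w * m := by
      calc r * V.card * m = r * (V.card * m) := by ring
        _ ≤ r * (2 * w * t) := Nat.mul_le_mul_left _ hVt
        _ = 2 * w * (r * t) := by ring
        _ ≤ 2 * w * (14 * B.card) := Nat.mul_le_mul_left _ hB
        _ = 14 * w * (2 * B.card) := by ring
        _ ≤ 14 * w * m := Nat.mul_le_mul_left _ hcon
    have := Nat.le_of_mul_le_mul_right h1 (by omega)
    omega

lemma exists_interval_of_rich [DecidableEq ι] {I : Finset ι} {a : ι → ℕ} {w r q : ℕ} {V : Finset ℕ}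
    (haw : ∀ i ∈ I, a i ≤ w) (hVne : V.Nonempty) (hVw : ∀ v ∈ V, 1 ≤ v ∧ v ≤ w)
    (hVq : ∀ v ∈ V, q ≤ v * (I.filter fun i => a i = v).card)
    (hr : 14 * w < r * V.card) (hq : (2 * r + 3) * w ≤ q)
    (hgcd : ∀ U ⊆ I, U.card ≤ 2 * (w + r) → (I \ U).gcd a = 1) :
    ∃ x, ∀ y, x ≤ y → y ≤ x + w → ∃ S ⊆ I, ∑ i ∈ S, a i = y := by
  obtain ⟨m, hmV⟩ := hVne
  obtain ⟨hm, hmw⟩ := hVw m hmV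
  have hVr : ∀ v ∈ V, 2 * r + 3 ≤ (I.filter fun i => a i = v).card := by
    intro v hv
    have h1 := (hq.trans (hVq v hv)).trans (Nat.mul_le_mul_right _ (hVw v hv).2)
    rw [Nat.mul_comm] at h1
    exact Nat.le_of_mul_le_mul_left h1 (by omega)
  obtain ⟨U, hUI, -, hUm, hUc, hUv, B, hB, hatt⟩ :=
    exists_attainsResidues_half hm hmw haw ⟨m, hmV⟩ hVw hVr hr hgcd (Finset.empty_subset I)
      (by simp) (by simp)
  obtain ⟨U', hUI', hUd', hUm', -, -, B', hB', hatt'⟩ :=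
    exists_attainsResidues_half hm hmw haw ⟨m, hmV⟩ hVw hVr hr hgcd hUI hUc hUv
  have : NeZero m := ⟨by omega⟩
  have hall : ∀ b : ZMod m, ∃ S ⊆ U ∪ U', ∑ i ∈ S, a i ≤ 2 * (r + 1) * w ∧
      ((∑ i ∈ S, a i : ℕ) : ZMod m) = b := by
    intro b
    have h1 : ¬ Disjoint (B'.image fun c => b - c) B := by
      intro hd
      have h2 := Finset.card_union_of_disjoint hd
      rw [Finset.card_image_of_injective _ sub_right_injective] at h2
      have h3 := Finset.card_le_univ ((B'.image fun c => b - c) ∪ B)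
      rw [ZMod.card] at h3
      omega
    obtain ⟨c, hc, hcB⟩ := Finset.not_disjoint_iff.1 h1
    obtain ⟨c', hc', rfl⟩ := Finset.mem_image.1 hc
    obtain ⟨S, hS, hs1, hs2⟩ := hatt _ hcB
    obtain ⟨S', hS', hs1', hs2'⟩ := hatt' _ hc'
    have hd : Disjoint S S' := Finset.disjoint_of_subset_left hS
      (Finset.disjoint_of_subset_right hS' hUd'.symm)
    refine ⟨S ∪ S', Finset.union_subset_union hS hS', ?_, ?_⟩
    · rw [Finset.sum_union hd]; linarith
    · rw [Finset.sum_union hd, Nat.cast_add, hs2, hs2', sub_add_cancel]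
  refine ⟨2 * (r + 1) * w, fun y hxy hyx => ?_⟩
  obtain ⟨S, hS, hs1, hs2⟩ := hall y
  set s := ∑ i ∈ S, a i with hs
  have hsy : s ≤ y := hs1.trans hxy
  have hdvd : m ∣ y - s := by
    rw [← ZMod.natCast_eq_zero_iff, Nat.cast_sub hsy, hs2, sub_self]
  obtain ⟨e, he⟩ := hdvd
  have hle : e ≤ (I.filter fun i => a i = m).card := by
    have h1 : m * e ≤ m * (I.filter fun i => a i = m).card := by
      have := hVq m hmV
      rw [← he]
      have : 2 * (r + 1) * w + w = (2 * r + 3) * w := by ring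
      omega
    exact Nat.le_of_mul_le_mul_left h1 (by omega)
  obtain ⟨M, hMsub, hMc⟩ := Finset.exists_subset_card_eq hle
  have hMm : ∀ i ∈ M, a i = m := fun i hi => (Finset.mem_filter.1 (hMsub hi)).2
  have hd : Disjoint S M := by
    refine Finset.disjoint_left.2 fun i hi hi' => ?_
    rcases Finset.mem_union.1 (hS hi) with h | h
    · exact hUm i h (hMm i hi')
    · exact hUm' i h (hMm i hi')
  refine ⟨S ∪ M, Finset.union_subset (hS.trans (Finset.union_subset hUI hUI'))
    (hMsub.trans (Finset.filter_subset _ _)), ?_⟩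
  rw [Finset.sum_union hd, Finset.sum_congr rfl hMm, Finset.sum_const, hMc, smul_eq_mul, ← hs]
  rw [Nat.mul_comm]
  omega

lemma exists_rich_values {I : Finset ι} {a : ι → ℕ} {w : ℕ} (haw : ∀ i ∈ I, 1 ≤ a i ∧ a i ≤ w)
    {C : ℝ} (hC : C * (1 + Real.log ((∑ i ∈ I, a i : ℕ) : ℝ)) ≤ ((∑ i ∈ I, a i : ℕ) : ℝ))
    (hI : I.Nonempty) :
    ∃ q, 1 ≤ q ∧ C ≤ q * (((Finset.Icc 1 w).filter fun v =>
      q ≤ v * (I.filter fun i => a i = v).card).card : ℝ) := by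
  set N := ∑ i ∈ I, a i with hN
  set p : ℕ → ℕ := fun v => v * (I.filter fun i => a i = v).card with hp
  by_contra! hcon
  have h1 : N = ∑ v ∈ Finset.Icc 1 w, p v := by
    rw [hN, ← Finset.sum_fiberwise_of_maps_to (t := Finset.Icc 1 w) (g := a)
      fun i hi => Finset.mem_Icc.2 (haw i hi)]
    refine Finset.sum_congr rfl fun v _ => ?_
    rw [Finset.sum_congr rfl (g := fun _ => v) fun i hi => (Finset.mem_filter.1 hi).2,
      Finset.sum_const, smul_eq_mul, Nat.mul_comm]
  have hpN : ∀ v ∈ Finset.Icc 1 w, p v ≤ N := fun v hv => by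
    rw [h1]; exact Finset.single_le_sum (f := p) (fun _ _ => Nat.zero_le _) hv
  have h2 : N = ∑ q ∈ Finset.Icc 1 N, ((Finset.Icc 1 w).filter fun v => q ≤ p v).card := by
    simp_rw [Finset.card_filter]
    rw [Finset.sum_comm]
    refine h1.trans (Finset.sum_congr rfl fun v hv => ?_)
    rw [← Finset.card_filter]
    have : (Finset.Icc 1 N).filter (fun q => q ≤ p v) = Finset.Icc 1 (p v) := by
      have := hpN v hv
      ext q
      simp only [Finset.mem_filter, Finset.mem_Icc]
      omega
    rw [this, Nat.card_Icc]
    omega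
  have hN1 : 1 ≤ N := by
    obtain ⟨i, hi⟩ := hI
    exact (haw i hi).1.trans (Finset.single_le_sum (f := a) (fun _ _ => Nat.zero_le _) hi)
  have h3 : (N : ℝ) < ∑ q ∈ Finset.Icc 1 N, C * (q : ℝ)⁻¹ := by
    conv_lhs => rw [h2]
    push_cast
    refine Finset.sum_lt_sum_of_nonempty ⟨1, Finset.mem_Icc.2 ⟨le_rfl, hN1⟩⟩ fun q hq => ?_
    have hq1 := (Finset.mem_Icc.1 hq).1
    have hq0 : (0 : ℝ) < q := by exact_mod_cast hq1
    rw [← div_eq_mul_inv, lt_div_iff₀ hq0, mul_comm]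
    exact hcon q hq1
  rw [← Finset.mul_sum] at h3
  have h4 := harmonic_le_one_add_log N
  have h5 : ((harmonic N : ℚ) : ℝ) = ∑ q ∈ Finset.Icc 1 N, (q : ℝ)⁻¹ := by
    rw [harmonic_eq_sum_Icc]; push_cast; rfl
  rw [h5] at h4
  have hC0 : 0 < C := by
    by_contra! hC0
    have h6 : 0 ≤ ∑ q ∈ Finset.Icc 1 N, (q : ℝ)⁻¹ :=
      Finset.sum_nonneg fun q _ => inv_nonneg.2 (Nat.cast_nonneg _)
    have h7 : (0 : ℝ) ≤ N := Nat.cast_nonneg _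
    nlinarith
  have := mul_le_mul_of_nonneg_left h4 hC0.le
  linarith

/-- Integers of size at most `w` whose greatest common divisor is robustly one, and whose sum is
large, have all the numbers in some interval of length `w` among their subset sums. -/
lemma exists_interval_of_subset_sums [DecidableEq ι] {I : Finset ι} {a : ι → ℕ} {w : ℕ} (hw : 1 ≤ w)
    (haw : ∀ i ∈ I, 1 ≤ a i ∧ a i ≤ w) (hI : I.Nonempty)
    (hlarge : 33 * (w : ℝ) ^ 2 * (1 + Real.log ((∑ i ∈ I, a i : ℕ) : ℝ)) ≤
      ((∑ i ∈ I, a i : ℕ) : ℝ))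
    (hgcd : ∀ U ⊆ I, U.card ≤ 32 * w → (I \ U).gcd a = 1) :
    ∃ x, ∀ y, x ≤ y → y ≤ x + w → ∃ S ⊆ I, ∑ i ∈ S, a i = y := by
  obtain ⟨q, hq1, hq⟩ := exists_rich_values haw hlarge hI
  set V := (Finset.Icc 1 w).filter fun v => q ≤ v * (I.filter fun i => a i = v).card with hV
  have hq' : 33 * w ^ 2 ≤ q * V.card := by exact_mod_cast hq
  have hVpos : 1 ≤ V.card := by
    by_contra! h
    have h0 : V.card = 0 := by omega
    rw [h0] at hq'
    have : 0 < w ^ 2 := by positivity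
    omega
  have hVw : V.card ≤ w := by
    refine (Finset.card_filter_le _ _).trans ?_
    rw [Nat.card_Icc]; omega
  have hdiv := Nat.div_mul_le_self (14 * w) V.card
  have hdiv' := Nat.lt_mul_div_succ (14 * w) hVpos
  have hr14 : 14 * w / V.card ≤ 14 * w := Nat.div_le_self _ _
  refine exists_interval_of_rich (r := 14 * w / V.card + 1) (q := q) (V := V)
    (fun i hi => (haw i hi).2) (Finset.card_pos.1 hVpos) (fun v hv => ?_) (fun v hv => ?_) ?_ ?_ ?_
  · exact Finset.mem_Icc.1 (Finset.mem_filter.1 hv).1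
  · exact (Finset.mem_filter.1 hv).2
  · rwa [Nat.mul_comm (14 * w / V.card + 1)]
  · refine Nat.le_of_mul_le_mul_right (le_trans ?_ hq') hVpos
    nlinarith
  · intro U hU hUc
    exact hgcd U hU (by omega)

end SubsetSums

section Bins

variable {W : Type}

/-- `p` is a disjoint union of sets closed under adjacency whose orders are coprime. -/
def SplitsCoprimely (H : SimpleGraph W) (p : Finset W) : Prop :=
  ∃ 𝒦 : Finset (Finset W), (𝒦 : Set (Finset W)).PairwiseDisjoint id ∧
    (∀ C ∈ 𝒦, C.Nonempty ∧ AdjClosed H C) ∧ 𝒦.biUnion id = p ∧ 𝒦.gcd Finset.card = 1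

lemma card_biUnion_id {𝒲 : Finset (Finset W)} (hd : (𝒲 : Set (Finset W)).PairwiseDisjoint id) :
    (𝒲.biUnion id).card = ∑ p ∈ 𝒲, p.card :=
  Finset.card_biUnion fun _ hp _ hq hpq => hd hp hq hpq

lemma exists_subfamily_card {𝒲 : Finset (Finset W)} {w t : ℕ} (hw : ∀ p ∈ 𝒲, p.card ≤ w)
    (ht : t ≤ ∑ p ∈ 𝒲, p.card) :
    ∃ 𝒢 ⊆ 𝒲, t ≤ ∑ p ∈ 𝒢, p.card ∧ ∑ p ∈ 𝒢, p.card ≤ t + w := by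
  induction 𝒲 using Finset.induction_on with
  | empty => exact ⟨∅, le_rfl, ht, by simp⟩
  | insert p 𝒲 hp ih =>
    by_cases h : t ≤ ∑ p ∈ 𝒲, p.card
    · obtain ⟨𝒢, h1, h2⟩ := ih (fun q hq => hw q (Finset.mem_insert_of_mem hq)) h
      exact ⟨𝒢, h1.trans (Finset.subset_insert _ _), h2⟩
    · refine ⟨insert p 𝒲, le_rfl, ht, ?_⟩
      rw [Finset.sum_insert hp]
      have := hw p (Finset.mem_insert_self _ _)
      omega

lemma exists_interval_of_tiles {H : SimpleGraph W} {𝓕 : Finset (Finset W)} {w : ℕ} (hw : 1 ≤ w)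
    (hd : (𝓕 : Set (Finset W)).PairwiseDisjoint id) (hs : ∀ p ∈ 𝓕, SplitsCoprimely H p)
    (hpw : ∀ p ∈ 𝓕, p.card ≤ w)
    (hlarge : 33 * (w : ℝ) ^ 2 * (1 + Real.log ((∑ p ∈ 𝓕, p.card : ℕ) : ℝ)) ≤
      ((∑ p ∈ 𝓕, p.card : ℕ) : ℝ)) (hne : 1 ≤ ∑ p ∈ 𝓕, p.card) :
    ∃ x, ∀ y, x ≤ y → y ≤ x + w → ∃ A ⊆ 𝓕.biUnion id, AdjClosed H A ∧ A.card = y := by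
  have hs' : ∀ p : Finset W, ∃ 𝒦 : Finset (Finset W), p ∈ 𝓕 →
      ((𝒦 : Set (Finset W)).PairwiseDisjoint id ∧
      (∀ C ∈ 𝒦, C.Nonempty ∧ AdjClosed H C) ∧ 𝒦.biUnion id = p ∧ 𝒦.gcd Finset.card = 1) := by
    intro p
    by_cases hp : p ∈ 𝓕
    · obtain ⟨𝒦, h⟩ := hs p hp
      exact ⟨𝒦, fun _ => h⟩
    · exact ⟨∅, fun h => absurd h hp⟩
  choose 𝒦 h𝒦 using hs'
  have hsub : ∀ p ∈ 𝓕, ∀ C ∈ 𝒦 p, C ⊆ p := fun p hp C hC => by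
    conv_rhs => rw [← (h𝒦 p hp).2.2.1]
    exact Finset.subset_biUnion_of_mem id hC
  have hKd : ∀ p ∈ 𝓕, ∀ q ∈ 𝓕, p ≠ q → Disjoint (𝒦 p) (𝒦 q) := by
    intro p hp q hq hpq
    refine Finset.disjoint_left.2 fun C hC hC' => ?_
    obtain ⟨x, hx⟩ := ((h𝒦 p hp).2.1 C hC).1
    exact Finset.disjoint_left.1 (hd hp hq hpq) (hsub p hp C hC hx) (hsub q hq C hC' hx)
  set I := 𝓕.biUnion 𝒦 with hI
  have hId : (I : Set (Finset W)).PairwiseDisjoint id := by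
    intro C hC C' hC' hne
    obtain ⟨p, hp, hCp⟩ := Finset.mem_biUnion.1 hC
    obtain ⟨q, hq, hCq⟩ := Finset.mem_biUnion.1 hC'
    by_cases hpq : p = q
    · subst hpq
      exact (h𝒦 p hp).1 hCp hCq hne
    · exact Finset.disjoint_of_subset_left (hsub p hp C hCp)
        (Finset.disjoint_of_subset_right (hsub q hq C' hCq) (hd hp hq hpq))
  have hIF : I.biUnion id = 𝓕.biUnion id := by
    rw [hI, Finset.biUnion_biUnion]
    refine Finset.biUnion_congr rfl fun p hp => ?_
    exact (h𝒦 p hp).2.2.1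
  have hsum : ∑ C ∈ I, C.card = ∑ p ∈ 𝓕, p.card := by
    rw [← card_biUnion_id hId, ← card_biUnion_id hd, hIF]
  have hIp : ∀ C ∈ I, ∃ p ∈ 𝓕, C ∈ 𝒦 p := fun C hC => Finset.mem_biUnion.1 hC
  obtain ⟨x, hx⟩ := exists_interval_of_subset_sums (I := I) (a := Finset.card) hw
    (fun C hC => by
      obtain ⟨p, hp, hCp⟩ := hIp C hC
      exact ⟨((h𝒦 p hp).2.1 C hCp).1.card_pos,
        (Finset.card_le_card (hsub p hp C hCp)).trans (hpw p hp)⟩)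
    (by
      rw [Finset.nonempty_iff_ne_empty]
      intro h
      rw [h, Finset.sum_empty] at hsum
      omega)
    (by rw [hsum]; exact hlarge)
    (fun U hU hUc => by
      have h1 : ∃ p ∈ 𝓕, Disjoint (𝒦 p) U := by
        by_contra! hcon
        have h2 : ∀ p ∈ 𝓕, ∃ C ∈ U, C ∈ 𝒦 p := fun p hp => by
          obtain ⟨C, hC, hCU⟩ := Finset.not_disjoint_iff.1 (hcon p hp)
          exact ⟨C, hCU, hC⟩
        choose! e he he' using h2
        have h3 : 𝓕.card ≤ U.card := by
          refine Finset.card_le_card_of_injOn e (fun p hp => he p hp) fun p hp q hq hpq => ?_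
          by_contra hne'
          refine Finset.disjoint_left.1 (hKd p hp q hq hne') (he' p hp) ?_
          rw [hpq]
          exact he' q hq
        have h4 : ∑ p ∈ 𝓕, p.card ≤ 32 * w * w :=
          (Finset.sum_le_card_nsmul _ _ _ hpw).trans (by
            rw [smul_eq_mul]; exact Nat.mul_le_mul_right _ (h3.trans hUc))
        have h5 : ((∑ p ∈ 𝓕, p.card : ℕ) : ℝ) ≤ 32 * w * w := by exact_mod_cast h4
        have h6 : 0 ≤ Real.log ((∑ p ∈ 𝓕, p.card : ℕ) : ℝ) :=
          Real.log_nonneg (by exact_mod_cast hne)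
        have h7 : (1 : ℝ) ≤ w := by exact_mod_cast hw
        have h8 : 0 ≤ 33 * (w : ℝ) ^ 2 * Real.log ((∑ p ∈ 𝓕, p.card : ℕ) : ℝ) := by positivity
        nlinarith
      obtain ⟨p, hp, hpU⟩ := h1
      refine Nat.dvd_one.1 ?_
      rw [← (h𝒦 p hp).2.2.2]
      refine Finset.gcd_mono fun C hC => Finset.mem_sdiff.2
        ⟨Finset.mem_biUnion.2 ⟨p, hp, hC⟩, Finset.disjoint_left.1 hpU hC⟩)
  refine ⟨x, fun y h1 h2 => ?_⟩
  obtain ⟨S, hS, hSy⟩ := hx y h1 h2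
  refine ⟨S.biUnion id, ?_, ?_, ?_⟩
  · rw [← hIF]
    exact Finset.biUnion_subset_biUnion_of_subset_left _ hS
  · refine AdjClosed.biUnion fun C hC => ?_
    obtain ⟨p, hp, hCp⟩ := hIp C (hS hC)
    exact ((h𝒦 p hp).2.1 C hCp).2
  · rw [card_biUnion_id (hId.subset (Finset.coe_subset.2 hS)), hSy]

/-- A large family of tiles can be distributed, by components, into bins of prescribed sizes. -/
lemma exists_bins {H : SimpleGraph W} {w m₀ : ℕ} (hw : 1 ≤ w) (hm₀ : 1 ≤ m₀)
    (hlarge : 33 * (w : ℝ) ^ 2 * (1 + Real.log ((m₀ + w : ℕ) : ℝ)) ≤ m₀) (ℓ : ℕ → ℕ) (q : ℕ) :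
    ∀ 𝒲 : Finset (Finset W), (𝒲 : Set (Finset W)).PairwiseDisjoint id →
      (∀ p ∈ 𝒲, SplitsCoprimely H p) → (∀ p ∈ 𝒲, p.card ≤ w) →
      (∀ i < q, m₀ + w ≤ ℓ i) →
      ∑ i ∈ Finset.range q, ℓ i + q * (m₀ + w) ≤ ∑ p ∈ 𝒲, p.card →
      ∃ A : ℕ → Finset W, (∀ i < q, A i ⊆ 𝒲.biUnion id ∧ AdjClosed H (A i) ∧ (A i).card = ℓ i) ∧
        ∀ i < q, ∀ j < q, i ≠ j → Disjoint (A i) (A j) := by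
  induction q with
  | zero =>
    intro 𝒲 _ _ _ _ _
    exact ⟨fun _ => ∅, by simp, by simp⟩
  | succ q ih =>
    intro 𝒲 hd hs hpw hℓ hmass
    rw [Finset.sum_range_succ] at hmass
    have hℓq := hℓ q (Nat.lt_succ_self q)
    have hqe : (q + 1) * (m₀ + w) = q * (m₀ + w) + (m₀ + w) := by ring
    obtain ⟨𝓕, h𝓕, hF1, hF2⟩ := exists_subfamily_card hpw (t := m₀) (by omega)
    have hFN : ((∑ p ∈ 𝓕, p.card : ℕ) : ℝ) ≤ ((m₀ + w : ℕ) : ℝ) := by exact_mod_cast hF2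
    have hF1' : (m₀ : ℝ) ≤ ((∑ p ∈ 𝓕, p.card : ℕ) : ℝ) := by exact_mod_cast hF1
    have hm₀' : (1 : ℝ) ≤ m₀ := by exact_mod_cast hm₀
    have hdF := hd.subset (Finset.coe_subset.2 h𝓕)
    obtain ⟨x, hx⟩ := exists_interval_of_tiles (H := H) hw hdF
      (fun p hp => hs p (h𝓕 hp)) (fun p hp => hpw p (h𝓕 hp))
      ((mul_le_mul_of_nonneg_left (add_le_add_right
        (Real.log_le_log (by linarith) hFN) 1) (by positivity)).trans (hlarge.trans hF1'))
      (by omega)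
    have hxm : x ≤ m₀ := by
      obtain ⟨A, hA, -, hAc⟩ := hx (x + w) (by omega) le_rfl
      have := Finset.card_le_card hA
      rw [card_biUnion_id hdF] at this
      omega
    have hsplit := Finset.sum_sdiff (f := Finset.card) h𝓕
    obtain ⟨𝒢, h𝒢, hG1, hG2⟩ := exists_subfamily_card (𝒲 := 𝒲 \ 𝓕) (w := w) (t := ℓ q - x - w)
      (fun p hp => hpw p (Finset.mem_sdiff.1 hp).1) (by omega)
    have h𝒢' : 𝒢 ⊆ 𝒲 := h𝒢.trans Finset.sdiff_subset
    obtain ⟨A, hA, hAcl, hAc⟩ := hx (ℓ q - ∑ p ∈ 𝒢, p.card) (by omega) (by omega)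
    have hsplit' := Finset.sum_sdiff (f := Finset.card) h𝒢
    set 𝒲' := (𝒲 \ 𝓕) \ 𝒢 with h𝒲'
    have h𝒲'sub : 𝒲' ⊆ 𝒲 := Finset.sdiff_subset.trans Finset.sdiff_subset
    obtain ⟨B, hB, hBd⟩ := ih 𝒲' (hd.subset (Finset.coe_subset.2 h𝒲'sub))
      (fun p hp => hs p (h𝒲'sub hp)) (fun p hp => hpw p (h𝒲'sub hp))
      (fun i hi => hℓ i (by omega)) (by omega)
    have hdisj : ∀ 𝒜 ⊆ 𝒲, ∀ ℬ ⊆ 𝒲, Disjoint 𝒜 ℬ → Disjoint (𝒜.biUnion id) (ℬ.biUnion id) := by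
      intro 𝒜 h𝒜 ℬ hℬ hdis
      rw [Finset.disjoint_biUnion_left]
      intro p hp
      rw [Finset.disjoint_biUnion_right]
      intro p' hp'
      exact hd (h𝒜 hp) (hℬ hp') fun h => Finset.disjoint_left.1 hdis hp (h ▸ hp')
    have hAG : Disjoint (𝒢.biUnion id) A := Finset.disjoint_of_subset_right hA
      (hdisj 𝒢 h𝒢' 𝓕 h𝓕 (Finset.disjoint_of_subset_left h𝒢 Finset.sdiff_disjoint))
    have hnew : ∀ i < q, Disjoint (B i) (𝒢.biUnion id ∪ A) := by
      intro i hi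
      rw [Finset.disjoint_union_right]
      refine ⟨Finset.disjoint_of_subset_left (hB i hi).1
        (hdisj _ h𝒲'sub _ h𝒢' Finset.sdiff_disjoint), Finset.disjoint_of_subset_left (hB i hi).1
        (Finset.disjoint_of_subset_right hA (hdisj _ h𝒲'sub _ h𝓕 ?_))⟩
      exact Finset.disjoint_of_subset_left Finset.sdiff_subset Finset.sdiff_disjoint
    have hcl : ∀ p ∈ 𝒲, AdjClosed H p := by
      intro p hp
      obtain ⟨𝒦, -, h𝒦, rfl, -⟩ := hs p hp
      exact AdjClosed.biUnion fun C hC => (h𝒦 C hC).2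
    refine ⟨fun i => if i = q then 𝒢.biUnion id ∪ A else B i, fun i hi => ?_,
      fun i hi j hj hij => ?_⟩
    · by_cases hiq : i = q
      · simp only [if_pos hiq]
        refine ⟨Finset.union_subset (Finset.biUnion_subset_biUnion_of_subset_left _ h𝒢')
          (hA.trans (Finset.biUnion_subset_biUnion_of_subset_left _ h𝓕)), ?_, ?_⟩
        · have h1 : AdjClosed H (𝒢.biUnion id) := AdjClosed.biUnion fun p hp => hcl p (h𝒢' hp)
          intro u hu v huv
          rcases Finset.mem_union.1 hu with hu | hu
          · exact Finset.mem_union_left _ (h1 u hu v huv)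
          · exact Finset.mem_union_right _ (hAcl u hu v huv)
        · rw [Finset.card_union_of_disjoint hAG, hAc,
            card_biUnion_id (hd.subset (Finset.coe_subset.2 h𝒢')), hiq]
          omega
      · simp only [if_neg hiq]
        obtain ⟨h1, h2⟩ := hB i (by omega)
        exact ⟨h1.trans (Finset.biUnion_subset_biUnion_of_subset_left _ h𝒲'sub), h2⟩
    · by_cases hiq : i = q
      · have hjq : j ≠ q := fun h => hij (hiq.trans h.symm)
        simp only [if_pos hiq, if_neg hjq]
        exact (hnew j (by omega)).symm
      · by_cases hjq : j = q
        · simp only [if_pos hjq, if_neg hiq]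
          exact hnew i (by omega)
        · simp only [if_neg hjq, if_neg hiq]
          exact hBd i (by omega) j (by omega) hij

end Bins

section HoleMoving

variable {V W : Type} {G : SimpleGraph V} {H : SimpleGraph W}

/-- `h` arises from the map `f` on `S` by giving the vertices of `M` new images which are adjacent
to the old images of their neighbours. -/
structure Rerouted (G : SimpleGraph V) (H : SimpleGraph W) (f : W → V) (S M : Finset W)
    (h : W → V) : Prop where
  eq_of_notMem : ∀ x ∈ S, x ∉ M → h x = f x
  injOn : Set.InjOn h S
  adj : ∀ x ∈ M, ∀ y, H.Adj x y → G.Adj (h x) (f y)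

lemma Rerouted.embOn {f h : W → V} {S M : Finset W} (hr : Rerouted G H f S M h)
    (hf : EmbOn G H f S) (hM : ∀ x ∈ M, ∀ y ∈ M, ¬ H.Adj x y) : EmbOn G H h S := by
  refine ⟨hr.injOn, fun x hx y hy hxy => ?_⟩
  by_cases hxM : x ∈ M
  · have hyM : y ∉ M := fun hyM => hM x hxM y hyM hxy
    rw [hr.eq_of_notMem y hy hyM]
    exact hr.adj x hxM y hxy
  · rw [hr.eq_of_notMem x hx hxM]
    by_cases hyM : y ∈ M
    · exact (hr.adj y hyM x hxy.symm).symm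
    · rw [hr.eq_of_notMem y hy hyM]
      exact hf.2 x hx y hy hxy

lemma Rerouted.update {f h : W → V} {S M : Finset W} (hr : Rerouted G H f S M h) {x : W} {v : V}
    (hxS : x ∈ S) (hxM : x ∉ M) (hv : ∀ y ∈ S, h y ≠ v)
    (hadj : ∀ y, H.Adj x y → G.Adj v (f y)) :
    Rerouted G H f S (insert x M) (Function.update h x v) ∧
      (∀ y ∈ S, Function.update h x v y ≠ f x) ∧
      ∀ y ∈ S, Function.update h x v y = v ∨ ∃ y' ∈ S, Function.update h x v y = h y' := by
  have hhx : h x = f x := hr.eq_of_notMem x hxS hxM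
  refine ⟨⟨fun y hy hyM => ?_, fun a ha b hb hab => ?_, fun a ha b hab => ?_⟩, fun y hy => ?_,
    fun y hy => ?_⟩
  · have h1 : y ≠ x := fun h => hyM (h ▸ Finset.mem_insert_self _ _)
    rw [Function.update_of_ne h1]
    exact hr.eq_of_notMem y hy fun h => hyM (Finset.mem_insert_of_mem h)
  · by_cases hax : a = x <;> by_cases hbx : b = x
    · rw [hax, hbx]
    · rw [hax, Function.update_self, Function.update_of_ne hbx] at hab
      exact absurd hab.symm (hv b hb)
    · rw [hbx, Function.update_self, Function.update_of_ne hax] at hab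
      exact absurd hab (hv a ha)
    · rw [Function.update_of_ne hax, Function.update_of_ne hbx] at hab
      exact hr.injOn ha hb hab
  · by_cases hax : a = x
    · subst hax
      rw [Function.update_self]
      exact hadj b hab
    · rw [Function.update_of_ne hax]
      exact hr.adj a ((Finset.mem_insert.1 ha).resolve_left hax) b hab
  · by_cases hyx : y = x
    · rw [hyx, Function.update_self, ← hhx]
      exact (hv x hxS).symm
    · rw [Function.update_of_ne hyx, ← hhx]
      exact fun h => hyx (hr.injOn hy hxS h)
  · by_cases hyx : y = x
    · left; rw [hyx, Function.update_self]
    · right; exact ⟨y, hy, by rw [Function.update_of_ne hyx]⟩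

variable [Fintype V]

/-- A single hole `v` is moved to `f z` in at most `j + 1` reroutings. -/
lemma exists_reroute_hole {f : W → V} {S D : Finset W} {b : ℝ} {m : ℕ} {z : W} {I : Finset V}
    (hDS : D ⊆ S) (hzS : z ∈ S) (hzD : z ∉ D)
    (hI : ∀ a ∈ I, ∀ y, H.Adj z y → G.Adj a (f y)) {J : ℕ}
    (hspare : ∀ v, ∀ j < J, b ≤ (((closureSeq G b I j).filter (G.Adj v)).card : ℝ) →
      m ≤ (D.filter fun x =>
        NbhdInto H f x (· ∈ (closureSeq G b I j).filter (G.Adj v))).card) :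
    ∀ j ≤ J, ∀ (M : Finset W) (h : W → V) (v : V), Rerouted G H f S M h → M.card + j < m + 1 →
      z ∉ M → (∀ y ∈ S, h y ≠ v) → v ∈ closureSeq G b I j →
      ∃ M' h', Rerouted G H f S M' h' ∧ M'.card ≤ M.card + j + 1 ∧ M' ⊆ M ∪ insert z D ∧
        (∀ y ∈ S, h' y ≠ f z) ∧ ∀ y ∈ S, h' y = v ∨ ∃ y' ∈ S, h' y = h y' := by
  intro j
  induction j with
  | zero =>
    intro _ M h v hr _ hzM hv hvI
    obtain ⟨h1, h2, h3⟩ := hr.update hzS hzM hv (hI v hvI)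
    refine ⟨_, _, h1, Finset.card_insert_le _ _, ?_, h2, h3⟩
    exact Finset.insert_subset (by simp) Finset.subset_union_left
  | succ j ih =>
    intro hj M h v hr hm hzM hv hvI
    rw [closureSeq, Finset.mem_union] at hvI
    rcases hvI with hvI | hvI
    · obtain ⟨M', h', h1, h2, h3⟩ := ih (by omega) M h v hr (by omega) hzM hv hvI
      exact ⟨M', h', h1, by omega, h3⟩
    · have hb := (Finset.mem_filter.1 hvI).2
      have hcard := hspare v j (by omega) hb
      obtain ⟨x, hxF, hxM⟩ := Finset.exists_mem_notMem_of_card_lt_card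
        (lt_of_lt_of_le (by omega : M.card < m) hcard)
      obtain ⟨hxD, hxN⟩ := Finset.mem_filter.1 hxF
      have hadj : ∀ y, H.Adj x y → G.Adj v (f y) := fun y hy =>
        (Finset.mem_filter.1 (hxN y (Or.inr hy))).2
      obtain ⟨h1, h2, h3⟩ := hr.update (hDS hxD) hxM hv hadj
      have hxB : f x ∈ closureSeq G b I j := (Finset.mem_filter.1 (hxN x (Or.inl rfl))).1
      have hcM : (insert x M).card = M.card + 1 := Finset.card_insert_of_notMem hxM
      have hzM' : z ∉ insert x M := by
        rw [Finset.mem_insert, not_or]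
        exact ⟨fun h => hzD (h ▸ hxD), hzM⟩
      obtain ⟨M', h', g1, g2, g3, g4, g5⟩ := ih (by omega) (insert x M) _ (f x) h1 (by omega)
        hzM' h2 hxB
      refine ⟨M', h', g1, by omega, g3.trans ?_, g4, fun y hy => ?_⟩
      · exact Finset.union_subset (Finset.insert_subset (by simp [hxD]) Finset.subset_union_left)
          Finset.subset_union_right
      · rcases g5 y hy with h5 | ⟨y', hy', h5⟩
        · exact Or.inr ⟨x, hDS hxD, by rw [h5, hr.eq_of_notMem x (hDS hxD) hxM]⟩
        · rw [h5]; exact h3 y' hy'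

/-- All holes in `L` are moved, the hole `v` to the position `f (τ v)`. -/
lemma exists_reroute_holes {f : W → V} {S D : Finset W} {b : ℝ} {m J : ℕ} (hf : EmbOn G H f S)
    (hDS : D ⊆ S) (I : W → Finset V) (τ : V → W) :
    ∀ L : Finset V, (∀ v ∈ L, ∀ y ∈ S, f y ≠ v) → (∀ v ∈ L, τ v ∈ S ∧ τ v ∉ D) →
      Set.InjOn τ L →
      (∀ v ∈ L, ∀ a ∈ I (τ v), ∀ y, H.Adj (τ v) y → G.Adj a (f y)) →
      (∀ v ∈ L, v ∈ closureSeq G b (I (τ v)) J) →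
      (∀ v ∈ L, ∀ u, ∀ j < J, b ≤ (((closureSeq G b (I (τ v)) j).filter (G.Adj u)).card : ℝ) →
        m ≤ (D.filter fun x =>
          NbhdInto H f x (· ∈ (closureSeq G b (I (τ v)) j).filter (G.Adj u))).card) →
      (J + 1) * L.card ≤ m →
      ∃ M h, Rerouted G H f S M h ∧ M.card ≤ (J + 1) * L.card ∧ M ⊆ D ∪ L.image τ ∧
        (∀ v ∈ L, ∀ y ∈ S, h y ≠ f (τ v)) ∧ ∀ y ∈ S, h y ∈ L ∨ ∃ y' ∈ S, h y = f y' := by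
  intro L
  induction L using Finset.induction_on with
  | empty =>
    intro _ _ _ _ _ _ _
    exact ⟨∅, f, ⟨fun _ _ _ => rfl, hf.1, by simp⟩, by simp, by simp, by simp,
      fun y hy => Or.inr ⟨y, hy, rfl⟩⟩
  | insert v L hvL ih =>
    intro hL hτ hinj hI hcl hspare hm
    rw [Finset.card_insert_of_notMem hvL] at hm
    have hm' : (J + 1) * L.card + (J + 1) ≤ m := by linarith
    obtain ⟨M, h, h1, h2, h3, h4, h5⟩ := ih (fun u hu => hL u (Finset.mem_insert_of_mem hu))
      (fun u hu => hτ u (Finset.mem_insert_of_mem hu))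
      (hinj.mono (by simp)) (fun u hu => hI u (Finset.mem_insert_of_mem hu))
      (fun u hu => hcl u (Finset.mem_insert_of_mem hu))
      (fun u hu => hspare u (Finset.mem_insert_of_mem hu)) (by omega)
    have hvv := Finset.mem_insert_self v L
    have hτM : τ v ∉ M := by
      intro hmem
      rcases Finset.mem_union.1 (h3 hmem) with h' | h'
      · exact (hτ v hvv).2 h'
      · obtain ⟨u, hu, huv⟩ := Finset.mem_image.1 h'
        have := hinj (Finset.mem_coe.2 (Finset.mem_insert_of_mem hu)) (Finset.mem_coe.2 hvv) huv
        exact hvL (this ▸ hu)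
    have hvh : ∀ y ∈ S, h y ≠ v := by
      intro y hy hyv
      rcases h5 y hy with h' | ⟨y', hy', h'⟩
      · exact hvL (hyv ▸ h')
      · exact hL v hvv y' hy' (h'.symm.trans hyv)
    obtain ⟨M', h', g1, g2, g3, g4, g5⟩ := exists_reroute_hole hDS (hτ v hvv).1 (hτ v hvv).2
      (hI v hvv) (hspare v hvv) J le_rfl M h v h1 (by omega) hτM hvh (hcl v hvv)
    refine ⟨M', h', g1, ?_, ?_, ?_, ?_⟩
    · rw [Finset.card_insert_of_notMem hvL, mul_add]; omega
    · refine g3.trans (Finset.union_subset (h3.trans ?_) ?_)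
      · exact Finset.union_subset_union_right (Finset.image_subset_image (by simp))
      · exact Finset.insert_subset (by simp) Finset.subset_union_left
    · intro u hu y hy
      rcases Finset.mem_insert.1 hu with rfl | hu'
      · exact g4 y hy
      · rcases g5 y hy with h' | ⟨y', hy', h'⟩
        · rw [h']
          exact fun heq => hL v hvv _ (hτ u hu).1 heq.symm
        · rw [h']; exact h4 u hu' y' hy'
    · intro y hy
      rcases g5 y hy with h' | ⟨y', hy', h'⟩
      · exact Or.inl (by rw [h']; exact hvv)
      · rw [h']
        exact (h5 y' hy').imp (fun h => Finset.mem_insert_of_mem h) id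

end HoleMoving

section Conversion

variable {V : Type} [Fintype V]

lemma card_filter_adj (G : SimpleGraph V) (v : V) :
    (Finset.univ.filter (G.Adj v)).card = ndeg G v := by
  rw [ndeg, ← Set.ncard_coe_finset]
  congr 1
  ext u
  simp

lemma GcdOne.gcd_eq_one {S : Set ℕ} (h : GcdOne S) {𝒯 : Finset ℕ} (hS : S ⊆ 𝒯) :
    𝒯.gcd id = 1 := by
  obtain ⟨T, hT, h1⟩ := h
  have : 𝒯.gcd id ∣ T.gcd id :=
    Finset.gcd_mono fun x hx => Finset.mem_coe.1 (hS (hT hx))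
  rw [h1] at this
  exact Nat.dvd_one.1 this

lemma SplitsCoprimely.of_gcdOne {H : SimpleGraph V} {p : Set V}
    (hp : ∀ u ∈ p, ∀ v, H.Adj u v → v ∈ p) (hg : GcdOne (compOrders (H.induce p))) :
    SplitsCoprimely H p.toFinset := by
  set comp : (H.induce p).ConnectedComponent → Finset V := fun c =>
    (Subtype.val '' c.supp).toFinset with hcomp
  have hmem : ∀ c v, v ∈ comp c ↔ ∃ h : v ∈ p, (H.induce p).connectedComponentMk ⟨v, h⟩ = c := by
    intro c v
    simp [hcomp, SimpleGraph.ConnectedComponent.mem_supp_iff]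
  have hcard : ∀ c, (comp c).card = c.supp.ncard := by
    intro c
    rw [← Set.ncard_image_of_injective c.supp Subtype.val_injective,
      ← Set.ncard_eq_toFinset_card']
  refine ⟨Finset.univ.image comp, ?_, ?_, ?_, ?_⟩
  · intro a ha b hb hab
    simp only [Finset.coe_image, Finset.coe_univ, Set.image_univ, Set.mem_range] at ha hb
    obtain ⟨c, rfl⟩ := ha
    obtain ⟨c', rfl⟩ := hb
    rw [Function.onFun, id, id, Finset.disjoint_left]
    intro v hv hv'
    obtain ⟨h, h1⟩ := (hmem _ _).1 hv
    obtain ⟨h', h2⟩ := (hmem _ _).1 hv'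
    exact hab (by rw [← h1, ← h2])
  · intro C hC
    obtain ⟨c, -, rfl⟩ := Finset.mem_image.1 hC
    constructor
    · obtain ⟨⟨v, hv⟩, hvc⟩ := c.nonempty_supp
      exact ⟨v, (hmem _ _).2 ⟨hv, hvc⟩⟩
    · intro u hu v huv
      obtain ⟨h, h1⟩ := (hmem _ _).1 hu
      refine (hmem _ _).2 ⟨hp u h v huv, ?_⟩
      rw [← h1]
      refine SimpleGraph.ConnectedComponent.sound (SimpleGraph.Adj.reachable ?_)
      exact huv.symm
  · ext v
    simp only [Finset.mem_biUnion, Finset.mem_image, Finset.mem_univ, true_and, id,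
      exists_exists_eq_and, hmem, Set.mem_toFinset]
    constructor
    · rintro ⟨c, h, -⟩; exact h
    · intro h; exact ⟨_, h, rfl⟩
  · have h := hg.gcd_eq_one (𝒯 := (Finset.univ.image comp).image Finset.card) ?_
    · rw [Finset.gcd_image] at h
      exact h
    · rintro m ⟨c, rfl⟩
      rw [Finset.mem_coe, Finset.mem_image]
      exact ⟨comp c, Finset.mem_image_of_mem _ (Finset.mem_univ _), hcard c⟩

lemma SplitsCoprimely.adjClosed {V : Type} {H : SimpleGraph V} {p : Finset V}
    (h : SplitsCoprimely H p) : AdjClosed H p := by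
  obtain ⟨𝒦, -, h2, rfl, -⟩ := h
  exact AdjClosed.biUnion fun C hC => (h2 C hC).2

lemma exists_tiles {H : SimpleGraph V} {k : ℕ} {w : ℝ} (hT : IsTiling H (TileFc k w)) :
    ∃ 𝒲 : Finset (Finset V), (𝒲 : Set (Finset V)).PairwiseDisjoint id ∧
      𝒲.biUnion id = Finset.univ ∧ ∀ p ∈ 𝒲, SplitsCoprimely H p ∧ (p.card : ℝ) ≤ w := by
  obtain ⟨P, hP, hadj, htile⟩ := hT
  refine ⟨Finset.univ.filter fun p : Finset V => (p : Set V) ∈ P, ?_, ?_, ?_⟩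
  · intro a ha b hb hab
    have ha' : (a : Set V) ∈ P := by simpa using ha
    have hb' : (b : Set V) ∈ P := by simpa using hb
    have := hP.pairwiseDisjoint ha' hb' (by simpa using hab)
    simpa [Function.onFun] using this
  · ext v
    simp only [Finset.mem_biUnion, Finset.mem_filter, Finset.mem_univ, true_and, id, iff_true]
    obtain ⟨p, ⟨hp, hv⟩, -⟩ := hP.2 v
    exact ⟨p.toFinset, by simpa using hp, by simpa using hv⟩
  · intro p hp
    have hp' : (p : Set V) ∈ P := by simpa using hp
    obtain ⟨h1, -, h3⟩ := htile _ hp'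
    refine ⟨?_, ?_⟩
    · have h4 := SplitsCoprimely.of_gcdOne (fun u hu v huv => ?_) h1
      · simpa using h4
      · obtain ⟨q, ⟨hq, hv⟩, -⟩ := hP.2 v
        by_contra hvp
        exact hadj _ hp' q hq (fun h => hvp (h ▸ hv)) u hu v hv huv
    · refine le_of_eq_of_le ?_ h3
      norm_cast
      rw [Fintype.card_eq_nat_card]
      simp

lemma UniformlyDense.locDense {G : SimpleGraph V} {ρ d κ : ℝ} (h : UniformlyDense G ρ d)
    (hκ : 0 ≤ κ) (hd : 0 ≤ d) (hρ : ρ ≤ d * κ ^ 2 / 4) :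
    LocDense G (d / 2) (κ * Fintype.card V) Finset.univ := by
  intro U _ hU
  set n : ℝ := ((Fintype.card V : ℕ) : ℝ) with hn
  have hn0 : 0 ≤ n := by positivity
  have h1 := h (U : Set V)
  have h2 : 2 * ((G.induce (U : Set V)).edgeSet.ncard : ℝ) = adjPairs G U U := by
    have h3 := (G.induce (U : Set V)).sum_degrees_eq_twice_card_edges
    have h4 : (G.induce (U : Set V)).edgeSet.ncard = (G.induce (U : Set V)).edgeFinset.card := by
      rw [← SimpleGraph.coe_edgeFinset, Set.ncard_coe_finset]
    rw [h4, adjPairs_eq_sum]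
    have h5 : ((∑ v, (G.induce (U : Set V)).degree v : ℕ) : ℝ) =
        2 * ((G.induce (U : Set V)).edgeFinset.card : ℝ) := by rw [h3]; push_cast; rfl
    rw [← h5]
    push_cast
    rw [← Finset.sum_coe_sort U fun a => ((U.filter (G.Adj a)).card : ℝ)]
    refine Finset.sum_congr rfl fun a _ => ?_
    norm_cast
    rw [← SimpleGraph.card_neighborFinset_eq_degree]
    refine Finset.card_bij (fun x _ => x.1) ?_ (fun _ _ _ _ h => Subtype.ext h) ?_
    · intro x hx
      have := (SimpleGraph.mem_neighborFinset _ _ _).1 hx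
      exact Finset.mem_filter.2 ⟨x.2, this⟩
    · intro b hb
      obtain ⟨hb1, hb2⟩ := Finset.mem_filter.1 hb
      exact ⟨⟨b, hb1⟩, (SimpleGraph.mem_neighborFinset _ _ _).2 hb2, rfl⟩
  rw [Set.ncard_coe_finset, ← hn] at h1
  have h3 : κ ^ 2 * n ^ 2 ≤ (U.card : ℝ) ^ 2 := by
    rw [← mul_pow]; exact pow_le_pow_left₀ (by positivity) hU 2
  have h4 : ρ * n ^ 2 ≤ d / 4 * (U.card : ℝ) ^ 2 := by
    calc ρ * n ^ 2 ≤ d * κ ^ 2 / 4 * n ^ 2 := by gcongr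
      _ = d / 4 * (κ ^ 2 * n ^ 2) := by ring
      _ ≤ _ := by gcongr
  linarith

/-- A maximal independent set meets every closed set in a positive proportion. -/
lemma exists_large_independent {H : SimpleGraph V} {Δ : ℕ} (hΔ : DegLe H Δ) :
    ∃ X : Finset V, (∀ x ∈ X, ∀ y ∈ X, ¬ H.Adj x y) ∧
      ∀ C : Finset V, AdjClosed H C → C.card ≤ (X ∩ C).card * (Δ + 1) := by
  obtain ⟨X, hX, hmax⟩ := Finset.exists_max_image
    (Finset.univ.filter fun X : Finset V => ∀ x ∈ X, ∀ y ∈ X, ¬ H.Adj x y) Finset.card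
    ⟨∅, by simp⟩
  have hXi := (Finset.mem_filter.1 hX).2
  refine ⟨X, hXi, fun C hC => ?_⟩
  have hsub : C ⊆ (X ∩ C).biUnion fun x => insert x (Finset.univ.filter (H.Adj x)) := by
    intro v hv
    rw [Finset.mem_biUnion]
    by_contra hcon
    push Not at hcon
    have hvX : v ∉ X := fun h => hcon v (Finset.mem_inter.2 ⟨h, hv⟩) (by simp)
    have hno : ∀ x ∈ X, ¬ H.Adj x v := by
      intro x hx hxv
      exact hcon x (Finset.mem_inter.2 ⟨hx, hC v hv x hxv.symm⟩) (by simp [hxv])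
    have := hmax (insert v X) (by
      rw [Finset.mem_filter]
      refine ⟨Finset.mem_univ _, fun x hx y hy hxy => ?_⟩
      rcases Finset.mem_insert.1 hx with rfl | hxX <;>
        rcases Finset.mem_insert.1 hy with rfl | hyX
      · exact H.irrefl hxy
      · exact hno y hyX hxy.symm
      · exact hno x hxX hxy
      · exact hXi x hxX y hyX hxy)
    rw [Finset.card_insert_of_notMem hvX] at this
    omega
  refine (Finset.card_le_card hsub).trans (Finset.card_biUnion_le_card_mul _ _ _ fun x _ => ?_)
  exact (Finset.card_insert_le _ _).trans (Nat.succ_le_succ (hΔ x))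

end Conversion

section Gluing

variable {V W : Type}

lemma disjoint_biUnion_id {𝒲 𝒜 ℬ : Finset (Finset W)}
    (hd : (𝒲 : Set (Finset W)).PairwiseDisjoint id) (hA : 𝒜 ⊆ 𝒲) (hB : ℬ ⊆ 𝒲)
    (h : Disjoint 𝒜 ℬ) : Disjoint (𝒜.biUnion id) (ℬ.biUnion id) := by
  rw [Finset.disjoint_biUnion_left]
  intro p hp
  rw [Finset.disjoint_biUnion_right]
  intro q hq
  exact hd (hA hp) (hB hq) fun hpq => Finset.disjoint_left.1 h hp (hpq ▸ hq)

lemma exists_disjoint_subfamilies {𝒲 : Finset (Finset W)} {w t : ℕ}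
    (hw : ∀ p ∈ 𝒲, p.card ≤ w) (s : ℕ) (hs : s * (t + w) ≤ ∑ p ∈ 𝒲, p.card) :
    ∃ 𝒵 : ℕ → Finset (Finset W),
      (∀ i < s, 𝒵 i ⊆ 𝒲 ∧ t ≤ ∑ p ∈ 𝒵 i, p.card ∧ ∑ p ∈ 𝒵 i, p.card ≤ t + w) ∧
      ∀ i < s, ∀ j < s, i ≠ j → Disjoint (𝒵 i) (𝒵 j) := by
  induction s with
  | zero => exact ⟨fun _ => ∅, by simp, by simp⟩
  | succ s ih =>
    rw [add_mul, one_mul] at hs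
    obtain ⟨𝒵, h1, h2⟩ := ih (by omega)
    set 𝒰 := (Finset.range s).biUnion 𝒵 with h𝒰
    have h𝒰sub : 𝒰 ⊆ 𝒲 := Finset.biUnion_subset.2 fun i hi => (h1 i (Finset.mem_range.1 hi)).1
    have hmass : ∑ p ∈ 𝒰, p.card ≤ s * (t + w) := by
      rw [h𝒰, Finset.sum_biUnion fun i hi j hj hij =>
        h2 i (by simpa using hi) j (by simpa using hj) hij]
      simpa using Finset.sum_le_card_nsmul (Finset.range s) _ (t + w)
        fun i hi => (h1 i (Finset.mem_range.1 hi)).2.2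
    have hsd := Finset.sum_sdiff h𝒰sub (f := Finset.card)
    obtain ⟨𝒢, g1, g2, g3⟩ := exists_subfamily_card (𝒲 := 𝒲 \ 𝒰) (w := w) (t := t)
      (fun p hp => hw p (Finset.mem_sdiff.1 hp).1) (by omega)
    have hdis : ∀ i < s, Disjoint (𝒵 i) 𝒢 := fun i hi =>
      (Finset.disjoint_sdiff.mono_left
        (Finset.subset_biUnion_of_mem 𝒵 (Finset.mem_range.2 hi))).mono_right g1
    refine ⟨Function.update 𝒵 s 𝒢, fun i hi => ?_, fun i hi j hj hij => ?_⟩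
    · rcases eq_or_ne i s with rfl | hne
      · rw [Function.update_self]
        exact ⟨g1.trans Finset.sdiff_subset, g2, g3⟩
      · rw [Function.update_of_ne hne]
        exact h1 i (by omega)
    · rcases eq_or_ne i s with hi' | hi' <;> rcases eq_or_ne j s with hj' | hj'
      · omega
      · subst hi'
        rw [Function.update_self, Function.update_of_ne hj']
        exact (hdis j (by omega)).symm
      · subst hj'
        rw [Function.update_self, Function.update_of_ne hi']
        exact hdis i (by omega)
      · rw [Function.update_of_ne hj', Function.update_of_ne hi']
        exact h2 i (by omega) j (by omega) hij

lemma AdjClosed.inter {H : SimpleGraph W} {S T : Finset W} (hS : AdjClosed H S)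
    (hT : AdjClosed H T) : AdjClosed H (S ∩ T) := fun x hx y hxy =>
  Finset.mem_inter.2 ⟨hS x (Finset.mem_inter.1 hx).1 y hxy, hT x (Finset.mem_inter.1 hx).2 y hxy⟩

lemma AdjClosed.sdiff {H : SimpleGraph W} {S T : Finset W} (hS : AdjClosed H S)
    (hT : AdjClosed H T) : AdjClosed H (S \ T) := fun x hx y hxy =>
  Finset.mem_sdiff.2 ⟨hS x (Finset.mem_sdiff.1 hx).1 y hxy,
    fun hy => (Finset.mem_sdiff.1 hx).2 (hT y hy x hxy.symm)⟩

lemma AdjClosed.range_biUnion {H : SimpleGraph W} {A : ℕ → Finset W} {s : ℕ}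
    (hA : ∀ i < s, AdjClosed H (A i)) : AdjClosed H ((Finset.range s).biUnion A) := by
  intro x hx y hxy
  obtain ⟨i, hi, hxi⟩ := Finset.mem_biUnion.1 hx
  exact Finset.mem_biUnion.2 ⟨i, hi, hA i (Finset.mem_range.1 hi) x hxi y hxy⟩

/-- Embeddings of disjoint closed sets into disjoint targets glue. -/
lemma EmbOn.glue {G : SimpleGraph V} {H : SimpleGraph W} {s : ℕ} {A : ℕ → Finset W}
    {Q : ℕ → Finset V} {F : ℕ → W → V} (hA : ∀ i < s, AdjClosed H (A i))
    (hAd : ∀ i < s, ∀ j < s, i ≠ j → Disjoint (A i) (A j))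
    (hQd : ∀ i < s, ∀ j < s, i ≠ j → Disjoint (Q i) (Q j))
    (hF : ∀ i < s, EmbOn G H (F i) (A i)) (hFQ : ∀ i < s, ∀ x ∈ A i, F i x ∈ Q i) :
    ∃ f, (∀ i < s, ∀ x ∈ A i, f x = F i x) ∧ EmbOn G H f ((Finset.range s).biUnion A) := by
  set f : W → V := fun x => F (if h : ∃ i, i < s ∧ x ∈ A i then h.choose else 0) x with hf
  have hfeq : ∀ i < s, ∀ x ∈ A i, f x = F i x := by
    intro i hi x hx
    have hex : ∃ i, i < s ∧ x ∈ A i := ⟨i, hi, hx⟩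
    have hi' : hex.choose = i := by
      by_contra hne
      exact Finset.disjoint_left.1 (hAd _ hex.choose_spec.1 i hi hne) hex.choose_spec.2 hx
    simp only [hf, dif_pos hex, hi']
  refine ⟨f, hfeq, fun x hx y hy hxy => ?_, fun x hx y hy hxy => ?_⟩
  · obtain ⟨i, hi, hxi⟩ := Finset.mem_biUnion.1 hx
    obtain ⟨j, hj, hyj⟩ := Finset.mem_biUnion.1 hy
    rw [Finset.mem_range] at hi hj
    rw [hfeq i hi x hxi, hfeq j hj y hyj] at hxy
    by_cases hij : i = j
    · subst hij
      exact (hF i hi).1 hxi hyj hxy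
    · have h1 := hFQ i hi x hxi
      rw [hxy] at h1
      exact absurd (hFQ j hj y hyj) (Finset.disjoint_left.1 (hQd i hi j hj hij) h1)
  · obtain ⟨i, hi, hxi⟩ := Finset.mem_biUnion.1 hx
    rw [Finset.mem_range] at hi
    have hyi := hA i hi x hxi y hxy
    rw [hfeq i hi x hxi, hfeq i hi y hyi]
    exact (hF i hi).2 x hxi y hyi hxy

lemma exists_parallel_embedding (k Δ : ℕ) {d γ : ℝ} (hd : 0 < d) (hd1 : d ≤ 1) (hγ : 0 < γ)
    (hγ1 : γ ≤ 1) :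
    ∃ c : ℝ, 0 < c ∧ c ≤ 1 ∧ ∀ (V : Type) [Fintype V] [Nonempty V] (G : SimpleGraph V),
      LocDense G d (c * Fintype.card V) Finset.univ →
      ∀ (W : Type) [Fintype W] (H : SimpleGraph W), DegLe H Δ → H.Colorable k →
      ∀ 𝒲 : Finset (Finset W), (𝒲 : Set (Finset W)).PairwiseDisjoint id →
      (∀ p ∈ 𝒲, AdjClosed H p) → (∀ p ∈ 𝒲, (p.card : ℝ) ≤ c * Fintype.card V) →
      ∀ (s : ℕ) (A : ℕ → Finset W) (Q : ℕ → Finset V),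
      (∀ i < s, A i ⊆ 𝒲.biUnion id) → (∀ i < s, AdjClosed H (A i)) →
      (∀ i < s, ∀ j < s, i ≠ j → Disjoint (A i) (A j)) →
      (∀ i < s, ∀ j < s, i ≠ j → Disjoint (Q i) (Q j)) →
      (∀ i < s, ((A i).card : ℝ) + γ * Fintype.card V ≤ (Q i).card) →
      ∃ f : W → V, EmbOn G H f ((Finset.range s).biUnion A) ∧ (∀ i < s, ∀ x ∈ A i, f x ∈ Q i) ∧
        ∀ i < s, ∀ x ∈ A i, c * Fintype.card V ≤
          (((Q i).filter fun a => NbhdInto H f x (G.Adj a)).card : ℝ) := by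
  obtain ⟨c, hc, hc1, hmain⟩ := exists_sequential_embedding k Δ hd hd1 hγ hγ1
  refine ⟨c, hc, hc1, fun V _ _ G hG W _ H hH hcol 𝒲 h𝒲 hcl hsmall
    s A Q hA hAcl hAd hQd hcard => ?_⟩
  have hpieces : ∀ i, i < s → ∃ F : W → V, EmbOn G H F (A i) ∧ (∀ x ∈ A i, F x ∈ Q i) ∧
      ∀ x ∈ A i, c * Fintype.card V ≤
        (((Q i).filter fun a => NbhdInto H F x (G.Adj a)).card : ℝ) := by
    intro i hi
    have hU : (𝒲.image (· ∩ A i)).biUnion id = A i := by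
      ext x
      simp only [Finset.mem_biUnion, Finset.mem_image, id, exists_exists_and_eq_and,
        Finset.mem_inter]
      constructor
      · rintro ⟨p, -, -, h⟩; exact h
      · intro h
        obtain ⟨p, hp, hxp⟩ := Finset.mem_biUnion.1 (hA i hi h)
        exact ⟨p, hp, hxp, h⟩
    have := hmain V G hG W H hH hcol (𝒲.image (· ∩ A i)) ?_ ?_ ?_ (Q i) ?_
    · rwa [hU] at this
    · intro a ha b hb hab
      obtain ⟨p, hp, rfl⟩ := Finset.mem_image.1 ha
      obtain ⟨q, hq, rfl⟩ := Finset.mem_image.1 hb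
      have hpq : p ≠ q := fun h => hab (by rw [h])
      exact (h𝒲 hp hq hpq).mono Finset.inter_subset_left Finset.inter_subset_left
    · intro C hC
      obtain ⟨p, hp, rfl⟩ := Finset.mem_image.1 hC
      exact (hcl p hp).inter (hAcl i hi)
    · intro C hC
      obtain ⟨p, hp, rfl⟩ := Finset.mem_image.1 hC
      refine le_trans ?_ (hsmall p hp)
      exact_mod_cast Finset.card_le_card Finset.inter_subset_left
    · rw [hU]; exact hcard i hi
  choose! F hF hFQ hFc using hpieces
  obtain ⟨f, hfeq, hf⟩ := EmbOn.glue hAcl hAd hQd hF hFQ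
  refine ⟨f, hf, fun i hi x hx => by rw [hfeq i hi x hx]; exact hFQ i hi x hx, fun i hi x hx => ?_⟩
  refine (hFc i hi x hx).trans_eq ?_
  congr 2
  ext a
  simp only [Finset.mem_filter]
  exact and_congr_right fun _ => ((hAcl i hi).nbhdInto_congr (hfeq i hi) hx _).symm

lemma exists_matching_of_card_eq [Nonempty W] {s : ℕ} {L : Finset V} {ι : V → ℕ}
    (hι : ∀ v ∈ L, ι v < s) {A : ℕ → Finset W}
    (hAd : ∀ i < s, ∀ j < s, i ≠ j → Disjoint (A i) (A j))
    (hcard : ∀ i < s, (A i).card = (L.filter (ι · = i)).card) :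
    ∃ e : V → W, Set.InjOn e L ∧ (∀ v ∈ L, e v ∈ A (ι v)) ∧
      ∀ y ∈ (Finset.range s).biUnion A, ∃ v ∈ L, e v = y := by
  have hex : ∀ i, i < s → ∃ e : V → W, Set.BijOn e (L.filter (ι · = i)) (A i) := fun i hi =>
    (Finset.finite_toSet _).exists_bijOn_of_encard_eq (by
      rw [Set.encard_coe_eq_coe_finsetCard, Set.encard_coe_eq_coe_finsetCard, hcard i hi])
  choose! e he using hex
  have hmem : ∀ v ∈ L, v ∈ L.filter (ι · = ι v) := fun v hv => Finset.mem_filter.2 ⟨hv, rfl⟩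
  have hmaps : ∀ v ∈ L, e (ι v) v ∈ A (ι v) := fun v hv => (he _ (hι v hv)).mapsTo (hmem v hv)
  refine ⟨fun v => e (ι v) v, fun u hu v hv huv => ?_, hmaps, fun y hy => ?_⟩
  · have hu' := hmaps u hu
    have hv' := hmaps v hv
    have huv' : e (ι u) u = e (ι v) v := huv
    by_cases h : ι u = ι v
    · refine (he _ (hι v hv)).injOn ?_ (hmem v hv) (by rw [← huv', h])
      exact Finset.mem_filter.2 ⟨hu, h⟩
    · rw [huv'] at hu'
      exact absurd hv' (Finset.disjoint_left.1 (hAd _ (hι u hu) _ (hι v hv) h) hu')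
  · obtain ⟨i, hi, hyi⟩ := Finset.mem_biUnion.1 hy
    obtain ⟨v, hv, hvy⟩ := (he i (Finset.mem_range.1 hi)).surjOn hyi
    obtain ⟨hvL, hvi⟩ := Finset.mem_filter.1 (Finset.mem_coe.1 hv)
    exact ⟨v, hvL, by simp only [hvi, hvy]⟩

end Gluing

section Frame

lemma exists_pos_le_six {a b c d e g : ℝ} (ha : 0 < a) (hb : 0 < b) (hc : 0 < c) (hd : 0 < d)
    (he : 0 < e) (hg : 0 < g) :
    ∃ x, 0 < x ∧ x ≤ a ∧ x ≤ b ∧ x ≤ c ∧ x ≤ d ∧ x ≤ e ∧ x ≤ g :=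
  ⟨min a (min b (min c (min d (min e g)))), by positivity, by simp, by simp, by simp, by simp,
    by simp, by simp⟩

lemma card_sdiff_image_le {V W : Type} (B : Finset V) (f : W → V) (S : Finset W) {a b : ℝ}
    (hB : a ≤ B.card) (hS : (S.card : ℝ) ≤ b) : a - b ≤ (B \ S.image f).card := by
  linarith [card_sdiff_image_ge B f S]

/-- The partial embedding supporting the absorption of a small leftover: targets `XZ i`, the
vertices `D` available for rerouting, and the classes `cl`. -/
lemma exists_frame (k Δ : ℕ) {d μ : ℝ} (hd : 0 < d) (hd1 : d ≤ 1) (hμ : 0 < μ) (hμ1 : μ ≤ 1) :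
    ∃ (c β : ℝ) (J : ℕ), 0 < c ∧ c ≤ 1 ∧ ∀ (V : Type) [Fintype V] [Nonempty V] (G : SimpleGraph V),
      (∀ v, μ * Fintype.card V ≤ ((Finset.univ.filter (G.Adj v)).card : ℝ)) →
      LocDense G d (c * Fintype.card V) Finset.univ →
      ∀ (W : Type) [Fintype W] (H : SimpleGraph W), Fintype.card W = Fintype.card V →
      DegLe H Δ → H.Colorable k →
      ∀ (w : ℕ), 1 ≤ w → (w : ℝ) ≤ c * Fintype.card V →
      w * Real.log (Fintype.card V) ≤ c * Fintype.card V →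
      ∀ 𝒲 : Finset (Finset W), (𝒲 : Set (Finset W)).PairwiseDisjoint id →
      (∀ p ∈ 𝒲, AdjClosed H p) → (∀ p ∈ 𝒲, p.card ≤ w) → 𝒲.biUnion id = Finset.univ →
      ∀ X : Finset W, (∀ C : Finset W, AdjClosed H C → C.card ≤ (X ∩ C).card * (Δ + 1)) →
      ∃ (s : ℕ) (cl : V → ℕ) (𝒰 : Finset (Finset W)) (f : W → V) (D : Finset W)
        (XZ : ℕ → Finset W) (I : W → Finset V),
        c * s ≤ 1 ∧ (∀ v, cl v < s) ∧ 𝒰 ⊆ 𝒲 ∧ EmbOn G H f (𝒰.biUnion id) ∧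
        ((𝒰.biUnion id).card : ℝ) ≤ Fintype.card V / 2 ∧
        (∀ i < s, c * Fintype.card V ≤
          (((Finset.univ.filter fun v => cl v = i) \ (𝒰.biUnion id).image f).card : ℝ)) ∧
        D ⊆ X ∩ 𝒰.biUnion id ∧
        (∀ i < s, XZ i ⊆ X ∩ 𝒰.biUnion id ∧ Disjoint (XZ i) D ∧
          c * Fintype.card V ≤ (XZ i).card) ∧
        (∀ i < s, ∀ j < s, i ≠ j → Disjoint (XZ i) (XZ j)) ∧
        ∀ i < s, ∀ z ∈ XZ i, (∀ a ∈ I z, ∀ y, H.Adj z y → G.Adj a (f y)) ∧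
          (∀ v, cl v = i → v ∈ closureSeq G (β * Fintype.card V) (I z) J) ∧
          ∀ u, ∀ j < J, β * Fintype.card V ≤
              (((closureSeq G (β * Fintype.card V) (I z) j).filter (G.Adj u)).card : ℝ) →
            c * Fintype.card V ≤ ((D.filter fun x => NbhdInto H f x
              (· ∈ (closureSeq G (β * Fintype.card V) (I z) j).filter (G.Adj u))).card : ℝ) := by
  have hΔ0 : (0 : ℝ) < Δ + 1 := by positivity
  obtain ⟨c₁, hc₁, hc₁1, hpar⟩ := exists_parallel_embedding k Δ hd hd1 (γ := μ / 4) (by positivity)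
    (by linarith)
  obtain ⟨σ, hσ, hσc, hσμ⟩ : ∃ σ, 0 < σ ∧ σ ≤ c₁ ∧ σ ≤ μ ^ 2 / 8 :=
    ⟨min c₁ (μ ^ 2 / 8), by positivity, min_le_left _ _, min_le_right _ _⟩
  obtain ⟨β, J, hβ, hβ1, hclasses⟩ := exists_classes hμ hμ1 hσ hσμ
  obtain ⟨c₂, hc₂, hc₂1, hspread⟩ := exists_spread_embedding k Δ hd hd1 (β := β / 4)
    (by positivity) (by linarith)
  have hσ1 : σ ≤ 1 := hσc.trans hc₁1
  set δ := β * μ / 16 with hδ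
  have hδ0 : 0 < δ := by positivity
  set η := σ * δ with hη
  have hη0 : 0 < η := by positivity
  set c₃ := c₂ * δ / (Δ + 1) with hc₃
  have hc₃0 : 0 < c₃ := by positivity
  have hlogJ : 0 ≤ Real.log (J + 1 : ℝ) :=
    Real.log_nonneg (by linarith [(Nat.cast_nonneg J : (0:ℝ) ≤ J)])
  obtain ⟨c, hc, hcc₁, hcc₂, hcσ, hcμ, hcη, hcJ⟩ := exists_pos_le_six hc₁ hc₂ hσ
    (show 0 < μ / 4 by positivity) (show 0 < η / (3 * (Δ + 1)) by positivity)
    (show 0 < c₃ / (2 * (2 + Real.log (J + 1 : ℝ))) by positivity)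
  refine ⟨c, β, J, hc, by linarith, ?_⟩
  intro V _ _ G hdeg hLD W _ H hWV hH hcol w hw1 hwc hwlog 𝒲 h𝒲 hcl hpw hcov X hX
  set n : ℝ := ((Fintype.card V : ℕ) : ℝ) with hn
  have hn0 : 0 < n := by rw [hn]; exact_mod_cast Fintype.card_pos
  have hne : Nonempty W := Fintype.card_pos_iff.1 (hWV ▸ Fintype.card_pos)
  obtain ⟨s, part, cl, hs, hpart, hcls, hV, hclos⟩ := hclasses V G hdeg
  have hw1' : (1 : ℝ) ≤ w := by exact_mod_cast hw1
  have hwη : (w : ℝ) ≤ η * n / 3 := by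
    calc (w : ℝ) ≤ c * n := hwc
      _ ≤ η / (3 * (Δ + 1)) * n := by gcongr
      _ ≤ η / 3 * n := by
        gcongr
        linarith [(Nat.cast_nonneg Δ : (0:ℝ) ≤ Δ)]
      _ = _ := by ring
  have hηδ : η ≤ δ := by rw [hη]; exact mul_le_of_le_one_left hδ0.le hσ1
  have hηδn : η * n ≤ δ * n := by gcongr
  have hδβ : δ ≤ β / 16 := by rw [hδ]; nlinarith
  have hδμ : δ ≤ μ / 16 := by rw [hδ]; nlinarith
  have hδβn : δ * n ≤ β / 16 * n := by gcongr
  have hδμn : δ * n ≤ μ / 16 * n := by gcongr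
  have hβn : β * n ≤ n := mul_le_of_le_one_left hn0.le hβ1
  have hμn : μ * n ≤ n := mul_le_of_le_one_left hn0.le hμ1
  have hmass : ((∑ p ∈ 𝒲, p.card : ℕ) : ℝ) = n := by
    rw [← card_biUnion_id h𝒲, hcov, Finset.card_univ, hWV]
  -- the targets
  set tZ := ⌈η * n⌉₊ with htZ
  have htZ1 : η * n ≤ tZ := Nat.le_ceil _
  have htZ2 : (tZ : ℝ) + w ≤ 2 * (η * n) := by
    have := Nat.ceil_lt_add_one (show 0 ≤ η * n by positivity)
    linarith
  have hsZ : (s : ℝ) * (tZ + w) ≤ 2 * (δ * n) := by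
    calc (s : ℝ) * (tZ + w) ≤ s * (2 * (η * n)) := by gcongr
      _ = (σ * s) * (2 * (δ * n)) := by rw [hη]; ring
      _ ≤ 1 * (2 * (δ * n)) := by gcongr
      _ = _ := one_mul _
  obtain ⟨𝒵, h𝒵, h𝒵d⟩ := exists_disjoint_subfamilies (t := tZ) hpw s (by
    have : (s : ℝ) * (tZ + w) ≤ (∑ p ∈ 𝒲, p.card : ℕ) := by rw [hmass]; linarith
    exact_mod_cast this)
  set 𝒵' := (Finset.range s).biUnion 𝒵 with h𝒵'
  have h𝒵'sub : 𝒵' ⊆ 𝒲 := Finset.biUnion_subset.2 fun i hi => (h𝒵 i (Finset.mem_range.1 hi)).1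
  have hZcard : ∀ i < s, ((𝒵 i).biUnion id).card = ∑ p ∈ 𝒵 i, p.card := fun i hi =>
    card_biUnion_id (h𝒲.subset (Finset.coe_subset.2 (h𝒵 i hi).1))
  have hZcl : ∀ i < s, AdjClosed H ((𝒵 i).biUnion id) := fun i hi =>
    AdjClosed.biUnion fun p hp => hcl p ((h𝒵 i hi).1 hp)
  have hZd : ∀ i < s, ∀ j < s, i ≠ j → Disjoint ((𝒵 i).biUnion id) ((𝒵 j).biUnion id) :=
    fun i hi j hj hij => disjoint_biUnion_id h𝒲 (h𝒵 i hi).1 (h𝒵 j hj).1 (h𝒵d i hi j hj hij)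
  have hZ'eq : 𝒵'.biUnion id = (Finset.range s).biUnion fun i => (𝒵 i).biUnion id := by
    rw [h𝒵', Finset.biUnion_biUnion]
  have hZ'card : ((𝒵'.biUnion id).card : ℝ) ≤ 2 * (δ * n) := by
    refine le_trans ?_ hsZ
    have : (𝒵'.biUnion id).card ≤ (Finset.range s).card * (tZ + w) := by
      rw [hZ'eq]
      refine Finset.card_biUnion_le_card_mul _ _ _ fun i hi => ?_
      rw [hZcard i (Finset.mem_range.1 hi)]
      exact (h𝒵 i (Finset.mem_range.1 hi)).2.2
    rw [Finset.card_range] at this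
    exact_mod_cast this
  set P : ℕ → Finset V := fun i => Finset.univ.filter fun v => cl v = i ∧ part v = i with hP
  have hPd : ∀ i < s, ∀ j < s, i ≠ j → Disjoint (P i) (P j) := by
    intro i _ j _ hij
    rw [Finset.disjoint_left]
    intro v hv hv'
    exact hij ((Finset.mem_filter.1 hv).2.1.symm.trans (Finset.mem_filter.1 hv').2.1)
  have hpwc : ∀ p ∈ 𝒲, (p.card : ℝ) ≤ c * n := fun p hp =>
    le_trans (by exact_mod_cast hpw p hp) hwc
  obtain ⟨fZ, hfZ, hfZP, hfZc⟩ := hpar V G (hLD.mono (by gcongr)) W H hH hcol 𝒲 h𝒲 hcl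
    (fun p hp => (hpwc p hp).trans (by gcongr)) s (fun i => (𝒵 i).biUnion id) P
    (fun i hi => Finset.biUnion_subset_biUnion_of_subset_left _ (h𝒵 i hi).1) hZcl hZd hPd (by
      intro i hi
      have h1 := hV i hi
      have h2 : (((𝒵 i).biUnion id).card : ℝ) ≤ tZ + w := by
        rw [hZcard i hi]; exact_mod_cast (h𝒵 i hi).2.2
      linarith)
  rw [← hZ'eq] at hfZ
  set I : W → Finset V := fun x =>
    (P (part (fZ x))).filter fun a => NbhdInto H fZ x (G.Adj a) with hI
  have hIeq : ∀ i < s, ∀ x ∈ (𝒵 i).biUnion id,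
      I x = (P i).filter fun a => NbhdInto H fZ x (G.Adj a) := by
    intro i hi x hx
    have := (Finset.mem_filter.1 (hfZP i hi x hx)).2.2
    simp only [hI, this]
  -- the vertices for rerouting
  have hsdmass : ((∑ p ∈ 𝒲 \ 𝒵', p.card : ℕ) : ℝ) ≥ n - 2 * (δ * n) := by
    have h1 := Finset.sum_sdiff h𝒵'sub (f := Finset.card)
    rw [← card_biUnion_id (h𝒲.subset (Finset.coe_subset.2 h𝒵'sub))] at h1
    have h2 : ((∑ p ∈ 𝒲 \ 𝒵', p.card : ℕ) : ℝ) + (𝒵'.biUnion id).card = n := by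
      rw [← hmass]; exact_mod_cast h1
    linarith
  set tD := ⌈δ * n⌉₊ with htD
  have htD1 : δ * n ≤ tD := Nat.le_ceil _
  have htD2 : (tD : ℝ) + w ≤ 2 * (δ * n) := by
    have := Nat.ceil_lt_add_one (show 0 ≤ δ * n by positivity)
    linarith
  obtain ⟨𝒟, h𝒟sub, h𝒟1, h𝒟2⟩ := exists_subfamily_card (𝒲 := 𝒲 \ 𝒵') (w := w) (t := tD)
    (fun p hp => hpw p (Finset.mem_sdiff.1 hp).1) (by
      have : (tD : ℝ) ≤ (∑ p ∈ 𝒲 \ 𝒵', p.card : ℕ) := by linarith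
      exact_mod_cast this)
  have h𝒟𝒲 : 𝒟 ⊆ 𝒲 := h𝒟sub.trans Finset.sdiff_subset
  have h𝒟𝒵 : Disjoint 𝒵' 𝒟 := Finset.disjoint_sdiff.mono_right h𝒟sub
  have hDd := h𝒲.subset (Finset.coe_subset.2 h𝒟𝒲)
  have hDcl : AdjClosed H (𝒟.biUnion id) := AdjClosed.biUnion fun p hp => hcl p (h𝒟𝒲 hp)
  have hDcard1 : δ * n ≤ (𝒟.biUnion id).card := by
    rw [card_biUnion_id hDd]; exact htD1.trans (by exact_mod_cast h𝒟1)
  have hDcard2 : ((𝒟.biUnion id).card : ℝ) ≤ 2 * (δ * n) := by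
    rw [card_biUnion_id hDd]; exact le_trans (by exact_mod_cast h𝒟2) htD2
  have hZD : Disjoint (𝒵'.biUnion id) (𝒟.biUnion id) :=
    disjoint_biUnion_id h𝒲 h𝒵'sub h𝒟𝒲 h𝒟𝒵
  set B : V → W → ℕ → Finset V := fun u z j =>
    (closureSeq G (β * n) (I z) j).filter (G.Adj u) with hB
  set T : V × W × Fin (J + 1) → Finset V := fun θ =>
    if β * n ≤ ((B θ.1 θ.2.1 θ.2.2).card : ℝ) then B θ.1 θ.2.1 θ.2.2 else Finset.univ with hT
  have hTcard : ∀ θ, β * n ≤ ((T θ).card : ℝ) := by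
    intro θ
    simp only [hT]
    split_ifs with h
    · exact h
    · rw [Finset.card_univ]; exact hβn
  obtain ⟨fD, hfD, hfDU, hfDc⟩ := hspread V G (hLD.mono (by gcongr)) W H hH hcol w (by linarith)
    (hwc.trans (by gcongr)) (V × W × Fin (J + 1)) T X 𝒟 hDd (fun p hp => hcl p (h𝒟𝒲 hp))
    (fun p hp => by exact_mod_cast hpw p (h𝒟𝒲 hp)) (Finset.univ \ (𝒵'.biUnion id).image fZ) (by
      intro θ
      have h1 : T θ ∩ (Finset.univ \ (𝒵'.biUnion id).image fZ) =
          T θ \ (𝒵'.biUnion id).image fZ := by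
        ext; simp
      rw [h1]
      have := card_sdiff_image_le (T θ) fZ (𝒵'.biUnion id) (hTcard θ) hZ'card
      linarith)
  set f : W → V := fun x => if x ∈ 𝒵'.biUnion id then fZ x else fD x with hf
  have hfZeq : ∀ x ∈ 𝒵'.biUnion id, f x = fZ x := fun x hx => by simp only [hf, if_pos hx]
  have hfDeq : ∀ x ∈ 𝒟.biUnion id, f x = fD x := fun x hx => by
    simp only [hf, if_neg (Finset.disjoint_right.1 hZD hx)]
  have hZicl : ∀ i < s, (𝒵 i).biUnion id ⊆ 𝒵'.biUnion id := fun i hi =>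
    Finset.biUnion_subset_biUnion_of_subset_left _
      (Finset.subset_biUnion_of_mem 𝒵 (Finset.mem_range.2 hi))
  have hUeq : (𝒵' ∪ 𝒟).biUnion id = 𝒵'.biUnion id ∪ 𝒟.biUnion id := Finset.union_biUnion
  have hUcard : (((𝒵' ∪ 𝒟).biUnion id).card : ℝ) ≤ 4 * (δ * n) := by
    rw [hUeq, Finset.card_union_of_disjoint hZD]
    push_cast
    linarith
  have hDX : c₃ * n ≤ c₂ * ((X ∩ 𝒟.biUnion id).card : ℝ) := by
    have h1 : ((𝒟.biUnion id).card : ℝ) ≤ (X ∩ 𝒟.biUnion id).card * (Δ + 1) := by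
      exact_mod_cast hX _ hDcl
    have h2 : δ * n / (Δ + 1) ≤ ((X ∩ 𝒟.biUnion id).card : ℝ) := by
      rw [div_le_iff₀ hΔ0]; linarith
    calc c₃ * n = c₂ * (δ * n / (Δ + 1)) := by rw [hc₃]; ring
      _ ≤ _ := by gcongr
  have hlogΘ : w * Real.log (Fintype.card (V × W × Fin (J + 1))) ≤ c₃ / 2 * n := by
    have h1 : Real.log (Fintype.card (V × W × Fin (J + 1))) =
        2 * Real.log n + Real.log (J + 1 : ℝ) := by
      rw [Fintype.card_prod, Fintype.card_prod, Fintype.card_fin, hWV]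
      push_cast
      rw [← hn, Real.log_mul hn0.ne' (by positivity), Real.log_mul hn0.ne' (by positivity)]
      ring
    rw [h1]
    have h2 : c * (2 + Real.log (J + 1 : ℝ)) ≤ c₃ / 2 := by
      rw [le_div_iff₀ (by positivity)] at hcJ ⊢
      linarith
    calc (w : ℝ) * (2 * Real.log n + Real.log (J + 1 : ℝ))
        = 2 * (w * Real.log n) + w * Real.log (J + 1 : ℝ) := by ring
      _ ≤ 2 * (c * n) + c * n * Real.log (J + 1 : ℝ) := by gcongr
      _ = c * (2 + Real.log (J + 1 : ℝ)) * n := by ring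
      _ ≤ _ := by gcongr
  have hc₃c : c ≤ c₃ / 2 := by
    refine hcJ.trans ?_
    gcongr
    linarith
  refine ⟨s, cl, 𝒵' ∪ 𝒟, f, X ∩ 𝒟.biUnion id, fun i => X ∩ (𝒵 i).biUnion id, I, ?_, hcls,
    Finset.union_subset h𝒵'sub h𝒟𝒲, ?_, ?_, ?_, ?_, ?_, ?_, ?_⟩
  · exact le_trans (by gcongr) hs
  · rw [hUeq]
    refine (hfZ.congr hfZeq).union (hfD.congr hfDeq)
      (AdjClosed.biUnion fun p hp => hcl p (h𝒵'sub hp)) hDcl fun x hx y hy hxy => ?_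
    rw [hfZeq x hx, hfDeq y hy] at hxy
    have := hfDU y hy
    rw [← hxy, Finset.mem_sdiff] at this
    exact this.2 (Finset.mem_image_of_mem _ hx)
  · linarith
  · intro i hi
    have h1 : μ / 2 * n ≤ ((Finset.univ.filter fun v => cl v = i).card : ℝ) :=
      (hV i hi).trans (Nat.cast_le.2 (Finset.card_le_card fun v hv =>
        Finset.mem_filter.2 ⟨Finset.mem_univ v, (Finset.mem_filter.1 hv).2.1⟩))
    have h2 := card_sdiff_image_le _ f _ h1 hUcard
    have h3 : c * n ≤ μ / 4 * n := by gcongr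
    linarith
  · rw [hUeq]
    exact Finset.inter_subset_inter_left Finset.subset_union_right
  · intro i hi
    refine ⟨?_, ?_, ?_⟩
    · rw [hUeq]
      exact Finset.inter_subset_inter_left ((hZicl i hi).trans Finset.subset_union_left)
    · exact (hZD.mono_left (hZicl i hi)).mono Finset.inter_subset_right Finset.inter_subset_right
    · have h1 : (((𝒵 i).biUnion id).card : ℝ) ≤ (X ∩ (𝒵 i).biUnion id).card * (Δ + 1) := by
        exact_mod_cast hX _ (hZcl i hi)
      have h2 : η * n ≤ ((𝒵 i).biUnion id).card := by
        rw [hZcard i hi]; exact htZ1.trans (by exact_mod_cast (h𝒵 i hi).2.1)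
      have h3 : η / (Δ + 1) * n ≤ ((X ∩ (𝒵 i).biUnion id).card : ℝ) := by
        rw [div_mul_eq_mul_div, div_le_iff₀ hΔ0]; linarith
      refine le_trans ?_ h3
      gcongr
      refine hcη.trans ?_
      gcongr
      linarith
  · exact fun i hi j hj hij =>
      (hZd i hi j hj hij).mono Finset.inter_subset_right Finset.inter_subset_right
  · intro i hi z hz
    have hzi := (Finset.mem_inter.1 hz).2
    have hzZ := hZicl i hi hzi
    refine ⟨fun a ha y hy => ?_, ?_, fun u j hj hb => ?_⟩
    · rw [hIeq i hi z hzi] at ha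
      have h1 := (Finset.mem_filter.1 ha).2 y (Or.inr hy)
      rwa [hfZeq y (AdjClosed.biUnion (fun p hp => hcl p (h𝒵'sub hp)) z hzZ y hy)]
    · refine hclos i hi (I z) ?_ ?_
      · rw [hIeq i hi z hzi]
        intro a ha
        rw [Finset.mem_filter]
        exact ⟨Finset.mem_univ _, (Finset.mem_filter.1 (Finset.mem_filter.1 ha).1).2.2⟩
      · rw [hIeq i hi z hzi]
        exact le_trans (by gcongr) (hfZc i hi z hzi)
    · have h1 := hfDc (u, z, ⟨j, by omega⟩)
      have h2 : T (u, z, ⟨j, by omega⟩) = B u z j := by simp only [hT]; exact if_pos hb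
      rw [h2] at h1
      have h3 : c * n ≤ c₃ / 2 * n := by gcongr
      have h4 : ((X ∩ 𝒟.biUnion id).filter fun x => NbhdInto H f x (· ∈ B u z j)) =
          (X ∩ 𝒟.biUnion id).filter fun x => NbhdInto H fD x (· ∈ B u z j) :=
        Finset.filter_congr fun x hx =>
          hDcl.nbhdInto_congr hfDeq (Finset.mem_inter.1 hx).2 _
      simp only [hB] at h4 h1
      rw [h4]
      linarith

end Frame

section Completion

variable {V W : Type}

/-- If `g` places the part of `H` outside `S` onto the targets, the leftover vertices are
absorbed by rerouting. -/
lemma exists_embedding_of_targets [Fintype V] [Fintype W] {G : SimpleGraph V} {H : SimpleGraph W}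
    {S D X : Finset W}
    {f g : W → V} {b : ℝ} {m J s : ℕ} {XZ A : ℕ → Finset W} {I : W → Finset V} {cl : V → ℕ}
    (hf : EmbOn G H f S) (hS : AdjClosed H S) (hX : ∀ x ∈ X, ∀ y ∈ X, ¬ H.Adj x y)
    (hDX : D ⊆ X ∩ S) (hcl : ∀ v, cl v < s)
    (hXZ : ∀ i < s, XZ i ⊆ X ∩ S ∧ Disjoint (XZ i) D)
    (hI : ∀ i < s, ∀ z ∈ XZ i, (∀ a ∈ I z, ∀ y, H.Adj z y → G.Adj a (f y)) ∧
      (∀ v, cl v = i → v ∈ closureSeq G b (I z) J) ∧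
      ∀ u, ∀ j < J, b ≤ (((closureSeq G b (I z) j).filter (G.Adj u)).card : ℝ) →
        m ≤ (D.filter fun x => NbhdInto H f x
          (· ∈ (closureSeq G b (I z) j).filter (G.Adj u))).card)
    (hAd : ∀ i < s, ∀ j < s, i ≠ j → Disjoint (A i) (A j))
    (hAS : (Finset.range s).biUnion A = Finset.univ \ S)
    (hA : ∀ i < s, (A i).card = ((Finset.univ \ S.image f).filter (cl · = i)).card)
    (hg : EmbOn G H g (Finset.univ \ S)) (hgZ : ∀ i < s, ∀ y ∈ A i, g y ∈ (XZ i).image f)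
    (hm : (J + 1) * (Finset.univ \ S.image f).card ≤ m) :
    ∃ F : W → V, Function.Injective F ∧ ∀ ⦃u v⦄, H.Adj u v → G.Adj (F u) (F v) := by
  rcases isEmpty_or_nonempty W with hW | hW
  · exact ⟨isEmptyElim, fun a => isEmptyElim a, fun a => isEmptyElim a⟩
  set L := Finset.univ \ S.image f with hL
  obtain ⟨e, he1, he2, he3⟩ := exists_matching_of_card_eq (fun v _ => hcl v) hAd hA
  have hpre : ∀ v ∈ L, ∃ x ∈ XZ (cl v), f x = g (e v) := fun v hv =>
    Finset.mem_image.1 (hgZ _ (hcl v) _ (he2 v hv))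
  choose! τ hτ hτg using hpre
  have heS : ∀ v ∈ L, e v ∈ Finset.univ \ S := fun v hv => by
    rw [← hAS]
    exact Finset.mem_biUnion.2 ⟨cl v, Finset.mem_range.2 (hcl v), he2 v hv⟩
  have hτXS : ∀ v ∈ L, τ v ∈ X ∩ S := fun v hv => (hXZ _ (hcl v)).1 (hτ v hv)
  obtain ⟨M, h, h1, -, h3, h4, -⟩ := exists_reroute_holes hf
    (hDX.trans Finset.inter_subset_right) I τ L
    (fun v hv y hy hyv => (Finset.mem_sdiff.1 hv).2 (hyv ▸ Finset.mem_image_of_mem f hy))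
    (fun v hv => ⟨(Finset.mem_inter.1 (hτXS v hv)).2,
      Finset.disjoint_left.1 (hXZ _ (hcl v)).2 (hτ v hv)⟩)
    (fun u hu v hv huv => by
      refine he1 hu hv (hg.1 (heS u hu) (heS v hv) ?_)
      rw [← hτg u hu, ← hτg v hv, huv])
    (fun v hv => (hI _ (hcl v) _ (hτ v hv)).1)
    (fun v hv => (hI _ (hcl v) _ (hτ v hv)).2.1 v rfl)
    (fun v hv => (hI _ (hcl v) _ (hτ v hv)).2.2) hm
  have hMX : M ⊆ X := by
    refine h3.trans (Finset.union_subset (hDX.trans Finset.inter_subset_left) ?_)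
    intro x hx
    obtain ⟨v, hv, rfl⟩ := Finset.mem_image.1 hx
    exact (Finset.mem_inter.1 (hτXS v hv)).1
  have hhS := h1.embOn hf fun x hx y hy => hX x (hMX hx) y (hMX hy)
  set F : W → V := fun x => if x ∈ S then h x else g x with hF
  have hFS : ∀ x ∈ S, F x = h x := fun x hx => if_pos hx
  have hFT : ∀ x ∈ Finset.univ \ S, F x = g x := fun x hx => if_neg (Finset.mem_sdiff.1 hx).2
  have hcl' : AdjClosed H (Finset.univ \ S) :=
    AdjClosed.sdiff (fun _ _ y _ => Finset.mem_univ y) hS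
  have hfin : EmbOn G H F (S ∪ (Finset.univ \ S)) := by
    refine (hhS.congr hFS).union (hg.congr hFT) hS hcl' fun x hx y hy hxy => ?_
    rw [hFS x hx, hFT y hy] at hxy
    obtain ⟨v, hv, rfl⟩ := he3 y (by rwa [hAS])
    exact h4 v hv x hx (by rw [hxy, hτg v hv])
  rw [Finset.union_sdiff_of_subset (Finset.subset_univ S)] at hfin
  exact ⟨F, fun x y hxy => hfin.1 (by simp) (by simp) hxy,
    fun x y hxy => hfin.2 x (by simp) y (by simp) hxy⟩

/-- Exact partition of a family of tiles into bins of prescribed sizes. -/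
lemma exists_bin_partition {H : SimpleGraph W} {w m₀ s : ℕ} (hw : 1 ≤ w) (hm₀ : 1 ≤ m₀)
    (hlarge : 33 * (w : ℝ) ^ 2 * (1 + Real.log ((m₀ + w : ℕ) : ℝ)) ≤ m₀) {ℓ : ℕ → ℕ}
    (hs : 1 ≤ s) {𝒲 : Finset (Finset W)} (hd : (𝒲 : Set (Finset W)).PairwiseDisjoint id)
    (hsplit : ∀ p ∈ 𝒲, SplitsCoprimely H p) (hpw : ∀ p ∈ 𝒲, p.card ≤ w)
    (hℓ : ∀ i < s, s * (m₀ + w) ≤ ℓ i) (hsum : ∑ i ∈ Finset.range s, ℓ i = ∑ p ∈ 𝒲, p.card) :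
    ∃ A : ℕ → Finset W, (∀ i < s, AdjClosed H (A i) ∧ (A i).card = ℓ i) ∧
      (∀ i < s, ∀ j < s, i ≠ j → Disjoint (A i) (A j)) ∧
      (Finset.range s).biUnion A = 𝒲.biUnion id := by
  obtain ⟨q, rfl⟩ : ∃ q, s = q + 1 := ⟨s - 1, by omega⟩
  have hq : (q + 1) * (m₀ + w) = q * (m₀ + w) + (m₀ + w) := by ring
  rw [Finset.sum_range_succ] at hsum
  have hℓq := hℓ q (by omega)
  obtain ⟨A, hA, hAd⟩ := exists_bins hw hm₀ hlarge ℓ q 𝒲 hd hsplit hpw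
    (fun i hi => le_trans (by omega) (hℓ i (by omega))) (by omega)
  set U := (Finset.range q).biUnion A with hU
  have hUsub : U ⊆ 𝒲.biUnion id :=
    Finset.biUnion_subset.2 fun i hi => (hA i (Finset.mem_range.1 hi)).1
  have hUcard : U.card = ∑ i ∈ Finset.range q, ℓ i := by
    rw [hU, Finset.card_biUnion fun i hi j hj hij =>
      hAd i (Finset.mem_range.1 hi) j (Finset.mem_range.1 hj) hij]
    exact Finset.sum_congr rfl fun i hi => (hA i (Finset.mem_range.1 hi)).2.2
  have hAne : ∀ i < q, Function.update A q (𝒲.biUnion id \ U) i = A i := fun i hi =>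
    Function.update_of_ne hi.ne _ _
  have hdis : ∀ i < q, Disjoint (A i) (𝒲.biUnion id \ U) := fun i hi =>
    Finset.disjoint_sdiff.mono_left (Finset.subset_biUnion_of_mem A (Finset.mem_range.2 hi))
  refine ⟨Function.update A q (𝒲.biUnion id \ U), fun i hi => ?_, fun i hi j hj hij => ?_, ?_⟩
  · rcases Nat.lt_succ_iff_lt_or_eq.1 hi with hi' | rfl
    · rw [hAne i hi']; exact (hA i hi').2
    · rw [Function.update_self]
      refine ⟨(AdjClosed.biUnion fun p hp => (hsplit p hp).adjClosed).sdiff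
        (AdjClosed.range_biUnion fun i hi => (hA i hi).2.1), ?_⟩
      have := Finset.card_sdiff_add_card_eq_card hUsub
      rw [card_biUnion_id hd] at this
      omega
  · rcases Nat.lt_succ_iff_lt_or_eq.1 hi with hi' | hi' <;>
      rcases Nat.lt_succ_iff_lt_or_eq.1 hj with hj' | hj'
    · rw [hAne i hi', hAne j hj']; exact hAd i hi' j hj' hij
    · rw [hAne i hi', hj', Function.update_self]; exact hdis i hi'
    · rw [hAne j hj', hi', Function.update_self]; exact (hdis j hj').symm
    · omega
  · rw [Finset.range_add_one, Finset.biUnion_insert, Function.update_self,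
      Finset.biUnion_congr rfl fun i hi => hAne i (Finset.mem_range.1 hi), ← hU,
      Finset.sdiff_union_of_subset hUsub]

end Completion

lemma exists_spanning_embedding (k Δ : ℕ) {d μ : ℝ} (hd : 0 < d) (hd1 : d ≤ 1) (hμ : 0 < μ)
    (hμ1 : μ ≤ 1) :
    ∃ c : ℝ, 0 < c ∧ c ≤ 1 ∧ ∀ (V : Type) [Fintype V] [Nonempty V] (G : SimpleGraph V),
      (∀ v, μ * Fintype.card V ≤ ((Finset.univ.filter (G.Adj v)).card : ℝ)) →
      LocDense G d (c * Fintype.card V) Finset.univ →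
      ∀ (W : Type) [Fintype W] (H : SimpleGraph W), Fintype.card W = Fintype.card V →
      DegLe H Δ → H.Colorable k →
      ∀ w m₀ : ℕ, 1 ≤ w → 1 ≤ m₀ → (m₀ : ℝ) + w ≤ c * Fintype.card V →
      w * Real.log (Fintype.card V) ≤ c * Fintype.card V →
      33 * (w : ℝ) ^ 2 * (1 + Real.log ((m₀ + w : ℕ) : ℝ)) ≤ m₀ →
      ∀ 𝒲 : Finset (Finset W), (𝒲 : Set (Finset W)).PairwiseDisjoint id →
      (∀ p ∈ 𝒲, SplitsCoprimely H p) → (∀ p ∈ 𝒲, p.card ≤ w) → 𝒲.biUnion id = Finset.univ →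
      ∃ F : W → V, Function.Injective F ∧ ∀ ⦃u v⦄, H.Adj u v → G.Adj (F u) (F v) := by
  obtain ⟨a, β, J, ha, ha1, hframe⟩ := exists_frame k Δ hd hd1 hμ hμ1
  have hJ : (0 : ℝ) ≤ J := Nat.cast_nonneg J
  set τ := a / (4 * (J + 1)) with hτ
  have hτ0 : 0 < τ := by positivity
  have hτa : τ ≤ a / 4 := by
    rw [hτ]; gcongr; linarith
  have hτJ : (J + 1) * (2 * τ) ≤ a := by
    have : (J + 1) * (2 * τ) = a / 2 := by rw [hτ]; field_simp; ring
    linarith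
  obtain ⟨c', hc', hc'1, hpar⟩ := exists_parallel_embedding k Δ hd hd1 (γ := τ / 2) (by positivity)
    (by linarith)
  obtain ⟨c, hc, hca, hcc', hcτ⟩ : ∃ c, 0 < c ∧ c ≤ a ∧ c ≤ c' ∧ c ≤ a ^ 2 * τ / 2 :=
    ⟨min a (min c' (a ^ 2 * τ / 2)), by positivity, by simp, by simp, by simp⟩
  refine ⟨c, hc, by linarith, ?_⟩
  intro V _ _ G hdeg hLD W _ H hWV hH hcol w m₀ hw hm₀ hmw hwlog hlarge 𝒲 h𝒲 hsplit hpw hcov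
  set n : ℝ := ((Fintype.card V : ℕ) : ℝ) with hn
  have hn0 : 0 < n := by rw [hn]; exact_mod_cast Fintype.card_pos
  have hm₀0 : (1 : ℝ) ≤ m₀ := by exact_mod_cast hm₀
  have hwc : (w : ℝ) ≤ c * n := by linarith
  have hcl : ∀ p ∈ 𝒲, AdjClosed H p := fun p hp => (hsplit p hp).adjClosed
  obtain ⟨X, hX, hXC⟩ := exists_large_independent hH
  obtain ⟨s, cl, 𝒰, f, D, XZ, I, hs, hcls, h𝒰, hf, hUcard, hfree, hD, hXZ, hXZd, hI⟩ :=
    hframe V G hdeg (hLD.mono (by gcongr)) W H hWV hH hcol w hw (hwc.trans (by gcongr))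
      (hwlog.trans (by gcongr)) 𝒲 h𝒲 hcl hpw hcov X hXC
  have hs1 : 1 ≤ s := by
    obtain ⟨v⟩ := ‹Nonempty V›
    exact Nat.one_le_of_lt (hcls v)
  have hs1' : (1 : ℝ) ≤ s := by exact_mod_cast hs1
  have hmass : ((∑ p ∈ 𝒲, p.card : ℕ) : ℝ) = n := by
    rw [← card_biUnion_id h𝒲, hcov, Finset.card_univ, hWV]
  have hca' : c * n ≤ τ / 2 * n := by
    gcongr
    refine hcτ.trans ?_
    have : a ^ 2 ≤ 1 := pow_le_one₀ ha.le ha1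
    nlinarith
  have hτan : τ * n ≤ a / 4 * n := by gcongr
  have han : a * n ≤ n := mul_le_of_le_one_left hn0.le ha1
  -- the family completing the leftover
  have hsplitmass : ∀ 𝒜 ⊆ 𝒲, ((∑ p ∈ 𝒲 \ 𝒜, p.card : ℕ) : ℝ) + (𝒜.biUnion id).card = n := by
    intro 𝒜 h𝒜
    rw [card_biUnion_id (h𝒲.subset (Finset.coe_subset.2 h𝒜)), ← hmass,
      ← Finset.sum_sdiff h𝒜]
    push_cast
    rfl
  set t := ⌈τ * n⌉₊ with ht
  have ht1 : τ * n ≤ t := Nat.le_ceil _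
  have ht2 : (t : ℝ) + w ≤ 2 * (τ * n) := by
    have := Nat.ceil_lt_add_one (show 0 ≤ τ * n by positivity)
    linarith
  obtain ⟨𝒯, h𝒯sub, h𝒯1, h𝒯2⟩ := exists_subfamily_card (𝒲 := 𝒲 \ 𝒰) (w := w) (t := t)
    (fun p hp => hpw p (Finset.mem_sdiff.1 hp).1) (by
      have : (t : ℝ) ≤ (∑ p ∈ 𝒲 \ 𝒰, p.card : ℕ) := by linarith [hsplitmass 𝒰 h𝒰]
      exact_mod_cast this)
  have h𝒯 : 𝒯 ⊆ 𝒲 := h𝒯sub.trans Finset.sdiff_subset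
  have h𝒯d := h𝒲.subset (Finset.coe_subset.2 h𝒯)
  rw [← card_biUnion_id h𝒯d] at h𝒯1 h𝒯2
  have hT1 : τ * n ≤ (𝒯.biUnion id).card := ht1.trans (by exact_mod_cast h𝒯1)
  have hT2 : ((𝒯.biUnion id).card : ℝ) ≤ 2 * (τ * n) := le_trans (by exact_mod_cast h𝒯2) ht2
  have hUT : Disjoint 𝒰 𝒯 := Finset.disjoint_sdiff.mono_right h𝒯sub
  set 𝒬 := 𝒲 \ (𝒰 ∪ 𝒯) with h𝒬
  have h𝒬𝒲 : 𝒬 ⊆ 𝒲 := Finset.sdiff_subset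
  have hUQ : Disjoint (𝒰.biUnion id) (𝒬.biUnion id) := disjoint_biUnion_id h𝒲 h𝒰 h𝒬𝒲
    (Finset.disjoint_sdiff.mono_left Finset.subset_union_left)
  have hTUQ : Disjoint 𝒯 (𝒰 ∪ 𝒬) := Finset.disjoint_union_right.2
    ⟨hUT.symm, Finset.disjoint_sdiff.mono_left Finset.subset_union_right⟩
  have hall : 𝒯 ∪ (𝒰 ∪ 𝒬) = 𝒲 := by
    rw [← Finset.union_assoc, Finset.union_comm 𝒯 𝒰, h𝒬,
      Finset.union_sdiff_of_subset (Finset.union_subset h𝒰 h𝒯)]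
  set S := 𝒰.biUnion id ∪ 𝒬.biUnion id with hS
  have hSeq : S = (𝒰 ∪ 𝒬).biUnion id := Finset.union_biUnion.symm
  have hTS : Finset.univ \ S = 𝒯.biUnion id := by
    rw [← hcov, ← hall, Finset.union_biUnion, ← hSeq, Finset.union_sdiff_right]
    refine Finset.sdiff_eq_self_of_disjoint ?_
    rw [hSeq]
    exact disjoint_biUnion_id h𝒲 h𝒯 (Finset.union_subset h𝒰 h𝒬𝒲) hTUQ
  have hScard : ((𝒯.biUnion id).card : ℝ) + S.card = n := by
    have := Finset.card_sdiff_add_card_eq_card (Finset.subset_univ S)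
    rw [hTS, Finset.card_univ, hWV] at this
    rw [hn]
    exact_mod_cast this
  have hUQcard : S.card = (𝒰.biUnion id).card + (𝒬.biUnion id).card :=
    Finset.card_union_of_disjoint hUQ
  -- reserving vertices in every class
  set r := s * (m₀ + w) with hr
  have hsr : (s : ℝ) * r ≤ τ / 2 * n := by
    have h1 : a * a * ((s : ℝ) * r) ≤ a * a * (τ / 2 * n) := by
      calc a * a * ((s : ℝ) * r) = (a * s) * (a * s) * (m₀ + w) := by rw [hr]; push_cast; ring
        _ ≤ 1 * 1 * (c * n) := by gcongr
        _ ≤ 1 * 1 * (a ^ 2 * τ / 2 * n) := by gcongr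
        _ = _ := by ring
    exact le_of_mul_le_mul_left h1 (by positivity)
  have hra : (r : ℝ) ≤ a * n := by
    have : (r : ℝ) ≤ s * r := le_mul_of_one_le_left (Nat.cast_nonneg r) hs1'
    linarith
  have hres : ∀ i, i < s → ∃ R ⊆ (Finset.univ.filter fun v => cl v = i) \ (𝒰.biUnion id).image f,
      R.card = r := fun i hi => by
    refine Finset.exists_subset_card_eq ?_
    have := hra.trans (hfree i hi)
    exact_mod_cast this
  choose! R hR hRcard using hres
  set R' := (Finset.range s).biUnion R with hR'
  have hR'card : (R'.card : ℝ) ≤ τ / 2 * n := by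
    refine le_trans ?_ hsr
    have := Finset.card_biUnion_le_card_mul (Finset.range s) R r
      fun i hi => (hRcard i (Finset.mem_range.1 hi)).le
    rw [Finset.card_range] at this
    exact_mod_cast this
  -- embedding everything except the completing family
  have hQ₀ : ((𝒬.biUnion id).card : ℝ) + τ / 2 * n ≤
      (((Finset.univ \ (𝒰.biUnion id).image f) \ R').card : ℝ) := by
    have h1 := card_sdiff_image_ge Finset.univ f (𝒰.biUnion id)
    rw [Finset.card_univ, ← hn] at h1
    have h2 : ((Finset.univ \ (𝒰.biUnion id).image f).card : ℝ) ≤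
        ((Finset.univ \ (𝒰.biUnion id).image f) \ R').card + R'.card := by
      exact_mod_cast Finset.card_le_card_sdiff_add_card
    have h3 : (S.card : ℝ) = (𝒰.biUnion id).card + (𝒬.biUnion id).card := by
      exact_mod_cast hUQcard
    linarith
  have hsmall : ∀ p ∈ 𝒲, (p.card : ℝ) ≤ c' * n := fun p hp =>
    le_trans (by exact_mod_cast hpw p hp) (hwc.trans (by gcongr))
  have hUcl : AdjClosed H (𝒰.biUnion id) := AdjClosed.biUnion fun p hp => hcl p (h𝒰 hp)
  have hQcl : AdjClosed H (𝒬.biUnion id) := AdjClosed.biUnion fun p hp => hcl p (h𝒬𝒲 hp)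
  obtain ⟨f₁, hf₁, hf₁Q, -⟩ := hpar V G (hLD.mono (by gcongr)) W H hH hcol 𝒲 h𝒲 hcl hsmall 1
    (fun _ => 𝒬.biUnion id) (fun _ => (Finset.univ \ (𝒰.biUnion id).image f) \ R')
    (fun _ _ => Finset.biUnion_subset_biUnion_of_subset_left _ h𝒬𝒲) (fun _ _ => hQcl)
    (fun i hi j hj hij => by omega) (fun i hi j hj hij => by omega) (fun _ _ => hQ₀)
  rw [Finset.range_one, Finset.singleton_biUnion] at hf₁
  have hf₁Q' := hf₁Q 0 one_pos
  set f₂ : W → V := fun x => if x ∈ 𝒰.biUnion id then f x else f₁ x with hf₂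
  have hf₂U : ∀ x ∈ 𝒰.biUnion id, f₂ x = f x := fun x hx => if_pos hx
  have hf₂Q : ∀ x ∈ 𝒬.biUnion id, f₂ x = f₁ x := fun x hx =>
    if_neg (Finset.disjoint_right.1 hUQ hx)
  have hf₂S : EmbOn G H f₂ S := by
    refine (hf.congr hf₂U).union (hf₁.congr hf₂Q) hUcl hQcl fun x hx y hy hxy => ?_
    rw [hf₂U x hx, hf₂Q y hy] at hxy
    have := hf₁Q' y hy
    rw [← hxy] at this
    exact (Finset.mem_sdiff.1 (Finset.mem_sdiff.1 this).1).2 (Finset.mem_image_of_mem _ hx)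
  have hScl : AdjClosed H S := by
    rw [hSeq]
    exact AdjClosed.biUnion fun p hp => hcl p (Finset.union_subset h𝒰 h𝒬𝒲 hp)
  set L := Finset.univ \ S.image f₂ with hL
  have hLcard : L.card = (𝒯.biUnion id).card := by
    have h1 : L.card + (S.image f₂).card = (Finset.univ : Finset V).card := by
      rw [hL]
      convert Finset.card_sdiff_add_card_eq_card (Finset.subset_univ (S.image f₂))
    rw [Finset.card_image_of_injOn hf₂S.1, Finset.card_univ] at h1
    have h2 := Finset.card_sdiff_add_card_eq_card (Finset.subset_univ S)
    rw [hTS, Finset.card_univ, hWV] at h2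
    omega
  have hRL : ∀ i < s, R i ⊆ L.filter (cl · = i) := by
    intro i hi v hv
    obtain ⟨h1, h2⟩ := Finset.mem_sdiff.1 (hR i hi hv)
    refine Finset.mem_filter.2 ⟨Finset.mem_sdiff.2 ⟨Finset.mem_univ _, fun hmem => ?_⟩,
      (Finset.mem_filter.1 h1).2⟩
    obtain ⟨x, hx, hxv⟩ := Finset.mem_image.1 hmem
    rcases Finset.mem_union.1 hx with hx | hx
    · rw [hf₂U x hx] at hxv
      exact h2 (hxv ▸ Finset.mem_image_of_mem f hx)
    · rw [hf₂Q x hx] at hxv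
      refine (Finset.mem_sdiff.1 (hf₁Q' x hx)).2 ?_
      rw [hxv]
      exact Finset.mem_biUnion.2 ⟨i, Finset.mem_range.2 hi, hv⟩
  obtain ⟨A, hA, hAd, hAU⟩ := exists_bin_partition hw hm₀ hlarge
    (ℓ := fun i => (L.filter (cl · = i)).card) hs1 h𝒯d (fun p hp => hsplit p (h𝒯 hp))
    (fun p hp => hpw p (h𝒯 hp))
    (fun i hi => (hRcard i hi).symm.le.trans (Finset.card_le_card (hRL i hi))) (by
      rw [← card_biUnion_id h𝒯d, ← hLcard]
      exact (Finset.card_eq_sum_card_fiberwise fun v _ => by simpa using hcls v).symm)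
  have hAsub : ∀ i < s, A i ⊆ 𝒯.biUnion id := fun i hi => by
    rw [← hAU]; exact Finset.subset_biUnion_of_mem A (Finset.mem_range.2 hi)
  have hXZS : ∀ i < s, XZ i ⊆ X ∩ S := fun i hi =>
    (hXZ i hi).1.trans (Finset.inter_subset_inter_left Finset.subset_union_left)
  have hXZU : ∀ i < s, XZ i ⊆ 𝒰.biUnion id := fun i hi =>
    (hXZ i hi).1.trans Finset.inter_subset_right
  -- embedding the completing family onto the targets
  obtain ⟨g, hg, hgZ, -⟩ := hpar V G (hLD.mono (by gcongr)) W H hH hcol 𝒲 h𝒲 hcl hsmall s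
    A (fun i => (XZ i).image f₂)
    (fun i hi => (hAsub i hi).trans (Finset.biUnion_subset_biUnion_of_subset_left _ h𝒯))
    (fun i hi => (hA i hi).1) hAd (by
      intro i hi j hj hij
      rw [Finset.disjoint_left]
      intro v hv hv'
      obtain ⟨x, hx, rfl⟩ := Finset.mem_image.1 hv
      obtain ⟨y, hy, hxy⟩ := Finset.mem_image.1 hv'
      have := hf₂S.1 (Finset.mem_inter.1 (hXZS j hj hy)).2
        (Finset.mem_inter.1 (hXZS i hi hx)).2 hxy
      exact Finset.disjoint_left.1 (hXZd i hi j hj hij) hx (this ▸ hy)) (by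
      intro i hi
      rw [Finset.card_image_of_injOn (hf₂S.1.mono fun x hx =>
        Finset.mem_coe.2 (Finset.mem_inter.1 (hXZS i hi hx)).2)]
      have h1 : ((A i).card : ℝ) ≤ (𝒯.biUnion id).card := by
        exact_mod_cast Finset.card_le_card (hAsub i hi)
      have h2 := (hXZ i hi).2.2
      linarith)
  refine exists_embedding_of_targets (b := β * n) (m := ⌈a * n⌉₊) (J := J) (I := I)
    (g := g) hf₂S hScl hX
    (hD.trans (Finset.inter_subset_inter_left Finset.subset_union_left)) hcls
    (fun i hi => ⟨hXZS i hi, (hXZ i hi).2.1⟩) (fun i hi z hz => ?_) hAd (hAU.trans hTS.symm)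
    (fun i hi => (hA i hi).2) (by rwa [hTS, ← hAU]) hgZ ?_
  · obtain ⟨h1, h2, h3⟩ := hI i hi z hz
    refine ⟨fun x hx y hy => ?_, h2, fun u j hj hb => ?_⟩
    · rw [hf₂U y (hUcl z (hXZU i hi hz) y hy)]
      exact h1 x hx y hy
    · refine Nat.ceil_le.2 ((h3 u j hj hb).trans_eq ?_)
      congr 2
      exact Finset.filter_congr fun x hx =>
        (hUcl.nbhdInto_congr hf₂U (Finset.mem_inter.1 (hD hx)).2 _).symm
  · rw [← hL, hLcard]
    have h1 : ((J : ℝ) + 1) * (𝒯.biUnion id).card ≤ ⌈a * n⌉₊ := by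
      calc ((J : ℝ) + 1) * (𝒯.biUnion id).card ≤ (J + 1) * (2 * (τ * n)) := by gcongr
        _ = (J + 1) * (2 * τ) * n := by ring
        _ ≤ a * n := by gcongr
        _ ≤ _ := Nat.le_ceil _
    exact_mod_cast h1

lemma exists_tile_parameters {c : ℝ} (hc : 0 < c) (hc1 : c ≤ 1) :
    ∃ n₀ : ℕ, ∀ n : ℕ, n₀ ≤ n → 0 < n ∧ ∃ w m₀ : ℕ, w = ⌊Real.sqrt n / Real.log n⌋₊ ∧
      1 ≤ w ∧ 1 ≤ m₀ ∧ (m₀ : ℝ) + w ≤ c * n ∧ w * Real.log n ≤ c * n ∧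
      33 * (w : ℝ) ^ 2 * (1 + Real.log ((m₀ + w : ℕ) : ℝ)) ≤ m₀ := by
  have hlog : ∀ᶠ n : ℕ in Filter.atTop, max 1 (264 / c) ≤ Real.log n :=
    (Real.tendsto_log_atTop.comp tendsto_natCast_atTop_atTop).eventually_ge_atTop _
  have hsqrt : ∀ᶠ n : ℕ in Filter.atTop, 2 / c ≤ Real.sqrt n :=
    (Real.tendsto_sqrt_atTop.comp tendsto_natCast_atTop_atTop).eventually_ge_atTop _
  have hlin : ∀ᶠ n : ℕ in Filter.atTop, 4 / c ≤ (n : ℝ) :=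
    tendsto_natCast_atTop_atTop.eventually_ge_atTop _
  have hcmp : ∀ᶠ n : ℕ in Filter.atTop, Real.log n ≤ Real.sqrt n := by
    have h := (isLittleO_log_rpow_atTop (r := 1 / 2) (by norm_num)).bound one_pos
    filter_upwards [tendsto_natCast_atTop_atTop.eventually h] with n hn
    rw [← Real.sqrt_eq_rpow, one_mul, Real.norm_of_nonneg (Real.sqrt_nonneg _)] at hn
    exact (le_abs_self _).trans hn
  obtain ⟨n₀, h⟩ := Filter.eventually_atTop.1 (hlog.and (hsqrt.and (hlin.and hcmp)))
  refine ⟨n₀, fun n hn => ?_⟩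
  obtain ⟨h1, h2, h3, h4⟩ := h n hn
  have hl1 := (le_max_left _ _).trans h1
  have hl2 := (le_max_right _ _).trans h1
  rw [div_le_iff₀ hc] at h2 h3 hl2
  have hn0 : (0 : ℝ) < n := by nlinarith
  set ℓ := Real.log n
  set q := Real.sqrt n
  have hq : q * q = n := Real.mul_self_sqrt hn0.le
  have hℓ : 0 < ℓ := by linarith
  have hq0 : 0 < q := by linarith
  have hqn : q ≤ c * n / 2 := by nlinarith
  have hm : (⌊c * n / 2⌋₊ : ℝ) ≤ c * n / 2 := Nat.floor_le (by positivity)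
  have hm' : c * n / 2 < ⌊c * n / 2⌋₊ + 1 := Nat.lt_floor_add_one _
  have hw : (⌊q / ℓ⌋₊ : ℝ) ≤ q / ℓ := Nat.floor_le (by positivity)
  have hwℓ : (⌊q / ℓ⌋₊ : ℝ) * ℓ ≤ q := (le_div_iff₀ hℓ).1 hw
  have hwq : q / ℓ ≤ q := div_le_self hq0.le hl1
  have hw1 : 1 ≤ ⌊q / ℓ⌋₊ := Nat.le_floor (by rw [Nat.cast_one, le_div_iff₀ hℓ]; linarith)
  have hsum : (⌊c * n / 2⌋₊ : ℝ) + ⌊q / ℓ⌋₊ ≤ c * n := by linarith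
  refine ⟨by exact_mod_cast hn0, _, ⌊c * n / 2⌋₊, rfl, hw1,
    Nat.le_floor (by rw [Nat.cast_one]; linarith), hsum, by linarith, ?_⟩
  have hlogle : Real.log ((⌊c * n / 2⌋₊ + ⌊q / ℓ⌋₊ : ℕ) : ℝ) ≤ ℓ := by
    refine Real.log_le_log (by exact_mod_cast Nat.add_pos_right _ hw1) ?_
    push_cast
    nlinarith
  calc 33 * (⌊q / ℓ⌋₊ : ℝ) ^ 2 * (1 + Real.log ((⌊c * n / 2⌋₊ + ⌊q / ℓ⌋₊ : ℕ) : ℝ))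
      ≤ 33 * (q / ℓ) ^ 2 * (ℓ + ℓ) := by gcongr
    _ = 66 * n / ℓ := by rw [← hq]; field_simp; ring
    _ ≤ c * n / 4 := by rw [div_le_iff₀ hℓ]; nlinarith
    _ ≤ ⌊c * n / 2⌋₊ := by linarith

/-- Theorem 1.4 (perfect tilings in uniformly dense graphs). -/
theorem quasirandom (k Δ : ℕ) (hk : 1 < k) (hΔ : 1 < Δ) (d μ : ℝ) (hd : 0 < d) (hμ : 0 < μ) :
    ∃ ρ : ℝ, 0 < ρ ∧ ∃ n₀ : ℕ, ∀ n : ℕ, n₀ ≤ n → ∀ G H : SimpleGraph (Fin n),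
      UniformlyDense G ρ d →
      (∀ v, μ * n ≤ (ndeg G v : ℝ)) →
      IsTiling H (TileFc k (Real.sqrt n / Real.log n)) →
      H.chromaticNumber ≤ (k : ℕ∞) →
      (∀ v, ndeg H v ≤ Δ) →
      ContainsCopy G H := by
  obtain ⟨c, hc, hc1, hemb⟩ := exists_spanning_embedding k Δ
    (lt_min (half_pos hd) one_pos) (min_le_right _ _) (lt_min hμ one_pos) (min_le_right _ _)
  obtain ⟨n₀, hn₀⟩ := exists_tile_parameters hc hc1
  refine ⟨d * c ^ 2 / 4, by positivity, n₀, fun n hn G H hG hdeg hT hχ hΔH => ?_⟩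
  obtain ⟨hn0, w, m₀, hw, hw1, hm₀, hsum, hwlog, hlarge⟩ := hn₀ n hn
  obtain ⟨𝒲, h𝒲, hcover, htile⟩ := exists_tiles hT
  have : Nonempty (Fin n) := ⟨⟨0, hn0⟩⟩
  refine hemb (Fin n) G (fun v => ?_) (fun U hU hUc => ?_) (Fin n) H rfl (fun x => ?_)
    (SimpleGraph.chromaticNumber_le_iff_colorable.1 hχ) w m₀ hw1 hm₀
    (by rwa [Fintype.card_fin]) (by rwa [Fintype.card_fin]) hlarge 𝒲 h𝒲
    (fun p hp => (htile p hp).1) (fun p hp => hw ▸ Nat.le_floor (htile p hp).2) hcover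
  · rw [card_filter_adj, Fintype.card_fin]
    exact (mul_le_mul_of_nonneg_right (min_le_left _ _) n.cast_nonneg).trans (hdeg v)
  · exact (mul_le_mul_of_nonneg_right (min_le_left _ _) (sq_nonneg _)).trans
      (hG.locDense hc.le hd.le le_rfl U hU hUc)
  · rw [card_filter_adj]
    exact hΔH x

end Paper
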